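/- arXiv:2205.07932 — 2 statements merged into one kernel-verified Lean document; each statement's English description precedes it below -/
import Mathlib

section
/- Let V be an n×(p·d) random real matrix uniformly distributed on the Stiefel manifold V(n, p·d), with columns partitioned into p consecutive blocks of d columns. Let T ⊆ {1,…,p} with |T| = s and A ⊆ T, and suppose (p − s)·d ≥ n. For t₄, t₅, t₆ > 0 with √(s d/n) + t₄ < 1, √(s/p) + t₅ < 1, √(s/p) + t₆ < 1/3, set Δ = (3(√(s d/n) + t₄) + 3(√(s/p) + t₅)) / (1 − 3(√(s/p) + t₆)). Then P[ ‖√(p d/n)·V_A‖ ≥ (1 + Δ)^{1/2} ] ≤ 2·exp(−n t₄²/2) + 2·exp(−p d t₅²/2) + exp(−p d t₆²/2), and (provided Δ < 1, so that V_Aᵀ V_A is invertible on the complementary event) P[ ‖((p d/n)·V_Aᵀ V_A)^{−1}‖ ≥ (1 − Δ)^{−1} ] ≤ 2·exp(−n t₄²/2) + 2·exp(−p d t₅²/2) + exp(−p d t₆²/2). -/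
open MeasureTheory ProbabilityTheory Filter Matrix
open scoped ENNReal NNReal

noncomputable section

/-- Euclidean norm of a finite real vector. -/
def euclNorm {ι : Type*} [Fintype ι] (v : ι → ℝ) : ℝ := Real.sqrt (∑ i, v i ^ 2)

/-- Spectral norm (largest singular value) of a real matrix. -/
def specNorm {m n : Type*} [Fintype m] [Fintype n] [DecidableEq n] (A : Matrix m n ℝ) : ℝ :=
  ‖LinearMap.toContinuousLinearMap (Matrix.toEuclideanLin A)‖

instance {m n α : Type*} [MeasurableSpace α] : MeasurableSpace (Matrix m n α) :=
  inferInstanceAs (MeasurableSpace (m → n → α))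

/-- `V` is uniformly distributed on the Stiefel manifold `V(n, ι)`:
`V Vᵀ = I_n` almost surely and `V·O` has the same distribution as `V` for every
fixed orthogonal matrix `O`. -/
def IsUniformStiefel {Ω ι : Type*} [MeasurableSpace Ω] [Fintype ι] [DecidableEq ι]
    (P : Measure Ω) {n : ℕ} (V : Ω → Matrix (Fin n) ι ℝ) : Prop :=
  Measurable V ∧ (∀ᵐ ω ∂P, V ω * (V ω)ᵀ = 1) ∧
    ∀ O : Matrix ι ι ℝ, O * Oᵀ = 1 →
      Measure.map (fun ω => V ω * O) P = Measure.map V P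

/-- The submatrix of a block matrix `V` consisting of the column blocks indexed by `J`. -/
def blockCols {n p d : ℕ} (V : Matrix (Fin n) (Fin p × Fin d) ℝ) (J : Finset (Fin p)) :
    Matrix (Fin n) ({j // j ∈ J} × Fin d) ℝ :=
  fun i jk => V i (jk.1.1, jk.2)

/-- The `k`-th column block of a block matrix `V`. -/
def colBlock {n p d : ℕ} (V : Matrix (Fin n) (Fin p × Fin d) ℝ) (k : Fin p) :
    Matrix (Fin n) (Fin d) ℝ :=
  fun i l => V i (k, l)

/-- Standard Gaussian measure on `K → ℝ`. -/
def gam (K : Type*) [Fintype K] : Measure (K → ℝ) := Measure.pi (fun _ => gaussianReal 0 1)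

instance gam_prob (K : Type*) [Fintype K] : IsProbabilityMeasure (gam K) := by
  unfold gam; infer_instance

/-- density -/
def rho {K : Type*} [Fintype K] (x : K → ℝ) : ℝ := ∏ a, gaussianPDFReal 0 1 (x a)

lemma rho_nonneg {K : Type*} [Fintype K] (x : K → ℝ) : 0 ≤ rho x :=
  Finset.prod_nonneg fun _ _ => gaussianPDFReal_nonneg _ _ _

lemma measurable_rho {K : Type*} [Fintype K] : Measurable (rho (K := K)) := by
  unfold rho
  exact Finset.measurable_prod _ fun a _ => (measurable_gaussianPDFReal 0 1).comp (measurable_pi_apply a)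

lemma gam_eq (K : Type*) [Fintype K] :
    gam K = (volume : Measure (K → ℝ)).withDensity (fun x => ENNReal.ofReal (rho x)) := by
  unfold gam
  refine Measure.pi_eq ?_
  intro s hs
  rw [withDensity_apply _ (MeasurableSet.univ_pi hs)]
  rw [← ofReal_integral_eq_lintegral_ofReal]
  · rw [volume_pi, Measure.restrict_pi_pi]
    unfold rho
    rw [integral_fintype_prod_eq_prod (fun _ => gaussianPDFReal 0 1)]
    rw [ENNReal.ofReal_prod_of_nonneg]
    · refine Finset.prod_congr rfl fun i _ => ?_
      rw [gaussianReal_apply_eq_integral 0 (by simp)]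
    · intro i _
      exact integral_nonneg fun x => gaussianPDFReal_nonneg _ _ _
  · apply Integrable.integrableOn
    unfold rho
    exact Integrable.fintype_prod (fun _ => integrable_gaussianPDFReal 0 1)
  · exact ae_of_all _ rho_nonneg

lemma integral_gam {K : Type*} [Fintype K] (φ : (K → ℝ) → ℝ) :
    ∫ x, φ x ∂(gam K) = ∫ x, φ x * rho x := by
  rw [gam_eq, integral_withDensity_eq_integral_toReal_smul (by
    exact measurable_rho.ennreal_ofReal) (by simp)]
  refine integral_congr_ae (ae_of_all _ fun x => ?_)
  simp [rho_nonneg, mul_comm]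

lemma integrable_gam {K : Type*} [Fintype K] (φ : (K → ℝ) → ℝ) :
    Integrable φ (gam K) ↔ Integrable (fun x => φ x * rho x) volume := by
  rw [gam_eq, integrable_withDensity_iff (measurable_rho.ennreal_ofReal) (by simp)]
  simp [rho_nonneg]

lemma hasDerivAt_gpdf (y : ℝ) : HasDerivAt (gaussianPDFReal 0 1) (-y * gaussianPDFReal 0 1 y) y := by
  unfold gaussianPDFReal
  have : HasDerivAt (fun x : ℝ => -(x - 0) ^ 2 / (2 * ((1 : ℝ≥0) : ℝ))) (-y) y := by
    have h := ((hasDerivAt_id y).pow 2).neg.div_const 2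
    convert! h using 1
    · ext x; simp
    · simp; ring
  convert! this.exp.const_mul ((√(2 * Real.pi * ((1 : ℝ≥0) : ℝ)))⁻¹) using 1
  ring

lemma hasLineDerivAt_rho {K : Type*} [Fintype K] [DecidableEq K] (x : K → ℝ) (a : K) :
    HasLineDerivAt ℝ rho (-(x a) * rho x) x (Pi.single a 1) := by
  unfold HasLineDerivAt
  have key : ∀ t : ℝ, rho (x + t • Pi.single a (1 : ℝ))
      = gaussianPDFReal 0 1 (x a + t) * ∏ b ∈ Finset.univ.erase a, gaussianPDFReal 0 1 (x b) := by
    intro t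
    unfold rho
    rw [← Finset.mul_prod_erase _ _ (Finset.mem_univ a)]
    congr 1
    · simp
    · refine Finset.prod_congr rfl fun b hb => ?_
      have : b ≠ a := Finset.ne_of_mem_erase hb
      simp [this]
  simp_rw [key]
  have h0 : rho x = gaussianPDFReal 0 1 (x a) * ∏ b ∈ Finset.univ.erase a, gaussianPDFReal 0 1 (x b) := by
    simpa using key 0
  have h1 : HasDerivAt (fun t : ℝ => gaussianPDFReal 0 1 (x a + t))
      (-(x a) * gaussianPDFReal 0 1 (x a)) 0 := by
    have := hasDerivAt_gpdf (x a + 0)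
    have h := HasDerivAt.comp_const_add (x a) 0 this
    simpa using h
  have h2 := h1.mul_const (∏ b ∈ Finset.univ.erase a, gaussianPDFReal 0 1 (x b))
  rw [h0]
  convert! h2 using 1
  ring

/-- Stein identity. -/
lemma stein {K : Type*} [Fintype K] [DecidableEq K] (a : K) (φ φ' : (K → ℝ) → ℝ)
    (h : ∀ x, HasLineDerivAt ℝ φ (φ' x) x (Pi.single a 1))
    (hi : Integrable φ (gam K)) (hi1 : Integrable (fun x => x a * φ x) (gam K))
    (hi' : Integrable φ' (gam K)) :
    ∫ x, x a * φ x ∂(gam K) = ∫ x, φ' x ∂(gam K) := by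
  have := integral_bilinear_hasLineDerivAt_right_eq_neg_left_of_integrable
    (μ := (volume : Measure (K → ℝ))) (f := φ) (f' := φ') (g := rho)
    (g' := fun x => -(x a) * rho x) (v := Pi.single a 1) (B := ContinuousLinearMap.mul ℝ ℝ)
    (by simpa using (integrable_gam _).1 hi')
    (by
      have := ((integrable_gam _).1 hi1).neg
      refine this.congr (ae_of_all _ fun x => ?_)
      simp; ring)
    (by simpa using (integrable_gam _).1 hi)
    (fun x _ => h x) (fun x _ => hasLineDerivAt_rho x a)
  rw [integral_gam, integral_gam]
  simp only [ContinuousLinearMap.mul_apply'] at this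
  rw [← neg_eq_iff_eq_neg] at this
  rw [← this, ← integral_neg]
  refine integral_congr_ae (ae_of_all _ fun x => ?_)
  simp; ring

/-- exponential growth -/
def EG {E : Type*} [Norm E] (φ : E → ℝ) : Prop := ∃ C : ℝ, 0 ≤ C ∧ ∀ x, |φ x| ≤ C * Real.exp (C * ‖x‖)

lemma integrable_exp_abs_gaussian (C : ℝ) :
    Integrable (fun x : ℝ => Real.exp (C * |x|)) (gaussianReal 0 1) := by
  refine ((integrable_exp_mul_gaussianReal C).add (integrable_exp_mul_gaussianReal (-C))).mono'
    (by fun_prop) (ae_of_all _ fun x => ?_)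
  rw [Real.norm_eq_abs, abs_of_pos (Real.exp_pos _)]
  simp only [Pi.add_apply]
  rcases abs_cases x with ⟨h, _⟩ | ⟨h, _⟩ <;> rw [h]
  · linarith [Real.exp_pos (-C * x)]
  · rw [show C * -x = -C * x by ring]; linarith [Real.exp_pos (C * x)]

lemma integrable_exp_norm {K : Type*} [Fintype K] (C : ℝ) (hC : 0 ≤ C) :
    Integrable (fun x : K → ℝ => Real.exp (C * ‖x‖)) (gam K) := by
  have h : Integrable (fun x : K → ℝ => ∏ a, Real.exp (C * |x a|)) (gam K) :=
    Integrable.fintype_prod (f := fun _ y => Real.exp (C * |y|)) (fun _ => integrable_exp_abs_gaussian C)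
  refine h.mono' (by fun_prop) (ae_of_all _ fun x => ?_)
  rw [Real.norm_eq_abs, abs_of_pos (Real.exp_pos _), ← Real.exp_sum, ← Finset.mul_sum]
  gcongr
  rw [pi_norm_le_iff_of_nonneg (Finset.sum_nonneg fun _ _ => abs_nonneg _)]
  intro i
  exact Finset.single_le_sum (f := fun a => |x a|) (fun _ _ => abs_nonneg _) (Finset.mem_univ i)

lemma EG.integrable {K : Type*} [Fintype K] {φ : (K → ℝ) → ℝ} (h : EG φ) (hm : Measurable φ) :
    Integrable φ (gam K) := by
  obtain ⟨C, hC, h⟩ := h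
  exact ((integrable_exp_norm C hC).const_mul C).mono' hm.aestronglyMeasurable (ae_of_all _ h)

lemma EG.mono {E : Type*} [Norm E] {φ ψ : E → ℝ} (h : EG φ) (hle : ∀ x, |ψ x| ≤ |φ x|) : EG ψ := by
  obtain ⟨C, hC, h⟩ := h
  exact ⟨C, hC, fun x => (hle x).trans (h x)⟩

lemma EG.mul {E : Type*} [SeminormedAddGroup E] {φ ψ : E → ℝ} (h : EG φ) (h' : EG ψ) :
    EG (fun x => φ x * ψ x) := by
  obtain ⟨C, hC, h⟩ := h
  obtain ⟨D, hD, h'⟩ := h'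
  refine ⟨C * D + C + D, by positivity, fun x => ?_⟩
  rw [abs_mul]
  calc |φ x| * |ψ x| ≤ (C * Real.exp (C * ‖x‖)) * (D * Real.exp (D * ‖x‖)) := by
        gcongr
        · exact h x
        · exact h' x
    _ = C * D * Real.exp ((C + D) * ‖x‖) := by rw [add_mul, Real.exp_add]; ring
    _ ≤ _ := by
      gcongr
      · linarith
      · nlinarith [mul_nonneg hC hD]

lemma EG.add {E : Type*} [SeminormedAddGroup E] {φ ψ : E → ℝ} (h : EG φ) (h' : EG ψ) :
    EG (fun x => φ x + ψ x) := by
  obtain ⟨C, hC, h⟩ := h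
  obtain ⟨D, hD, h'⟩ := h'
  refine ⟨C + D, by positivity, fun x => ?_⟩
  calc |φ x + ψ x| ≤ |φ x| + |ψ x| := abs_add_le _ _
    _ ≤ C * Real.exp (C * ‖x‖) + D * Real.exp (D * ‖x‖) := add_le_add (h x) (h' x)
    _ ≤ C * Real.exp ((C + D) * ‖x‖) + D * Real.exp ((C + D) * ‖x‖) := by
      gcongr <;> linarith
    _ = _ := by ring

lemma EG.const {E : Type*} [SeminormedAddGroup E] (c : ℝ) : EG (fun _ : E => c) :=
  ⟨|c|, abs_nonneg _, fun x => by
    have : 1 ≤ Real.exp (|c| * ‖x‖) := Real.one_le_exp (by positivity)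
    nlinarith [abs_nonneg c]⟩

lemma EG.sum {E ι : Type*} [SeminormedAddGroup E] (s : Finset ι) {φ : ι → E → ℝ}
    (h : ∀ i, EG (φ i)) : EG (fun x => ∑ i ∈ s, φ i x) := by
  classical
  induction s using Finset.induction_on with
  | empty => simpa using EG.const (E := E) 0
  | insert a s ha ih => 
    simp_rw [Finset.sum_insert ha]
    exact (h a).add ih

lemma EG.of_le_norm {E : Type*} [SeminormedAddGroup E] {φ : E → ℝ} (c : ℝ) (hc : 0 ≤ c)
    (h : ∀ x, |φ x| ≤ c * ‖x‖) : EG φ := by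
  refine ⟨c + 1, by positivity, fun x => (h x).trans ?_⟩
  have h1 := Real.add_one_le_exp ((c+1) * ‖x‖)
  have h2 := norm_nonneg x
  have h3 : ‖x‖ ≤ Real.exp ((c+1) * ‖x‖) := by nlinarith [mul_nonneg hc h2]
  nlinarith

lemma EG.coord {K : Type*} [Fintype K] (a : K) : EG (fun x : K → ℝ => x a) :=
  EG.of_le_norm 1 zero_le_one fun x => by simpa using norm_le_pi_norm x a

lemma EG.comp {E F : Type*} [SeminormedAddGroup E] [SeminormedAddGroup F] {φ : F → ℝ} (h : EG φ)
    (A : E → F) (c : ℝ) (hc : 0 ≤ c) (hA : ∀ x, ‖A x‖ ≤ c * ‖x‖) : EG (fun x => φ (A x)) := by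
  obtain ⟨C, hC, h⟩ := h
  refine ⟨C + C * c, by positivity, fun x => (h _).trans ?_⟩
  have h1 : C * ‖A x‖ ≤ (C + C * c) * ‖x‖ := by
    calc C * ‖A x‖ ≤ C * (c * ‖x‖) := mul_le_mul_of_nonneg_left (hA x) hC
      _ ≤ _ := by nlinarith [mul_nonneg hC (norm_nonneg x)]
  have h2 : C ≤ C + C * c := by nlinarith [mul_nonneg hC hc]
  exact mul_le_mul h2 (Real.exp_le_exp.2 h1) (Real.exp_pos _).le (by positivity)

lemma mp_inl (K₁ K₂ : Type*) [Fintype K₁] [Fintype K₂] :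
    MeasurePreserving (fun x : K₁ ⊕ K₂ → ℝ => fun a => x (Sum.inl a)) (gam (K₁ ⊕ K₂)) (gam K₁) := by
  have h := measurePreserving_sumPiEquivProdPi (X := fun _ : K₁ ⊕ K₂ => ℝ)
    (fun _ => gaussianReal 0 1)
  exact MeasurePreserving.comp (measurePreserving_fst) h

lemma mp_inr (K₁ K₂ : Type*) [Fintype K₁] [Fintype K₂] :
    MeasurePreserving (fun x : K₁ ⊕ K₂ → ℝ => fun a => x (Sum.inr a)) (gam (K₁ ⊕ K₂)) (gam K₂) := by
  have h := measurePreserving_sumPiEquivProdPi (X := fun _ : K₁ ⊕ K₂ => ℝ)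
    (fun _ => gaussianReal 0 1)
  exact MeasurePreserving.comp (measurePreserving_snd) h

lemma integral_gam_mul {K₁ K₂ : Type*} [Fintype K₁] [Fintype K₂] (f : (K₁ → ℝ) → ℝ)
    (g : (K₂ → ℝ) → ℝ) :
    ∫ x, f (fun a => x (Sum.inl a)) * g (fun a => x (Sum.inr a)) ∂(gam (K₁ ⊕ K₂))
      = (∫ x, f x ∂(gam K₁)) * ∫ x, g x ∂(gam K₂) := by
  have h := measurePreserving_sumPiEquivProdPi (X := fun _ : K₁ ⊕ K₂ => ℝ)
    (fun _ => gaussianReal 0 1)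
  have h2 := h.integral_comp (MeasurableEquiv.measurableEmbedding _)
    (fun z : (K₁ → ℝ) × (K₂ → ℝ) => f z.1 * g z.2)
  have h3 := integral_prod_mul (μ := gam K₁) (ν := gam K₂) f g
  rw [← h3]
  exact h2

lemma integral_inl {K₁ K₂ : Type*} [Fintype K₁] [Fintype K₂] (f : (K₁ → ℝ) → ℝ) :
    ∫ x, f (fun a => x (Sum.inl a)) ∂(gam (K₁ ⊕ K₂)) = ∫ x, f x ∂(gam K₁) := by
  simpa using integral_gam_mul (K₂ := K₂) f (fun _ => 1)

lemma integral_inr {K₁ K₂ : Type*} [Fintype K₁] [Fintype K₂] (f : (K₂ → ℝ) → ℝ) :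
    ∫ x, f (fun a => x (Sum.inr a)) ∂(gam (K₁ ⊕ K₂)) = ∫ x, f x ∂(gam K₂) := by
  simpa using integral_gam_mul (K₁ := K₁) (fun _ => 1) f

lemma norm_mulVec_le {J K : Type*} [Fintype J] [Fintype K] (A B : Matrix J K ℝ)
    (h : ∀ j a, |A j a| ≤ |B j a|) (x : K → ℝ) : ‖A *ᵥ x‖ ≤ (∑ j, ∑ a, |B j a|) * ‖x‖ := by
  have h0 : ∀ j, 0 ≤ ∑ a, |B j a| := fun j => Finset.sum_nonneg fun _ _ => abs_nonneg _
  rw [pi_norm_le_iff_of_nonneg (mul_nonneg (Finset.sum_nonneg fun j _ => h0 j) (norm_nonneg x))]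
  intro j
  calc ‖(A *ᵥ x) j‖ = |∑ a, A j a * x a| := rfl
    _ ≤ ∑ a, |A j a * x a| := Finset.abs_sum_le_sum_abs _ _
    _ ≤ ∑ a, |B j a| * ‖x‖ := by
      refine Finset.sum_le_sum fun a _ => ?_
      rw [abs_mul]
      exact mul_le_mul (h j a) (norm_le_pi_norm x a) (abs_nonneg _) (abs_nonneg _)
    _ = (∑ a, |B j a|) * ‖x‖ := by rw [Finset.sum_mul]
    _ ≤ _ := by
      gcongr
      exact Finset.single_le_sum (f := fun j => ∑ a, |B j a|) (fun j _ => h0 j) (Finset.mem_univ j)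

lemma EG.mulVec {J K : Type*} [Fintype J] [Fintype K] {φ : (J → ℝ) → ℝ} (h : EG φ)
    (A : Matrix J K ℝ) : EG (fun x : K → ℝ => φ (A *ᵥ x)) :=
  h.comp (fun x => A *ᵥ x) _ (Finset.sum_nonneg fun j _ => Finset.sum_nonneg fun a _ => abs_nonneg (A j a))
    (norm_mulVec_le A A (fun _ _ => le_rfl))

lemma stein_mulVec {J K : Type*} [Fintype J] [Fintype K] (A : Matrix J K ℝ) (a : K)
    (φ : (J → ℝ) → ℝ) (φ' : J → (J → ℝ) → ℝ)
    (h : ∀ z, HasFDerivAt φ (∑ j, φ' j z • (ContinuousLinearMap.proj j : (J → ℝ) →L[ℝ] ℝ)) z)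
    (hφ : EG φ) (hφ' : ∀ j, EG (φ' j)) (hm : ∀ j, Measurable (φ' j)) :
    ∫ x, x a * φ (A *ᵥ x) ∂(gam K) = ∑ j, A j a * ∫ x, φ' j (A *ᵥ x) ∂(gam K) := by
  classical
  have hc : Continuous φ := continuous_iff_continuousAt.2 fun z => (h z).continuousAt
  have hcA : Continuous (fun x : K → ℝ => A *ᵥ x) := by fun_prop
  have hIntA : ∀ j, Integrable (fun x => φ' j (A *ᵥ x)) (gam K) := fun j =>
    ((hφ' j).mulVec A).integrable ((hm j).comp hcA.measurable)
  rw [stein a (fun x => φ (A *ᵥ x)) (fun x => ∑ j, A j a * φ' j (A *ᵥ x))]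
  · rw [integral_finsetSum _ fun j _ => (hIntA j).const_mul _]
    simp_rw [integral_const_mul]
  · intro x
    unfold HasLineDerivAt
    have h1 : HasDerivAt (fun t : ℝ => A *ᵥ (x + t • Pi.single a 1)) (fun j => A j a) 0 := by
      rw [hasDerivAt_pi]
      intro j
      have : ∀ t : ℝ, (A *ᵥ (x + t • Pi.single a (1:ℝ))) j = (A *ᵥ x) j + t * A j a := by
        intro t
        simp [mulVec_add, mulVec_smul]
      simp_rw [this]
      simpa using ((hasDerivAt_id (0:ℝ)).mul_const (A j a)).const_add ((A *ᵥ x) j)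
    have h2 := HasFDerivAt.comp_hasDerivAt (0 : ℝ) (h (A *ᵥ (x + (0:ℝ) • Pi.single a 1))) h1
    convert! h2 using 1
    simp [mul_comm]
  · exact (hφ.mulVec A).integrable (hc.comp hcA).measurable
  · exact ((EG.coord a).mul (hφ.mulVec A)).integrable
      ((measurable_pi_apply a).mul (hc.comp hcA).measurable)
  · exact integrable_finsetSum _ fun j _ => (hIntA j).const_mul _

theorem interp {J K₁ K₂ : Type*} [Fintype J] [Fintype K₁] [Fintype K₂]
    (L : Matrix J K₁ ℝ) (M : Matrix J K₂ ℝ)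
    (F : (J → ℝ) → ℝ) (F1 : J → (J → ℝ) → ℝ) (F2 : J → J → (J → ℝ) → ℝ)
    (hF : ∀ z, HasFDerivAt F (∑ j, F1 j z • (ContinuousLinearMap.proj j : (J → ℝ) →L[ℝ] ℝ)) z)
    (hF1 : ∀ i z, HasFDerivAt (F1 i)
      (∑ j, F2 i j z • (ContinuousLinearMap.proj j : (J → ℝ) →L[ℝ] ℝ)) z)
    (gF : EG F) (gF1 : ∀ j, EG (F1 j)) (gF2 : ∀ i j, EG (F2 i j)) (mF2 : ∀ i j, Measurable (F2 i j))
    (hC : ∀ z, 0 ≤ ∑ i, ∑ j, F2 i j z * ((M * Mᵀ) i j - (L * Lᵀ) i j)) :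
    ∫ x, F (L *ᵥ x) ∂(gam K₁) ≤ ∫ x, F (M *ᵥ x) ∂(gam K₂) := by
  classical
  have cF : Continuous F := continuous_iff_continuousAt.2 fun z => (hF z).continuousAt
  have cF1 : ∀ j, Continuous (F1 j) := fun j =>
    continuous_iff_continuousAt.2 fun z => (hF1 j z).continuousAt
  let A : ℝ → Matrix J (K₁ ⊕ K₂) ℝ := fun θ => fromCols (Real.cos θ • L) (Real.sin θ • M)
  let D : ℝ → Matrix J (K₁ ⊕ K₂) ℝ := fun θ => fromCols (-Real.sin θ • L) (Real.cos θ • M)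
  let B : Matrix J (K₁ ⊕ K₂) ℝ := fromCols L M
  let c : ℝ := ∑ j, ∑ a, |B j a|
  have hc0 : 0 ≤ c := Finset.sum_nonneg fun j _ => Finset.sum_nonneg fun a _ => abs_nonneg (B j a)
  have hAB : ∀ θ j a, |A θ j a| ≤ |B j a| := by
    rintro θ j (a | a) <;> simp only [A, B, fromCols_apply_inl, fromCols_apply_inr, Matrix.smul_apply,
      smul_eq_mul, abs_mul]
    · nlinarith [Real.abs_cos_le_one θ, abs_nonneg (L j a)]
    · nlinarith [Real.abs_sin_le_one θ, abs_nonneg (M j a)]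
  have hDB : ∀ θ j a, |D θ j a| ≤ |B j a| := by
    rintro θ j (a | a) <;> simp only [D, B, fromCols_apply_inl, fromCols_apply_inr, Matrix.smul_apply,
      smul_eq_mul, abs_mul, abs_neg]
    · nlinarith [Real.abs_sin_le_one θ, abs_nonneg (L j a)]
    · nlinarith [Real.abs_cos_le_one θ, abs_nonneg (M j a)]
  have hAn : ∀ θ x, ‖A θ *ᵥ x‖ ≤ c * ‖x‖ := fun θ x => norm_mulVec_le _ _ (hAB θ) x
  have hDn : ∀ θ x, ‖D θ *ᵥ x‖ ≤ c * ‖x‖ := fun θ x => norm_mulVec_le _ _ (hDB θ) x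
  have hAD : ∀ θ x, HasDerivAt (fun θ => A θ *ᵥ x) (D θ *ᵥ x) θ := by
    intro θ x
    simp only [A, D, fromCols_mulVec, Matrix.smul_mulVec]
    exact ((Real.hasDerivAt_cos θ).smul_const _).add ((Real.hasDerivAt_sin θ).smul_const _)
  have cA : ∀ θ, Continuous (fun x : K₁ ⊕ K₂ → ℝ => A θ *ᵥ x) := fun θ => by fun_prop
  have cD : ∀ θ, Continuous (fun x : K₁ ⊕ K₂ → ℝ => D θ *ᵥ x) := fun θ => by fun_prop
  -- derivative
  let Ψ : ℝ → ℝ := fun θ => ∫ x, F (A θ *ᵥ x) ∂(gam (K₁ ⊕ K₂))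
  let Ψ' : ℝ → ℝ := fun θ => ∫ x, ∑ j, F1 j (A θ *ᵥ x) * (D θ *ᵥ x) j ∂(gam (K₁ ⊕ K₂))
  have hΨ : ∀ θ, HasDerivAt Ψ (Ψ' θ) θ := by
    intro θ
    choose C hC0 hCb using gF1
    have := hasDerivAt_integral_of_dominated_loc_of_deriv_le (μ := gam (K₁ ⊕ K₂))
      (F := fun θ x => F (A θ *ᵥ x)) (x₀ := θ) (s := Set.univ)
      (F' := fun θ x => ∑ j, F1 j (A θ *ᵥ x) * (D θ *ᵥ x) j)
      (bound := fun x => ∑ j, (C j * Real.exp (C j * (c * ‖x‖))) * (c * ‖x‖))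
      Filter.univ_mem
      (Eventually.of_forall fun θ => (cF.comp (cA θ)).aestronglyMeasurable)
      ((gF.mulVec (A θ)).integrable (cF.comp (cA θ)).measurable)
      (by
        refine Continuous.aestronglyMeasurable ?_
        refine continuous_finsetSum _ fun j _ => ((cF1 j).comp (cA θ)).mul ?_
        exact (continuous_apply j).comp (cD θ))
      (ae_of_all _ fun x θ _ => by
        rw [Real.norm_eq_abs]
        refine (Finset.abs_sum_le_sum_abs _ _).trans (Finset.sum_le_sum fun j _ => ?_)
        rw [abs_mul]
        have e1 : |(D θ *ᵥ x) j| ≤ c * ‖x‖ := (norm_le_pi_norm (D θ *ᵥ x) j).trans (hDn θ x)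
        have e2 : |F1 j (A θ *ᵥ x)| ≤ C j * Real.exp (C j * (c * ‖x‖)) := by
          refine (hCb j _).trans ?_
          have := hC0 j
          have := hAn θ x
          gcongr
        exact mul_le_mul e2 e1 (abs_nonneg _) (mul_nonneg (hC0 j) (Real.exp_pos _).le))
      (by
        refine integrable_finsetSum _ fun j _ => ?_
        refine EG.integrable (EG.mul ?_ ?_) (by fun_prop)
        · refine ⟨C j + C j * c, add_nonneg (hC0 j) (mul_nonneg (hC0 j) hc0), fun x => ?_⟩
          rw [abs_of_nonneg (mul_nonneg (hC0 j) (Real.exp_pos _).le)]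
          have h1 : C j ≤ C j + C j * c := by nlinarith [mul_nonneg (hC0 j) hc0]
          have h2 : C j * (c * ‖x‖) ≤ (C j + C j * c) * ‖x‖ := by
            nlinarith [mul_nonneg (hC0 j) (norm_nonneg x)]
          exact mul_le_mul h1 (Real.exp_le_exp.2 h2) (Real.exp_pos _).le
            (add_nonneg (hC0 j) (mul_nonneg (hC0 j) hc0))
        · exact EG.of_le_norm c hc0 fun x => by
            rw [abs_of_nonneg (mul_nonneg hc0 (norm_nonneg x))])
      (ae_of_all _ fun x θ _ => by
        have h2 := HasFDerivAt.comp_hasDerivAt θ (hF (A θ *ᵥ x)) (hAD θ x)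
        convert! h2 using 1
        simp)
    exact this.2
  have hΨ' : ∀ θ ∈ interior (Set.Icc 0 (Real.pi / 2)), 0 ≤ Ψ' θ := by
    intro θ hθ
    rw [interior_Icc] at hθ
    have hs : 0 ≤ Real.sin θ * Real.cos θ := mul_nonneg
      (Real.sin_nonneg_of_nonneg_of_le_pi hθ.1.le (by linarith [hθ.2, Real.pi_pos]))
      (Real.cos_nonneg_of_neg_pi_div_two_le_of_le (by linarith [hθ.1, Real.pi_pos]) hθ.2.le)
    have hIntA : ∀ j a, Integrable (fun x : K₁ ⊕ K₂ → ℝ => x a * F1 j (A θ *ᵥ x)) (gam (K₁ ⊕ K₂)) :=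
      fun j a => ((EG.coord a).mul ((gF1 j).mulVec (A θ))).integrable
        ((measurable_pi_apply a).mul ((cF1 j).comp (cA θ)).measurable)
    have hIntB : ∀ i j, Integrable (fun x : K₁ ⊕ K₂ → ℝ => F2 i j (A θ *ᵥ x)) (gam (K₁ ⊕ K₂)) :=
      fun i j => ((gF2 i j).mulVec (A θ)).integrable ((mF2 i j).comp (cA θ).measurable)
    have e1 : Ψ' θ = ∑ i, ∑ a, D θ i a * ∫ x, x a * F1 i (A θ *ᵥ x) ∂(gam (K₁ ⊕ K₂)) := by
      simp only [Ψ']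
      have : ∀ x : K₁ ⊕ K₂ → ℝ, ∑ j, F1 j (A θ *ᵥ x) * (D θ *ᵥ x) j
          = ∑ i, ∑ a, D θ i a * (x a * F1 i (A θ *ᵥ x)) := by
        intro x
        refine Finset.sum_congr rfl fun i _ => ?_
        simp only [mulVec, dotProduct, Finset.mul_sum]
        refine Finset.sum_congr rfl fun a _ => ?_
        ring
      simp_rw [this]
      have hi : ∀ i a, Integrable (fun x : K₁ ⊕ K₂ → ℝ => D θ i a * (x a * F1 i (A θ *ᵥ x)))
          (gam (K₁ ⊕ K₂)) := fun i a => (hIntA i a).const_mul _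
      refine (integral_finsetSum _ fun i _ => integrable_finsetSum _ fun a _ => hi i a).trans ?_
      refine Finset.sum_congr rfl fun i _ => ?_
      refine (integral_finsetSum _ fun a _ => hi i a).trans ?_
      simp_rw [integral_const_mul]
    have e2 : Ψ' θ = ∑ i, ∑ j, (D θ * (A θ)ᵀ) i j * ∫ x, F2 i j (A θ *ᵥ x) ∂(gam (K₁ ⊕ K₂)) := by
      rw [e1]
      refine Finset.sum_congr rfl fun i _ => ?_
      simp_rw [stein_mulVec (A θ) _ (F1 i) (F2 i) (hF1 i) (gF1 i) (gF2 i) (mF2 i), Matrix.mul_apply,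
        Matrix.transpose_apply, Finset.mul_sum, Finset.sum_mul]
      rw [Finset.sum_comm]
      refine Finset.sum_congr rfl fun j _ => Finset.sum_congr rfl fun a _ => ?_
      ring
    have e3 : D θ * (A θ)ᵀ = (Real.sin θ * Real.cos θ) • (M * Mᵀ - L * Lᵀ) := by
      simp only [D, A, transpose_fromCols, fromCols_mul_fromRows, transpose_smul, Matrix.smul_mul,
        Matrix.mul_smul, smul_smul, smul_sub]
      rw [show Real.cos θ * -Real.sin θ = -(Real.sin θ * Real.cos θ) by ring, neg_smul]
      abel
    have e4 : Ψ' θ = (Real.sin θ * Real.cos θ) *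
        ∫ x, ∑ i, ∑ j, F2 i j (A θ *ᵥ x) * ((M * Mᵀ) i j - (L * Lᵀ) i j) ∂(gam (K₁ ⊕ K₂)) := by
      rw [e2, e3, integral_finsetSum _ fun i _ => integrable_finsetSum _ fun a _ => (hIntB i a).mul_const _,
        Finset.mul_sum]
      refine Finset.sum_congr rfl fun i _ => ?_
      rw [integral_finsetSum _ fun a _ => (hIntB i a).mul_const _, Finset.mul_sum]
      refine Finset.sum_congr rfl fun j _ => ?_
      rw [integral_mul_const]
      simp only [Matrix.smul_apply, Matrix.sub_apply, smul_eq_mul]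
      ring
    rw [e4]
    exact mul_nonneg hs (integral_nonneg fun x => hC _)
  have hmono : MonotoneOn Ψ (Set.Icc 0 (Real.pi / 2)) :=
    monotoneOn_of_hasDerivWithinAt_nonneg (convex_Icc _ _)
      (fun θ _ => (hΨ θ).continuousAt.continuousWithinAt)
      (fun θ _ => (hΨ θ).hasDerivWithinAt) hΨ'
  have hpi := Real.pi_pos
  have := hmono (Set.left_mem_Icc.2 (by positivity)) (Set.right_mem_Icc.2 (by positivity))
    (by positivity : (0:ℝ) ≤ Real.pi / 2)
  have l0 : Ψ 0 = ∫ x, F (L *ᵥ x) ∂(gam K₁) := by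
    rw [← integral_inl (K₂ := K₂)]
    simp only [Ψ, A, fromCols_mulVec]
    simp; rfl
  have l1 : Ψ (Real.pi / 2) = ∫ x, F (M *ᵥ x) ∂(gam K₂) := by
    rw [← integral_inr (K₁ := K₁)]
    simp only [Ψ, A, fromCols_mulVec]
    simp; rfl
  rwa [l0, l1] at this

/-- smoothed Euclidean norm -/
def nr {K : Type*} [Fintype K] (ε : ℝ) (x : K → ℝ) : ℝ := √(ε ^ 2 + ∑ a, x a ^ 2)

section
variable {K : Type*} [Fintype K] {ε : ℝ}

lemma nr_sq (ε : ℝ) (x : K → ℝ) : nr ε x ^ 2 = ε ^ 2 + ∑ a, x a ^ 2 :=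
  Real.sq_sqrt (by positivity)

lemma nr_nonneg (ε : ℝ) (x : K → ℝ) : 0 ≤ nr ε x := Real.sqrt_nonneg _

lemma le_nr (hε : 0 < ε) (x : K → ℝ) : ε ≤ nr ε x := by
  apply Real.le_sqrt_of_sq_le
  have : 0 ≤ ∑ a, x a ^ 2 := by positivity
  linarith

lemma nr_pos (hε : 0 < ε) (x : K → ℝ) : 0 < nr ε x := hε.trans_le (le_nr hε x)

lemma continuous_nr (ε : ℝ) : Continuous (nr ε : (K → ℝ) → ℝ) := by
  unfold nr; fun_prop

lemma nr_le (hε : 0 < ε) (x : K → ℝ) : nr ε x ≤ ε + (Fintype.card K : ℝ) * ‖x‖ := by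
  apply Real.sqrt_le_iff.2
  refine ⟨by positivity, ?_⟩
  have h1 : ∑ a, x a ^ 2 ≤ (∑ a, |x a|) ^ 2 := by
    have := Finset.sum_sq_le_sq_sum_of_nonneg (s := Finset.univ) (f := fun a => |x a|)
      (fun i _ => abs_nonneg _)
    simpa using this
  have h2 : ∑ a, |x a| ≤ (Fintype.card K : ℝ) * ‖x‖ := by
    calc ∑ a, |x a| ≤ ∑ _a : K, ‖x‖ := Finset.sum_le_sum fun a _ => norm_le_pi_norm x a
      _ = _ := by simp
  have h3 : 0 ≤ ∑ a, |x a| := by positivity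
  have h4 : (∑ a, |x a|) ^ 2 ≤ ((Fintype.card K : ℝ) * ‖x‖) ^ 2 := by gcongr
  have h5 : 0 ≤ (Fintype.card K : ℝ) * ‖x‖ := by positivity
  nlinarith

lemma hasFDerivAt_nr (hε : 0 < ε) (x : K → ℝ) :
    HasFDerivAt (nr ε) (∑ j, (x j / nr ε x) • (ContinuousLinearMap.proj j : (K → ℝ) →L[ℝ] ℝ)) x := by
  have hq : HasFDerivAt (fun x : K → ℝ => ε ^ 2 + ∑ a, x a ^ 2)
      (∑ j, (2 * x j) • (ContinuousLinearMap.proj j : (K → ℝ) →L[ℝ] ℝ)) x := by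
    refine HasFDerivAt.const_add _ ?_
    refine HasFDerivAt.fun_sum fun a _ => ?_
    have := (ContinuousLinearMap.proj (R := ℝ) (φ := fun _ : K => ℝ) a).hasFDerivAt (x := x)
    have h2 := this.pow 2
    convert! h2 using 1
    simp
  have h := hq.sqrt (by positivity)
  convert! h using 1
  rw [Finset.smul_sum]
  refine Finset.sum_congr rfl fun j _ => ?_
  rw [smul_smul]
  congr 1
  unfold nr
  field_simp

lemma EG_exp_nr (hε : 0 < ε) (l : ℝ) : EG (fun x : K → ℝ => Real.exp (l * nr ε x)) := by
  refine ⟨Real.exp (|l| * ε) + |l| * Fintype.card K, by positivity, fun x => ?_⟩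
  rw [abs_of_pos (Real.exp_pos _)]
  have h1 : l * nr ε x ≤ |l| * ε + (|l| * Fintype.card K) * ‖x‖ := by
    calc l * nr ε x ≤ |l| * nr ε x := by gcongr; exacts [nr_nonneg _ _, le_abs_self l]
      _ ≤ |l| * (ε + (Fintype.card K : ℝ) * ‖x‖) := by gcongr; exact nr_le hε x
      _ = _ := by ring
  have h0 : 0 ≤ |l| * (Fintype.card K : ℝ) := by positivity
  calc Real.exp (l * nr ε x) ≤ Real.exp (|l| * ε) * Real.exp ((|l| * Fintype.card K) * ‖x‖) := by
        rw [← Real.exp_add]; gcongr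
    _ ≤ _ := by
      gcongr
      · linarith
      · linarith [Real.exp_pos (|l| * ε)]

lemma EG_nr (hε : 0 < ε) : EG (nr ε : (K → ℝ) → ℝ) := by
  refine (EG_exp_nr hε 1).mono fun x => ?_
  rw [abs_of_nonneg (nr_nonneg _ _), abs_of_pos (Real.exp_pos _)]
  linarith [Real.add_one_le_exp (1 * nr ε x)]

lemma EG_inv_nr (hε : 0 < ε) : EG (fun x : K → ℝ => (nr ε x)⁻¹) := by
  refine (EG.const (ε⁻¹)).mono fun x => ?_
  rw [abs_of_nonneg (inv_nonneg.2 (nr_nonneg _ _)), abs_of_pos (by positivity)]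
  gcongr; exact le_nr hε x

lemma hasDerivAt_mgf_nr (hε : 0 < ε) (l : ℝ) :
    HasDerivAt (fun l => ∫ x, Real.exp (l * nr ε x) ∂(gam K))
      (∫ x, nr ε x * Real.exp (l * nr ε x) ∂(gam K)) l := by
  have : integrableExpSet (nr ε) (gam K) = Set.univ := by
    ext t
    simp only [integrableExpSet, Set.mem_setOf_eq, Set.mem_univ, iff_true]
    have := continuous_nr (K := K) ε
    exact (EG_exp_nr hε t).integrable (by fun_prop)
  exact hasDerivAt_mgf (X := nr ε) (μ := gam K) (by rw [this]; simp)

lemma hasFDerivAt_exp_nr (hε : 0 < ε) (l : ℝ) (x : K → ℝ) :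
    HasFDerivAt (fun x : K → ℝ => Real.exp (l * nr ε x)) (Real.exp (l * nr ε x) • l •
      (∑ j, (x j / nr ε x) • (ContinuousLinearMap.proj j : (K → ℝ) →L[ℝ] ℝ))) x :=
  ((hasFDerivAt_nr hε x).const_mul l).exp

lemma proj_sum_single [DecidableEq K] (c : K → ℝ) (a : K) :
    (∑ j, c j • (ContinuousLinearMap.proj j : (K → ℝ) →L[ℝ] ℝ)) (Pi.single a 1) = c a := by
  simp [Pi.single_apply]

lemma moment_upper (hε : 0 < ε) (l : ℝ) (hl : 0 ≤ l) :
    ∫ x, nr ε x ^ 2 * Real.exp (l * nr ε x) ∂(gam K) ≤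
      (Fintype.card K + ε ^ 2) * ∫ x, Real.exp (l * nr ε x) ∂(gam K)
        + l * ∫ x, nr ε x * Real.exp (l * nr ε x) ∂(gam K) := by
  classical
  have cn := continuous_nr (K := K) ε
  have ge := EG_exp_nr (K := K) hε l
  have i0 : Integrable (fun x : K → ℝ => Real.exp (l * nr ε x)) (gam K) := ge.integrable (by fun_prop)
  have i1 : Integrable (fun x : K → ℝ => nr ε x * Real.exp (l * nr ε x)) (gam K) :=
    ((EG_nr hε).mul ge).integrable (by fun_prop)
  have i2 : ∀ a : K, Integrable (fun x : K → ℝ => x a * (x a * Real.exp (l * nr ε x))) (gam K) :=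
    fun a => ((EG.coord a).mul ((EG.coord a).mul ge)).integrable (by fun_prop)
  have i3 : ∀ a : K, Integrable (fun x : K → ℝ => x a * (x a / nr ε x) * Real.exp (l * nr ε x)) (gam K) :=
    fun a => by
      simp_rw [div_eq_mul_inv]
      exact (((EG.coord a).mul ((EG.coord a).mul (EG_inv_nr hε))).mul ge).integrable (by fun_prop)
  have st : ∀ a : K, ∫ x, x a * (x a * Real.exp (l * nr ε x)) ∂(gam K) =
      ∫ x, (Real.exp (l * nr ε x) + l * (x a * (x a / nr ε x) * Real.exp (l * nr ε x))) ∂(gam K) := by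
    intro a
    refine stein a _ _ ?_ ?_ (i2 a) (i0.add ((i3 a).const_mul l))
    · intro x
      have hp := (ContinuousLinearMap.proj (R := ℝ) (φ := fun _ : K => ℝ) a).hasFDerivAt (x := x)
      have h := (hp.mul (hasFDerivAt_exp_nr hε l x)).hasLineDerivAt (Pi.single a 1)
      convert! h using 1
      simp only [ContinuousLinearMap.add_apply, ContinuousLinearMap.smul_apply, proj_sum_single]
      simp
      ring
    · exact ((EG.coord a).mul ge).integrable (by fun_prop)
  have e1 : ∀ x : K → ℝ, nr ε x ^ 2 * Real.exp (l * nr ε x) =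
      ε ^ 2 * Real.exp (l * nr ε x) + ∑ a, x a * (x a * Real.exp (l * nr ε x)) := by
    intro x
    rw [nr_sq, add_mul, Finset.sum_mul]
    congr 1
    exact Finset.sum_congr rfl fun a _ => by ring
  have e2 : ∑ a, ∫ x, x a * (x a * Real.exp (l * nr ε x)) ∂(gam K) ≤
      Fintype.card K * ∫ x, Real.exp (l * nr ε x) ∂(gam K)
        + l * ∫ x, nr ε x * Real.exp (l * nr ε x) ∂(gam K) := by
    simp_rw [st]
    have : ∀ a : K, ∫ x, (Real.exp (l * nr ε x) + l * (x a * (x a / nr ε x) * Real.exp (l * nr ε x))) ∂(gam K)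
      = ∫ x, Real.exp (l * nr ε x) ∂(gam K) +
        l * ∫ x, x a * (x a / nr ε x) * Real.exp (l * nr ε x) ∂(gam K) := by
      intro a
      rw [integral_add i0 ((i3 a).const_mul l), integral_const_mul]
    simp_rw [this]
    rw [Finset.sum_add_distrib, ← Finset.mul_sum, ← integral_finsetSum _ (fun a _ => i3 a)]
    simp only [Finset.sum_const, Finset.card_univ, nsmul_eq_mul]
    refine add_le_add le_rfl (mul_le_mul_of_nonneg_left
      (integral_mono (integrable_finsetSum _ (fun a _ => i3 a)) i1 fun x => ?_) hl)
    simp only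
    rw [← Finset.sum_mul]
    gcongr
    have hp := nr_pos hε x
    have : ∑ a, x a * (x a / nr ε x) = (∑ a, x a ^ 2) / nr ε x := by
      rw [Finset.sum_div]; exact Finset.sum_congr rfl fun a _ => by ring
    rw [this, div_le_iff₀ hp]
    nlinarith [nr_sq ε x, sq_nonneg ε]
  simp_rw [e1]
  rw [integral_add (i0.const_mul _) (integrable_finsetSum _ (fun a _ => i2 a)),
    integral_finsetSum _ (fun a _ => i2 a), integral_const_mul]
  linarith

lemma mgf_upper (hε : 0 < ε) (l : ℝ) (hl : 0 ≤ l) :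
    ∫ x, Real.exp (l * nr ε x) ∂(gam K) ≤
      Real.exp (l * √(Fintype.card K + ε ^ 2) + l ^ 2 / 2) := by
  set c := √(Fintype.card K + ε ^ 2) with hc
  have hc2 : c ^ 2 = Fintype.card K + ε ^ 2 := Real.sq_sqrt (by positivity)
  have hcp : 0 < c := Real.sqrt_pos.2 (by positivity)
  have cn := continuous_nr (K := K) ε
  let h : ℝ → ℝ := fun l => (∫ x, Real.exp (l * nr ε x) ∂(gam K)) * Real.exp (-(l * c + l ^ 2 / 2))
  have hd : ∀ l, HasDerivAt h (((∫ x, nr ε x * Real.exp (l * nr ε x) ∂(gam K)) -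
      (c + l) * (∫ x, Real.exp (l * nr ε x) ∂(gam K))) * Real.exp (-(l * c + l ^ 2 / 2))) l := by
    intro l
    have h1 : HasDerivAt (fun l : ℝ => -(l * c + l ^ 2 / 2)) (-(c + l)) l := by
      have := (((hasDerivAt_id l).mul_const c).add (((hasDerivAt_id l).pow 2).div_const 2)).neg
      convert! this using 1
      simp
    convert! (hasDerivAt_mgf_nr (K := K) hε l).mul h1.exp using 1
    ring
  have hanti : AntitoneOn h (Set.Ici 0) := by
    refine antitoneOn_of_hasDerivWithinAt_nonpos (convex_Ici 0)
      (fun l _ => (hd l).continuousAt.continuousWithinAt) (fun l _ => (hd l).hasDerivWithinAt) ?_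
    intro l hl
    rw [interior_Ici] at hl
    have hl : 0 < l := hl
    refine mul_nonpos_of_nonpos_of_nonneg ?_ (Real.exp_pos _).le
    have hm := moment_upper (K := K) hε l hl.le
    have ge := EG_exp_nr (K := K) hε l
    have i0 : Integrable (fun x : K → ℝ => Real.exp (l * nr ε x)) (gam K) := ge.integrable (by fun_prop)
    have i1 : Integrable (fun x : K → ℝ => nr ε x * Real.exp (l * nr ε x)) (gam K) :=
      ((EG_nr hε).mul ge).integrable (by fun_prop)
    have i2 : Integrable (fun x : K → ℝ => nr ε x ^ 2 * Real.exp (l * nr ε x)) (gam K) := by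
      simp_rw [pow_two]
      exact (((EG_nr hε).mul (EG_nr hε)).mul ge).integrable (by fun_prop)
    have q : ∫ x : K → ℝ, (2 * (c + l) * (nr ε x * Real.exp (l * nr ε x))
        - (c + l) ^ 2 * Real.exp (l * nr ε x)) ∂(gam K) ≤
        ∫ x, nr ε x ^ 2 * Real.exp (l * nr ε x) ∂(gam K) := by
      refine integral_mono ((i1.const_mul _).sub (i0.const_mul _)) i2 fun x => ?_
      have := mul_nonneg (sq_nonneg (nr ε x - (c + l))) (Real.exp_pos (l * nr ε x)).le
      simp only
      nlinarith
    rw [integral_sub (i1.const_mul _) (i0.const_mul _), integral_const_mul, integral_const_mul] at q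
    have m0 : 0 ≤ ∫ x : K → ℝ, Real.exp (l * nr ε x) ∂(gam K) := integral_nonneg fun x => (Real.exp_pos _).le
    rw [← hc2] at hm
    set a := ∫ x : K → ℝ, Real.exp (l * nr ε x) ∂(gam K)
    set b := ∫ x : K → ℝ, nr ε x * Real.exp (l * nr ε x) ∂(gam K)
    have k1 : (2 * c + l) * (b - (c + l) * a) ≤ 0 := by
      nlinarith [mul_nonneg (mul_nonneg hcp.le hl.le) m0]
    by_contra hcon
    push Not at hcon
    have : 0 < (2 * c + l) * (b - (c + l) * a) := by positivity
    linarith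
  have := hanti (Set.self_mem_Ici) (Set.mem_Ici.2 hl) hl
  have h0 : h 0 = 1 := by simp [h]
  rw [h0] at this
  simp only [h] at this
  rw [Real.exp_neg, ← div_eq_mul_inv, div_le_one (Real.exp_pos _)] at this
  exact this

lemma moment_lower (hε : 0 < ε) (l : ℝ) (hl : 0 ≤ l) :
    ((Fintype.card K : ℝ) - 1) * (∫ x, (nr ε x)⁻¹ * Real.exp (-l * nr ε x) ∂(gam K))
      - l * ∫ x, Real.exp (-l * nr ε x) ∂(gam K) ≤
      ∫ x, nr ε x * Real.exp (-l * nr ε x) ∂(gam K) := by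
  classical
  have cn := continuous_nr (K := K) ε
  have np : ∀ x : K → ℝ, nr ε x ≠ 0 := fun x => (nr_pos hε x).ne'
  have ge := EG_exp_nr (K := K) hε (-l)
  have gi := EG_inv_nr (K := K) hε
  have i0 : Integrable (fun x : K → ℝ => Real.exp (-l * nr ε x)) (gam K) := ge.integrable (by fun_prop)
  have i1 : Integrable (fun x : K → ℝ => nr ε x * Real.exp (-l * nr ε x)) (gam K) :=
    ((EG_nr hε).mul ge).integrable (by fun_prop)
  have im : Integrable (fun x : K → ℝ => (nr ε x)⁻¹ * Real.exp (-l * nr ε x)) (gam K) :=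
    (gi.mul ge).integrable (by fun_prop)
  have i2 : ∀ a : K, Integrable (fun x : K → ℝ => x a * (x a * (nr ε x)⁻¹ * Real.exp (-l * nr ε x))) (gam K) :=
    fun a => ((EG.coord a).mul (((EG.coord a).mul gi).mul ge)).integrable (by fun_prop)
  let φ' : K → (K → ℝ) → ℝ := fun a x => ((nr ε x)⁻¹ - x a * (x a * ((nr ε x)⁻¹ * ((nr ε x)⁻¹ * (nr ε x)⁻¹)))
    + (-l) * (x a * (x a * ((nr ε x)⁻¹ * (nr ε x)⁻¹)))) * Real.exp (-l * nr ε x)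
  have iφ : ∀ a, Integrable (φ' a) (gam K) := by
    intro a
    refine EG.integrable (EG.mul (EG.add ?_ ?_) ge) ?_
    · simp_rw [sub_eq_add_neg, neg_eq_neg_one_mul (_ * _ : ℝ)]
      exact gi.add ((EG.const (-1)).mul ((EG.coord a).mul ((EG.coord a).mul (gi.mul (gi.mul gi)))))
    · exact (EG.const (-l)).mul ((EG.coord a).mul ((EG.coord a).mul (gi.mul gi)))
    · fun_prop
  have st : ∀ a : K, ∫ x, x a * (x a * (nr ε x)⁻¹ * Real.exp (-l * nr ε x)) ∂(gam K) =
      ∫ x, φ' a x ∂(gam K) := by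
    intro a
    refine stein a _ _ ?_ ?_ (i2 a) (iφ a)
    · intro x
      have hp := (ContinuousLinearMap.proj (R := ℝ) (φ := fun _ : K => ℝ) a).hasFDerivAt (x := x)
      have hinv : HasFDerivAt (fun x : K → ℝ => (nr ε x)⁻¹) ((-((nr ε x) ^ 2)⁻¹) • 
          (∑ j, (x j / nr ε x) • (ContinuousLinearMap.proj j : (K → ℝ) →L[ℝ] ℝ))) x :=
        (hasDerivAt_inv (np x)).comp_hasFDerivAt x (hasFDerivAt_nr hε x)
      have h := ((hp.mul hinv).mul (hasFDerivAt_exp_nr hε (-l) x)).hasLineDerivAt (Pi.single a 1)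
      convert! h using 1
      simp only [ContinuousLinearMap.add_apply, ContinuousLinearMap.smul_apply, proj_sum_single]
      simp [φ']
      field_simp [np x]
      ring
    · exact (((EG.coord a).mul gi).mul ge).integrable (by fun_prop)
  have key : ∑ a, ∫ x, φ' a x ∂(gam K) = ∫ x, ∑ a, x a * (x a * (nr ε x)⁻¹ * Real.exp (-l * nr ε x)) ∂(gam K) := by
    rw [integral_finsetSum _ (fun a _ => i2 a)]
    simp_rw [st]
  rw [← integral_finsetSum _ (fun a _ => iφ a)] at key
  have u1 : ∫ x, ∑ a, x a * (x a * (nr ε x)⁻¹ * Real.exp (-l * nr ε x)) ∂(gam K) ≤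
      ∫ x, nr ε x * Real.exp (-l * nr ε x) ∂(gam K) := by
    refine integral_mono (integrable_finsetSum _ (fun a _ => i2 a)) i1 fun x => ?_
    have hp := nr_pos hε x
    have : ∑ a, x a * (x a * (nr ε x)⁻¹ * Real.exp (-l * nr ε x)) =
        ((∑ a, x a ^ 2) * (nr ε x)⁻¹) * Real.exp (-l * nr ε x) := by
      rw [Finset.sum_mul, Finset.sum_mul]; exact Finset.sum_congr rfl fun a _ => by ring
    simp only
    rw [this]
    gcongr
    rw [← div_eq_mul_inv, div_le_iff₀ hp]
    nlinarith [nr_sq ε x, sq_nonneg ε]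
  have u2 : ∫ x, (((Fintype.card K : ℝ) - 1) * ((nr ε x)⁻¹ * Real.exp (-l * nr ε x))
      - l * Real.exp (-l * nr ε x)) ∂(gam K) ≤ ∫ x, ∑ a, φ' a x ∂(gam K) := by
    refine integral_mono ((im.const_mul _).sub (i0.const_mul _))
      (integrable_finsetSum _ (fun a _ => iφ a)) fun x => ?_
    have hp := nr_pos hε x
    have : ∑ a, φ' a x = ((Fintype.card K : ℝ) * (nr ε x)⁻¹ - (∑ a, x a ^ 2) * (nr ε x)⁻¹ ^ 3
        - l * ((∑ a, x a ^ 2) * (nr ε x)⁻¹ ^ 2)) * Real.exp (-l * nr ε x) := by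
      simp only [φ']
      rw [← Finset.sum_mul, Finset.sum_add_distrib, Finset.sum_sub_distrib]
      congr 1
      simp only [Finset.sum_const, Finset.card_univ, nsmul_eq_mul, Finset.sum_mul, Finset.mul_sum]
      rw [sub_eq_add_neg _ (∑ i, l * _), ← Finset.sum_neg_distrib]
      congr 1
      · congr 1
        exact Finset.sum_congr rfl fun a _ => by ring
      · exact Finset.sum_congr rfl fun a _ => by ring
    simp only
    rw [this]
    have hle : (∑ a, x a ^ 2) * (nr ε x)⁻¹ ^ 2 ≤ 1 := by
      rw [inv_pow, ← div_eq_mul_inv, div_le_one (by positivity), nr_sq]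
      nlinarith [sq_nonneg ε]
    have hle3 : (∑ a, x a ^ 2) * (nr ε x)⁻¹ ^ 3 ≤ (nr ε x)⁻¹ := by
      have : (∑ a, x a ^ 2) * (nr ε x)⁻¹ ^ 3 = ((∑ a, x a ^ 2) * (nr ε x)⁻¹ ^ 2) * (nr ε x)⁻¹ := by ring
      rw [this]
      exact mul_le_of_le_one_left (by positivity) hle
    rw [← mul_assoc, ← sub_mul]
    refine mul_le_mul_of_nonneg_right ?_ (Real.exp_pos _).le
    have := mul_le_of_le_one_right hl hle
    linarith
  rw [integral_sub (im.const_mul _) (i0.const_mul _), integral_const_mul, integral_const_mul] at u2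
  linarith

lemma mgf_lower (hε : 0 < ε) (l : ℝ) (hl : 0 ≤ l) (hK : 1 ≤ Fintype.card K) :
    ∫ x, Real.exp (-l * nr ε x) ∂(gam K) ≤
      Real.exp (-l * √((Fintype.card K : ℝ) - 1) + l ^ 2 / 2) := by
  have hK' : (0 : ℝ) ≤ (Fintype.card K : ℝ) - 1 := by
    have : (1 : ℝ) ≤ Fintype.card K := by exact_mod_cast hK
    linarith
  set c := √((Fintype.card K : ℝ) - 1) with hc
  have hc2 : c ^ 2 = (Fintype.card K : ℝ) - 1 := Real.sq_sqrt hK'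
  have hcp : 0 ≤ c := Real.sqrt_nonneg _
  have cn := continuous_nr (K := K) ε
  have np : ∀ x : K → ℝ, nr ε x ≠ 0 := fun x => (nr_pos hε x).ne'
  let h : ℝ → ℝ := fun l => (∫ x, Real.exp (-l * nr ε x) ∂(gam K)) * Real.exp (-(-l * c + l ^ 2 / 2))
  have hd : ∀ l, HasDerivAt h ((-(∫ x, nr ε x * Real.exp (-l * nr ε x) ∂(gam K)) +
      (c - l) * (∫ x, Real.exp (-l * nr ε x) ∂(gam K))) * Real.exp (-(-l * c + l ^ 2 / 2))) l := by
    intro l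
    have h1 : HasDerivAt (fun l : ℝ => -(-l * c + l ^ 2 / 2)) (c - l) l := by
      have := (((hasDerivAt_id l).neg.mul_const c).add (((hasDerivAt_id l).pow 2).div_const 2)).neg
      convert! this using 1
      simp
      ring
    have h2 := (hasDerivAt_mgf_nr (K := K) hε (-l)).comp l (hasDerivAt_neg l)
    convert! h2.mul h1.exp using 1
    simp only [Function.comp]
    ring
  have hanti : AntitoneOn h (Set.Ici 0) := by
    refine antitoneOn_of_hasDerivWithinAt_nonpos (convex_Ici 0)
      (fun l _ => (hd l).continuousAt.continuousWithinAt) (fun l _ => (hd l).hasDerivWithinAt) ?_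
    intro l hl
    rw [interior_Ici] at hl
    have hl : 0 < l := hl
    refine mul_nonpos_of_nonpos_of_nonneg ?_ (Real.exp_pos _).le
    have hm := moment_lower (K := K) hε l hl.le
    have ge := EG_exp_nr (K := K) hε (-l)
    have i0 : Integrable (fun x : K → ℝ => Real.exp (-l * nr ε x)) (gam K) := ge.integrable (by fun_prop)
    have i1 : Integrable (fun x : K → ℝ => nr ε x * Real.exp (-l * nr ε x)) (gam K) :=
      ((EG_nr hε).mul ge).integrable (by fun_prop)
    have im : Integrable (fun x : K → ℝ => (nr ε x)⁻¹ * Real.exp (-l * nr ε x)) (gam K) :=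
      ((EG_inv_nr hε).mul ge).integrable (by fun_prop)
    have q : ∫ x : K → ℝ, (2 * c * Real.exp (-l * nr ε x) - nr ε x * Real.exp (-l * nr ε x)) ∂(gam K) ≤
        ∫ x, c ^ 2 * ((nr ε x)⁻¹ * Real.exp (-l * nr ε x)) ∂(gam K) := by
      refine integral_mono ((i0.const_mul _).sub i1) (im.const_mul _) fun x => ?_
      have hp := nr_pos hε x
      simp only
      rw [← sub_mul, ← mul_assoc]
      gcongr
      rw [← div_eq_mul_inv, le_div_iff₀ hp]
      nlinarith [sq_nonneg (nr ε x - c)]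
    rw [integral_sub (i0.const_mul _) i1, integral_const_mul, integral_const_mul, hc2] at q
    have m0 : 0 ≤ ∫ x : K → ℝ, Real.exp (-l * nr ε x) ∂(gam K) := integral_nonneg fun x => (Real.exp_pos _).le
    nlinarith [mul_nonneg hl.le m0]
  have := hanti (Set.self_mem_Ici) (Set.mem_Ici.2 hl) hl
  have h0 : h 0 = 1 := by simp [h]
  rw [h0] at this
  simp only [h] at this
  rw [Real.exp_neg, ← div_eq_mul_inv, div_le_one (Real.exp_pos _)] at this
  exact this
end

lemma sum3_comm {I J : Type*} [Fintype I] [Fintype J] (a : I → J → J → ℝ) :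
    ∑ i, ∑ j, ∑ v, a v i j = ∑ v, ∑ i, ∑ j, a v i j := by
  rw [Finset.sum_comm (f := fun v i => ∑ j, a v i j)]
  exact Finset.sum_congr rfl fun i _ => Finset.sum_comm

lemma gibbs_interp {I J K₁ K₂ : Type*} [Fintype I] [Nonempty I] [Fintype J] [Fintype K₁] [Fintype K₂]
    (L : Matrix J K₁ ℝ) (M : Matrix J K₂ ℝ) (β l : ℝ) (hl : 0 < l) (hlβ : l ≤ β)
    (f : I → (J → ℝ) → ℝ) (p : I → J → (J → ℝ) → ℝ) (q : I → J → J → (J → ℝ) → ℝ)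
    (hf : ∀ v z, HasFDerivAt (f v) (∑ j, p v j z • (ContinuousLinearMap.proj j : (J → ℝ) →L[ℝ] ℝ)) z)
    (hp : ∀ v i z, HasFDerivAt (p v i)
      (∑ j, q v i j z • (ContinuousLinearMap.proj j : (J → ℝ) →L[ℝ] ℝ)) z)
    (bp : ∀ v i z, |p v i z| ≤ 1) (B : ℝ) (bq : ∀ v i j z, |q v i j z| ≤ B)
    (mq : ∀ v i j, Measurable (q v i j))
    (gf : ∀ v, EG (fun z => Real.exp (β * f v z)))
    (hC1 : ∀ v v' z, ∑ i, ∑ j, p v i z * p v' j z * ((M * Mᵀ) i j - (L * Lᵀ) i j) ≤ 0)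
    (hC2 : ∀ v z, ∑ i, ∑ j, (β * (p v i z * p v j z) + q v i j z) *
      ((M * Mᵀ) i j - (L * Lᵀ) i j) = 0) :
    ∫ x, (∑ v, Real.exp (β * f v (L *ᵥ x))) ^ (l / β) ∂(gam K₁) ≤
      ∫ x, (∑ v, Real.exp (β * f v (M *ᵥ x))) ^ (l / β) ∂(gam K₂) := by
  have hβ : 0 < β := hl.trans_le hlβ
  let ψ : I → (J → ℝ) → ℝ := fun v z => Real.exp (β * f v z)
  let S : (J → ℝ) → ℝ := fun z => ∑ v, ψ v z
  let F : (J → ℝ) → ℝ := fun z => S z ^ (l / β)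
  let m : J → (J → ℝ) → ℝ := fun j z => (∑ v, ψ v z * p v j z) * (S z)⁻¹
  let r : J → J → (J → ℝ) → ℝ := fun i j z =>
    (∑ v, ψ v z * (β * (p v i z * p v j z) + q v i j z)) * (S z)⁻¹
  let F1 : J → (J → ℝ) → ℝ := fun j z => l * (F z * m j z)
  let F2 : J → J → (J → ℝ) → ℝ := fun i j z => l * (F z * ((l - β) * (m i z * m j z) + r i j z))
  have ψp : ∀ v z, 0 < ψ v z := fun v z => Real.exp_pos _
  have Sp : ∀ z, 0 < S z := fun z => Finset.sum_pos (fun v _ => ψp v z) Finset.univ_nonempty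
  have Fp : ∀ z, 0 < F z := fun z => Real.rpow_pos_of_pos (Sp z) _
  have avg : ∀ (c : I → ℝ) (b : ℝ) (z : J → ℝ), (∀ v, |c v| ≤ b) → |(∑ v, ψ v z * c v) * (S z)⁻¹| ≤ b := by
    intro c b z hc
    rw [abs_mul, abs_of_pos (inv_pos.2 (Sp z)), ← div_eq_mul_inv, div_le_iff₀ (Sp z)]
    calc |∑ v, ψ v z * c v| ≤ ∑ v, |ψ v z * c v| := Finset.abs_sum_le_sum_abs _ _
      _ ≤ ∑ v, b * ψ v z := Finset.sum_le_sum fun v _ => by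
        rw [abs_mul, abs_of_pos (ψp v z), mul_comm]
        exact mul_le_mul_of_nonneg_right (hc v) (ψp v z).le
      _ = b * S z := by rw [Finset.mul_sum]
  have bm : ∀ j z, |m j z| ≤ 1 := fun j z => avg _ 1 z fun v => bp v j z
  have br : ∀ i j z, |r i j z| ≤ β + B := fun i j z => avg _ _ z fun v => by
    refine (abs_add_le _ _).trans (add_le_add ?_ (bq v i j z))
    rw [abs_mul, abs_of_pos hβ, abs_mul]
    have := mul_le_mul (bp v i z) (bp v j z) (abs_nonneg _) zero_le_one
    nlinarith
  have mf : ∀ v, Measurable (f v) := fun v =>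
    (continuous_iff_continuousAt.2 fun z => (hf v z).continuousAt).measurable
  have mp : ∀ v i, Measurable (p v i) := fun v i =>
    (continuous_iff_continuousAt.2 fun z => (hp v i z).continuousAt).measurable
  have mS : Measurable S := by
    refine Finset.measurable_sum _ fun v _ => ?_
    exact ((mf v).const_mul β).exp
  have mF : Measurable F := mS.pow_const _
  have mψ : ∀ v, Measurable (ψ v) := fun v => ((mf v).const_mul β).exp
  have mm : ∀ i, Measurable (m i) := fun i =>
    (Finset.measurable_sum _ fun v _ => (mψ v).mul (mp v i)).mul mS.inv
  have mr : ∀ i j, Measurable (r i j) := fun i j =>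
    (Finset.measurable_sum _ fun v _ => (mψ v).mul
      ((((mp v i).mul (mp v j)).const_mul β).add (mq v i j))).mul mS.inv
  -- derivatives
  have hψ : ∀ v z, HasFDerivAt (ψ v)
      (∑ j, (β * (ψ v z * p v j z)) • (ContinuousLinearMap.proj j : (J → ℝ) →L[ℝ] ℝ)) z := by
    intro v z
    convert! ((hf v z).const_mul β).exp using 1
    simp only [Finset.smul_sum, smul_smul]
    exact Finset.sum_congr rfl fun j _ => by congr 1; ring
  have hS : ∀ z, HasFDerivAt S
      (∑ j, (β * (S z * m j z)) • (ContinuousLinearMap.proj j : (J → ℝ) →L[ℝ] ℝ)) z := by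
    intro z
    convert! HasFDerivAt.fun_sum (u := Finset.univ) (fun v _ => hψ v z) using 1
    rw [Finset.sum_comm]
    refine Finset.sum_congr rfl fun j _ => ?_
    rw [← Finset.sum_smul, ← Finset.mul_sum]
    congr 2
    have := (Sp z).ne'
    simp only [m]
    field_simp
  have hF : ∀ z, HasFDerivAt F (∑ j, F1 j z • (ContinuousLinearMap.proj j : (J → ℝ) →L[ℝ] ℝ)) z := by
    intro z
    have h := (Real.hasDerivAt_rpow_const (x := S z) (p := l / β) (Or.inl (Sp z).ne')).comp_hasFDerivAt z (hS z)
    convert! h using 1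
    simp only [Finset.smul_sum, smul_smul]
    refine Finset.sum_congr rfl fun j _ => ?_
    congr 1
    rw [Real.rpow_sub_one (Sp z).ne']
    have := (Sp z).ne'
    simp only [F1, F]
    field_simp
  have hN : ∀ i z, HasFDerivAt (fun z => ∑ v, ψ v z * p v i z)
      (∑ j, (S z * r i j z) • (ContinuousLinearMap.proj j : (J → ℝ) →L[ℝ] ℝ)) z := by
    intro i z
    convert! HasFDerivAt.fun_sum (u := Finset.univ) (fun v _ => (hψ v z).mul (hp v i z)) using 1
    simp only [Finset.smul_sum, smul_smul, ← Finset.sum_add_distrib, ← add_smul]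
    rw [Finset.sum_comm]
    refine Finset.sum_congr rfl fun j _ => ?_
    rw [← Finset.sum_smul]
    congr 1
    have := (Sp z).ne'
    simp only [r]
    rw [mul_comm, mul_assoc, inv_mul_cancel₀ this, mul_one]
    exact Finset.sum_congr rfl fun v _ => by ring
  have hm : ∀ i z, HasFDerivAt (m i)
      (∑ j, (r i j z - β * (m i z * m j z)) • (ContinuousLinearMap.proj j : (J → ℝ) →L[ℝ] ℝ)) z := by
    intro i z
    have hinv := (hasDerivAt_inv (Sp z).ne').comp_hasFDerivAt z (hS z)
    convert! (hN i z).mul hinv using 1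
    simp only [Finset.smul_sum, smul_smul, ← Finset.sum_add_distrib, ← add_smul]
    refine Finset.sum_congr rfl fun j _ => ?_
    congr 1
    have := (Sp z).ne'
    have hmi : ∑ v, ψ v z * p v i z = m i z * S z := by simp only [m]; field_simp
    rw [hmi]
    simp only [Function.comp]
    field_simp
    ring
  have hF1 : ∀ i z, HasFDerivAt (F1 i)
      (∑ j, F2 i j z • (ContinuousLinearMap.proj j : (J → ℝ) →L[ℝ] ℝ)) z := by
    intro i z
    convert! ((hF z).mul (hm i z)).const_mul l using 1
    simp only [Finset.smul_sum, smul_smul, ← Finset.sum_add_distrib, ← add_smul]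
    refine Finset.sum_congr rfl fun j _ => ?_
    congr 1
    simp only [F2, F1]
    ring
  -- growth
  have gS : EG S := EG.sum _ gf
  have gF : EG F := by
    refine ((EG.const (1 : ℝ)).add gS).mono fun z => ?_
    rw [abs_of_pos (Fp z), abs_of_pos (by linarith [Sp z])]
    rcases le_total (S z) 1 with h | h
    · have := Real.rpow_le_one (Sp z).le h (by positivity : 0 ≤ l / β)
      linarith [Sp z]
    · have := Real.rpow_le_rpow_of_exponent_le h ((div_le_one hβ).2 hlβ)
      rw [Real.rpow_one] at this
      linarith [Sp z]
  have gm : ∀ j, EG (m j) := fun j => (EG.const (1 : ℝ)).mono fun z => by simpa using bm j z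
  have gr : ∀ i j, EG (r i j) := fun i j => (EG.const (β + B)).mono fun z =>
    (br i j z).trans (le_abs_self _)
  have gF1 : ∀ j, EG (F1 j) := fun j => (EG.const l).mul (gF.mul (gm j))
  have gF2 : ∀ i j, EG (F2 i j) := fun i j => (EG.const l).mul
    (gF.mul (((EG.const (l - β)).mul ((gm i).mul (gm j))).add (gr i j)))
  have mF2 : ∀ i j, Measurable (F2 i j) := fun i j =>
    (mF.mul ((((mm i).mul (mm j)).const_mul (l - β)).add (mr i j))).const_mul l
  refine interp L M F F1 F2 hF hF1 gF gF1 gF2 mF2 ?_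
  intro z
  set C : J → J → ℝ := fun i j => (M * Mᵀ) i j - (L * Lᵀ) i j with hC
  change 0 ≤ ∑ i, ∑ j, F2 i j z * C i j
  have e1 : ∑ i, ∑ j, m i z * m j z * C i j ≤ 0 := by
    have : ∑ i, ∑ j, m i z * m j z * C i j =
        ∑ v, ∑ v', (ψ v z * ψ v' z * ((S z)⁻¹ * (S z)⁻¹)) * ∑ i, ∑ j, p v i z * p v' j z * C i j := by
      calc ∑ i, ∑ j, m i z * m j z * C i j
          = ∑ i, ∑ j, ∑ v, ∑ v', (ψ v z * ψ v' z * ((S z)⁻¹ * (S z)⁻¹)) * (p v i z * p v' j z * C i j) := by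
            refine Finset.sum_congr rfl fun i _ => Finset.sum_congr rfl fun j _ => ?_
            simp only [m]
            have : (∑ v, ψ v z * p v i z) * (S z)⁻¹ * ((∑ v, ψ v z * p v j z) * (S z)⁻¹) * C i j =
              (∑ v, ψ v z * p v i z) * (∑ v, ψ v z * p v j z) * ((S z)⁻¹ * (S z)⁻¹ * C i j) := by ring
            rw [this, Finset.sum_mul_sum, Finset.sum_mul]
            refine Finset.sum_congr rfl fun v _ => ?_
            rw [Finset.sum_mul]
            exact Finset.sum_congr rfl fun v' _ => by ring
        _ = _ := by
            rw [sum3_comm (fun v i j => ∑ v', (ψ v z * ψ v' z * ((S z)⁻¹ * (S z)⁻¹)) *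
              (p v i z * p v' j z * C i j))]
            refine Finset.sum_congr rfl fun v _ => ?_
            rw [sum3_comm (fun v' i j => (ψ v z * ψ v' z * ((S z)⁻¹ * (S z)⁻¹)) *
              (p v i z * p v' j z * C i j))]
            simp only [Finset.mul_sum]
    rw [this]
    refine Finset.sum_nonpos fun v _ => Finset.sum_nonpos fun v' _ => ?_
    have := ψp v z
    have := ψp v' z
    have := Sp z
    exact mul_nonpos_of_nonneg_of_nonpos (by positivity) (hC1 v v' z)
  have e2 : ∑ i, ∑ j, r i j z * C i j = 0 := by
    have : ∑ i, ∑ j, r i j z * C i j =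
        ∑ v, (ψ v z * (S z)⁻¹) * ∑ i, ∑ j, (β * (p v i z * p v j z) + q v i j z) * C i j := by
      simp only [r, Finset.mul_sum, Finset.sum_mul]
      rw [sum3_comm]
      exact Finset.sum_congr rfl fun v _ => Finset.sum_congr rfl fun i _ =>
        Finset.sum_congr rfl fun j _ => by ring
    rw [this]
    exact Finset.sum_eq_zero fun v _ => by rw [hC2 v z, mul_zero]
  have e3 : ∑ i, ∑ j, F2 i j z * C i j =
      l * (F z * ((l - β) * (∑ i, ∑ j, m i z * m j z * C i j) + ∑ i, ∑ j, r i j z * C i j)) := by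
    simp only [Finset.mul_sum, ← Finset.sum_add_distrib, F2]
    exact Finset.sum_congr rfl fun i _ => Finset.sum_congr rfl fun j _ => by ring
  rw [e3, e2, add_zero]
  refine mul_nonneg hl.le (mul_nonneg (Fp z).le ?_)
  exact mul_nonneg_of_nonpos_of_nonpos (by linarith) e1

section
variable {I R N Mi : Type*} [Fintype I] [Fintype R] [Fintype N] [Fintype Mi]

/-- coordinates of block `v` -/
def wc (v : I) (z : (I × R) ⊕ I → ℝ) : R → ℝ := fun i => z (Sum.inl (v, i))

def fJ (σ ε : ℝ) (v : I) (z : (I × R) ⊕ I → ℝ) : ℝ := σ * nr ε (wc v z) + z (Sum.inr v)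

open Classical in
def pJ (σ ε : ℝ) (v : I) (j : (I × R) ⊕ I) (z : (I × R) ⊕ I → ℝ) : ℝ :=
  Sum.elim (fun vi => if vi.1 = v then σ * (wc v z vi.2 * (nr ε (wc v z))⁻¹) else 0)
    (fun v' => if v' = v then 1 else 0) j

open Classical in
def qJ (σ ε : ℝ) (v : I) (j k : (I × R) ⊕ I) (z : (I × R) ⊕ I → ℝ) : ℝ :=
  Sum.elim (fun vi => Sum.elim (fun wk => if vi.1 = v ∧ wk.1 = v then
      σ * ((if vi.2 = wk.2 then 1 else 0) * (nr ε (wc v z))⁻¹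
        - (wc v z vi.2 * (nr ε (wc v z))⁻¹) * (wc v z wk.2 * (nr ε (wc v z))⁻¹) * (nr ε (wc v z))⁻¹) else 0)
      (fun _ => 0) k)
    (fun _ => 0) j

def LJ (W : Matrix R N ℝ) (u : I → Mi → ℝ) : Matrix ((I × R) ⊕ I) ((N × Mi) ⊕ Unit) ℝ :=
  fun j k => Sum.elim (fun vi => Sum.elim (fun ab => W vi.2 ab.1 * u vi.1 ab.2) (fun _ => 0) k)
    (fun _ => Sum.elim (fun _ => 0) (fun _ => 1) k) j

open Classical in
def MJ (u : I → Mi → ℝ) : Matrix ((I × R) ⊕ I) (R ⊕ Mi) ℝ :=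
  fun j k => Sum.elim (fun vi => Sum.elim (fun i => if vi.2 = i then 1 else 0) (fun _ => 0) k)
    (fun v => Sum.elim (fun _ => 0) (fun b => u v b) k) j

open Classical in
def CJ (u : I → Mi → ℝ) (j k : (I × R) ⊕ I) : ℝ :=
  Sum.elim (fun vi => Sum.elim (fun wk => if vi.2 = wk.2 then 1 - u vi.1 ⬝ᵥ u wk.1 else 0) (fun _ => 0) k)
    (fun v => Sum.elim (fun _ => 0) (fun w => u v ⬝ᵥ u w - 1) k) j

lemma CJ_eq [DecidableEq R] (W : Matrix R N ℝ) (hW : W * Wᵀ = 1) (u : I → Mi → ℝ) (j k : (I × R) ⊕ I) :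
    (((MJ u : Matrix ((I × R) ⊕ I) (R ⊕ Mi) ℝ) * (MJ u : Matrix ((I × R) ⊕ I) (R ⊕ Mi) ℝ)ᵀ) j k - (LJ W u * (LJ W u)ᵀ) j k) = CJ u j k := by
  have hW' : ∀ i i', ∑ a, W i a * W i' a = if i = i' then 1 else 0 := by
    intro i i'
    have := congrFun (congrFun hW i) i'
    rw [Matrix.mul_apply, Matrix.one_apply] at this
    simpa using this
  rcases j with ⟨v, i⟩ | v <;> rcases k with ⟨v', i'⟩ | v'
  · simp only [Matrix.mul_apply, Matrix.transpose_apply, MJ, LJ, CJ, Fintype.sum_sum_type, Sum.elim_inl, Sum.elim_inr]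
    have : ∑ x : N × Mi, W i x.1 * u v x.2 * (W i' x.1 * u v' x.2) =
        (∑ a, W i a * W i' a) * (u v ⬝ᵥ u v') := by
      rw [Fintype.sum_prod_type, dotProduct, Finset.sum_mul_sum]
      exact Finset.sum_congr rfl fun a _ => Finset.sum_congr rfl fun b _ => by ring
    rw [this, hW']
    by_cases h : i = i'
    · subst h; simp
    · simp [h, eq_comm]
  · simp [Matrix.mul_apply, MJ, LJ, CJ]
  · simp [Matrix.mul_apply, MJ, LJ, CJ]
  · simp [Matrix.mul_apply, MJ, LJ, CJ, dotProduct]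

lemma hasFDerivAt_wc (v : I) (z : (I × R) ⊕ I → ℝ) : HasFDerivAt (wc (R := R) v)
    (ContinuousLinearMap.pi fun i => (ContinuousLinearMap.proj (Sum.inl (v, i)) :
      ((I × R) ⊕ I → ℝ) →L[ℝ] ℝ)) z :=
  (ContinuousLinearMap.pi fun i => (ContinuousLinearMap.proj (Sum.inl (v, i)) :
      ((I × R) ⊕ I → ℝ) →L[ℝ] ℝ)).hasFDerivAt

lemma hasFDerivAt_nrwc {ε : ℝ} (hε : 0 < ε) (v : I) (z : (I × R) ⊕ I → ℝ) :
    HasFDerivAt (fun z => nr ε (wc (R := R) v z))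
      (∑ i, (wc v z i * (nr ε (wc v z))⁻¹) • (ContinuousLinearMap.proj (Sum.inl (v, i)) :
      ((I × R) ⊕ I → ℝ) →L[ℝ] ℝ)) z := by
  have h := (hasFDerivAt_nr hε (wc v z)).comp z (hasFDerivAt_wc v z)
  convert! h using 1
  ext x
  simp [div_eq_mul_inv]

lemma hf_J {ε : ℝ} (hε : 0 < ε) (σ : ℝ) (v : I) (z : (I × R) ⊕ I → ℝ) :
    HasFDerivAt (fJ (R := R) σ ε v) (∑ j, pJ σ ε v j z • (ContinuousLinearMap.proj j :
      ((I × R) ⊕ I → ℝ) →L[ℝ] ℝ)) z := by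
  classical
  have h := ((hasFDerivAt_nrwc hε v z).const_mul σ).add
    ((ContinuousLinearMap.proj (Sum.inr v) : ((I × R) ⊕ I → ℝ) →L[ℝ] ℝ).hasFDerivAt (x := z))
  convert! h using 1
  simp only [Fintype.sum_sum_type, Fintype.sum_prod_type, pJ, Sum.elim_inl, Sum.elim_inr, ite_smul, zero_smul,
    one_smul]
  congr 1
  · rw [Finset.sum_comm]
    simp [Finset.smul_sum, smul_smul]
  · simp

lemma hp_J {ε : ℝ} (hε : 0 < ε) (σ : ℝ) (v : I) (j : (I × R) ⊕ I) (z : (I × R) ⊕ I → ℝ) :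
    HasFDerivAt (pJ (R := R) σ ε v j) (∑ k, qJ σ ε v j k z • (ContinuousLinearMap.proj k :
      ((I × R) ⊕ I → ℝ) →L[ℝ] ℝ)) z := by
  classical
  have hne : nr ε (wc v z) ≠ 0 := (nr_pos hε _).ne'
  rcases j with ⟨v', i⟩ | v'
  · by_cases hv : v' = v
    · subst hv
      have h1 : HasFDerivAt (fun z : (I × R) ⊕ I → ℝ => wc v' z i) (ContinuousLinearMap.proj (Sum.inl (v', i)) :
        ((I × R) ⊕ I → ℝ) →L[ℝ] ℝ) z :=
        (ContinuousLinearMap.proj (Sum.inl (v', i)) : ((I × R) ⊕ I → ℝ) →L[ℝ] ℝ).hasFDerivAt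
      have hinv := (hasDerivAt_inv hne).comp_hasFDerivAt z (hasFDerivAt_nrwc hε v' z)
      have h := (h1.mul hinv).const_mul σ
      have e : pJ (R := R) σ ε v' (Sum.inl (v', i)) = fun z => σ * (wc v' z i * (nr ε (wc v' z))⁻¹) := by
        ext z; simp [pJ]
      rw [e]
      convert! h using 1
      ext x
      simp only [Fintype.sum_sum_type, Fintype.sum_prod_type, qJ, Sum.elim_inl, Sum.elim_inr]
      simp only [true_and, zero_smul, Finset.sum_const_zero, add_zero]
      rw [Finset.sum_comm]
      simp only [ite_smul, zero_smul, Finset.sum_ite_eq', Finset.mem_univ, if_true, mul_sub, sub_smul,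
        Finset.sum_sub_distrib]
      simp [Finset.mul_sum]
      rw [add_comm]
      simp only [sub_mul, Finset.sum_sub_distrib, ite_mul, zero_mul, Finset.sum_ite_eq, Finset.mem_univ, if_true]
      rw [sub_eq_add_neg, ← Finset.sum_neg_distrib, ← Finset.sum_neg_distrib]
      congr 1
      · ring
      · exact Finset.sum_congr rfl fun k _ => by rw [pow_two, mul_inv]; ring
    · have e : pJ (R := R) σ ε v (Sum.inl (v', i)) = fun z => 0 := by
        ext z; simp [pJ, hv]
      rw [e]
      convert! hasFDerivAt_const (0 : ℝ) z using 2
      refine Finset.sum_eq_zero fun k _ => ?_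
      rcases k with ⟨w, k⟩ | w <;> simp [qJ, hv]
  · have e : pJ (R := R) σ ε v (Sum.inr v') = fun z => if v' = v then 1 else 0 := by
        ext z; simp [pJ]
    rw [e]
    convert! hasFDerivAt_const (if v' = v then (1 : ℝ) else 0) z using 2
    refine Finset.sum_eq_zero fun k _ => ?_
    simp [qJ]

lemma abs_coord_div {ε : ℝ} (hε : 0 < ε) (w : R → ℝ) (i : R) : |w i * (nr ε w)⁻¹| ≤ 1 := by
  have hp := nr_pos hε w
  rw [abs_mul, abs_of_pos (inv_pos.2 hp), ← div_eq_mul_inv, div_le_one hp]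
  apply abs_le_of_sq_le_sq _ hp.le
  rw [nr_sq]
  have := Finset.single_le_sum (f := fun a => w a ^ 2) (fun a _ => sq_nonneg _) (Finset.mem_univ i)
  nlinarith [sq_nonneg ε]

lemma bp_J {ε σ : ℝ} (hε : 0 < ε) (hσ : |σ| = 1) (v : I) (j : (I × R) ⊕ I) (z : (I × R) ⊕ I → ℝ) :
    |pJ σ ε v j z| ≤ 1 := by
  rcases j with ⟨v', i⟩ | v'
  · simp only [pJ, Sum.elim_inl]
    split_ifs
    · rw [abs_mul, hσ, one_mul]; exact abs_coord_div hε _ _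
    · simp
  · simp only [pJ, Sum.elim_inr]
    split_ifs <;> simp

lemma bq_J {ε σ : ℝ} (hε : 0 < ε) (hσ : |σ| = 1) (v : I) (j k : (I × R) ⊕ I) (z : (I × R) ⊕ I → ℝ) :
    |qJ σ ε v j k z| ≤ 2 * ε⁻¹ := by
  have h0 : |(0 : ℝ)| ≤ 2 * ε⁻¹ := by rw [abs_zero]; positivity
  rcases j with ⟨v', i⟩ | v' <;> rcases k with ⟨w, k⟩ | w <;> simp only [qJ, Sum.elim_inl, Sum.elim_inr]
  · split_ifs with h1
    all_goals try exact h0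
    all_goals
      have hi : (nr ε (wc v z))⁻¹ ≤ ε⁻¹ := by gcongr; exact le_nr hε _
      have hi0 : 0 ≤ (nr ε (wc v z))⁻¹ := inv_nonneg.2 (nr_nonneg _ _)
      rw [abs_mul, hσ, one_mul]
      refine (abs_sub _ _).trans ?_
      rw [two_mul]
      refine add_le_add ?_ ?_
      · simp only [one_mul, zero_mul, abs_of_nonneg hi0, abs_zero]
        first | exact hi | exact hi0.trans hi
      · rw [abs_mul, abs_mul, abs_of_nonneg hi0]
        have a1 := abs_coord_div hε (wc v z) i
        have a2 := abs_coord_div hε (wc v z) k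
        have := mul_le_mul a1 a2 (abs_nonneg _) zero_le_one
        calc _ ≤ 1 * (nr ε (wc v z))⁻¹ := by gcongr; simpa using this
          _ ≤ _ := by rw [one_mul]; exact hi
  all_goals exact h0

lemma mq_J (σ ε : ℝ) (v : I) (j k : (I × R) ⊕ I) : Measurable (qJ (R := R) σ ε v j k) := by
  have hw : ∀ i, Measurable (fun z : (I × R) ⊕ I → ℝ => wc (R := R) v z i) := fun i => measurable_pi_apply _
  have hn : Measurable (fun z : (I × R) ⊕ I → ℝ => nr ε (wc (R := R) v z)) :=
    (continuous_nr ε).measurable.comp (measurable_pi_iff.2 hw)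
  rcases j with ⟨v', i⟩ | v' <;> rcases k with ⟨w, k⟩ | w <;> unfold qJ <;> simp only [Sum.elim_inl, Sum.elim_inr]
  · split_ifs <;> fun_prop
  all_goals fun_prop

lemma gf_J {ε : ℝ} (hε : 0 < ε) (σ β : ℝ) (v : I) :
    EG (fun z => Real.exp (β * fJ (R := R) σ ε v z)) := by
  have h1 : EG (fun z : (I × R) ⊕ I → ℝ => Real.exp ((β * σ) * nr ε (wc (R := R) v z))) :=
    (EG_exp_nr hε (β * σ)).comp _ 1 zero_le_one fun z => by
      rw [one_mul, pi_norm_le_iff_of_nonneg (norm_nonneg _)]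
      exact fun i => norm_le_pi_norm z (Sum.inl (v, i))
  have h2 : EG (fun z : (I × R) ⊕ I → ℝ => Real.exp (β * z (Sum.inr v))) := by
    refine ⟨|β| + 1, by positivity, fun z => ?_⟩
    rw [abs_of_pos (Real.exp_pos _)]
    have hz := norm_le_pi_norm z (Sum.inr v)
    have : β * z (Sum.inr v) ≤ (|β| + 1) * ‖z‖ := by
      calc β * z (Sum.inr v) ≤ |β| * |z (Sum.inr v)| := by rw [← abs_mul]; exact le_abs_self _
        _ ≤ |β| * ‖z‖ := by gcongr; exact hz
        _ ≤ _ := by nlinarith [norm_nonneg z]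
    calc _ ≤ Real.exp ((|β| + 1) * ‖z‖) := Real.exp_le_exp.2 this
      _ ≤ _ := le_mul_of_one_le_left (Real.exp_pos _).le (by linarith [abs_nonneg β])
  convert! h1.mul h2 using 2 with z
  rw [← Real.exp_add]; congr 1; unfold fJ; ring

lemma sum_cs {ε : ℝ} (hε : 0 < ε) (w w' : R → ℝ) :
    ∑ i, (w i * (nr ε w)⁻¹) * (w' i * (nr ε w')⁻¹) ≤ 1 := by
  have hp := nr_pos hε w
  have hp' := nr_pos hε w'
  have e : ∑ i, (w i * (nr ε w)⁻¹) * (w' i * (nr ε w')⁻¹) = (∑ i, w i * w' i) / (nr ε w * nr ε w') := by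
    rw [Finset.sum_div]
    exact Finset.sum_congr rfl fun i _ => by field_simp
  rw [e, div_le_one (by positivity)]
  refine (abs_le_of_sq_le_sq' ?_ (by positivity)).2
  have := Finset.sum_mul_sq_le_sq_mul_sq Finset.univ w w'
  refine this.trans ?_
  rw [mul_pow, nr_sq, nr_sq]
  gcongr <;> nlinarith [sq_nonneg ε]

lemma sum_pJ_mul (σ ε : ℝ) (v : I) (z : (I × R) ⊕ I → ℝ) (c : (I × R) ⊕ I → ℝ) :
    ∑ j, pJ σ ε v j z * c j = (∑ i, σ * (wc v z i * (nr ε (wc v z))⁻¹) * c (Sum.inl (v, i)))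
      + c (Sum.inr v) := by
  classical
  simp only [Fintype.sum_sum_type, Fintype.sum_prod_type, pJ, Sum.elim_inl, Sum.elim_inr]
  rw [Finset.sum_comm]
  simp

lemma hC1_J {ε σ : ℝ} (hε : 0 < ε) (hσ : |σ| = 1) (u : I → Mi → ℝ) (hu : ∀ v, u v ⬝ᵥ u v = 1)
    (v v' : I) (z : (I × R) ⊕ I → ℝ) :
    ∑ i, ∑ j, pJ σ ε v i z * pJ σ ε v' j z * CJ u i j ≤ 0 := by
  classical
  simp_rw [mul_assoc, ← Finset.mul_sum, sum_pJ_mul]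
  simp only [CJ, Sum.elim_inl, Sum.elim_inr, mul_ite, mul_zero, Finset.sum_ite_eq, Finset.mem_univ, if_true,
    Finset.sum_const_zero, add_zero, zero_add]
  have h1 : u v ⬝ᵥ u v' ≤ 1 := by
    have := hu v
    have := hu v'
    simp only [dotProduct] at *
    have h : 0 ≤ ∑ i, (u v i - u v' i) ^ 2 := by positivity
    have e : ∑ i, (u v i - u v' i) ^ 2 = ∑ i, u v i * u v i + ∑ i, u v' i * u v' i - 2 * ∑ i, u v i * u v' i := by
      rw [Finset.mul_sum, ← Finset.sum_add_distrib, ← Finset.sum_sub_distrib]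
      exact Finset.sum_congr rfl fun i _ => by ring
    linarith
  have h2 := sum_cs hε (wc v z) (wc v' z)
  have hs : σ * σ = 1 := by rw [← abs_mul_abs_self, hσ]; norm_num
  have e : ∑ i, σ * (wc v z i * (nr ε (wc v z))⁻¹) *
      (σ * (wc v' z i * (nr ε (wc v' z))⁻¹) * (1 - u v ⬝ᵥ u v')) =
      (∑ i, (wc v z i * (nr ε (wc v z))⁻¹) * (wc v' z i * (nr ε (wc v' z))⁻¹)) * (1 - u v ⬝ᵥ u v') := by
    rw [Finset.sum_mul]
    refine Finset.sum_congr rfl fun i _ => ?_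
    calc _ = (σ * σ) * ((wc v z i * (nr ε (wc v z))⁻¹) * (wc v' z i * (nr ε (wc v' z))⁻¹) * (1 - u v ⬝ᵥ u v')) := by ring
      _ = _ := by rw [hs, one_mul]
  simp only [mul_assoc] at e h2 ⊢
  rw [e]
  nlinarith

lemma hC2_J {ε σ β : ℝ} (u : I → Mi → ℝ) (hu : ∀ v, u v ⬝ᵥ u v = 1)
    (v : I) (z : (I × R) ⊕ I → ℝ) :
    ∑ i, ∑ j, (β * (pJ σ ε v i z * pJ σ ε v j z) + qJ σ ε v i j z) * CJ u i j = 0 := by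
  classical
  refine Finset.sum_eq_zero fun j _ => Finset.sum_eq_zero fun k _ => ?_
  rcases j with ⟨v', i⟩ | v' <;> rcases k with ⟨w, k⟩ | w <;>
    simp only [pJ, qJ, CJ, Sum.elim_inl, Sum.elim_inr] <;>
    by_cases h1 : v' = v <;> by_cases h2 : w = v <;> simp [h1, h2, hu]

end

section
variable {I R N Mi : Type*} [Fintype I] [Fintype R] [Fintype N] [Fintype Mi]

/-- reshape a vector into a matrix -/
def GM (g : N × Mi → ℝ) : Matrix N Mi ℝ := fun a b => g (a, b)

lemma wc_LJ (W : Matrix R N ℝ) (u : I → Mi → ℝ) (x : (N × Mi) ⊕ Unit → ℝ) (v : I) :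
    wc v (LJ W u *ᵥ x) = W *ᵥ (GM (fun a => x (Sum.inl a)) *ᵥ u v) := by
  ext i
  simp only [wc, LJ, mulVec, dotProduct, Fintype.sum_sum_type, Fintype.sum_prod_type, Sum.elim_inl, Sum.elim_inr,
    GM, zero_mul, Finset.sum_const_zero, add_zero, Finset.mul_sum]
  exact Finset.sum_congr rfl fun a _ => Finset.sum_congr rfl fun b _ => by ring

lemma inr_LJ (W : Matrix R N ℝ) (u : I → Mi → ℝ) (x : (N × Mi) ⊕ Unit → ℝ) (v : I) :
    (LJ W u *ᵥ x) (Sum.inr v) = x (Sum.inr ()) := by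
  simp [LJ, mulVec, dotProduct]

lemma wc_MJ (u : I → Mi → ℝ) (x : R ⊕ Mi → ℝ) (v : I) :
    wc v ((MJ u : Matrix ((I × R) ⊕ I) (R ⊕ Mi) ℝ) *ᵥ x) = fun i => x (Sum.inl i) := by
  classical
  ext i
  simp only [wc, MJ, mulVec, dotProduct, Fintype.sum_sum_type, Sum.elim_inl, Sum.elim_inr, zero_mul,
    Finset.sum_const_zero, add_zero, ite_mul, one_mul, Finset.sum_ite_eq, Finset.mem_univ, if_true]

lemma inr_MJ (u : I → Mi → ℝ) (x : R ⊕ Mi → ℝ) (v : I) :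
    ((MJ u : Matrix ((I × R) ⊕ I) (R ⊕ Mi) ℝ) *ᵥ x) (Sum.inr v) = u v ⬝ᵥ fun b => x (Sum.inr b) := by
  simp [MJ, mulVec, dotProduct]

lemma mgf_unit (l : ℝ) : ∫ x : Unit → ℝ, Real.exp (l * x ()) ∂(gam Unit) = Real.exp (l ^ 2 / 2) := by
  have h := (measurePreserving_eval (fun _ : Unit => gaussianReal 0 1) ()).integral_comp'
    (f := MeasurableEquiv.funUnique Unit ℝ) (g := fun y => Real.exp (l * y))
  have h2 := mgf_gaussianReal (p := gaussianReal 0 1) (X := id) (μ := 0) (v := 1) (by simp) l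
  simp only [mgf, id] at h2
  have h3 : ∫ x : Unit → ℝ, Real.exp (l * x ()) ∂(gam Unit) = ∫ x, Real.exp (l * x) ∂(gaussianReal 0 1) := h
  rw [h3, h2]
  simp

lemma dot_le_nr {ε : ℝ} (u h : Mi → ℝ) (hu : u ⬝ᵥ u = 1) : u ⬝ᵥ h ≤ nr ε h := by
  refine (abs_le_of_sq_le_sq' ?_ (nr_nonneg _ _)).2
  have := Finset.sum_mul_sq_le_sq_mul_sq Finset.univ u h
  rw [nr_sq]
  have e : ∑ i, u i ^ 2 = 1 := by
    rw [← hu]; exact Finset.sum_congr rfl fun i _ => by ring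
  rw [e, one_mul] at this
  refine this.trans ?_
  nlinarith [sq_nonneg ε]

lemma GM_mulVec (W : Matrix R N ℝ) (u : Mi → ℝ) (g : N × Mi → ℝ) :
    W *ᵥ (GM g *ᵥ u) = (fun i ab => W i ab.1 * u ab.2 : Matrix R (N × Mi) ℝ) *ᵥ g := by
  ext i
  simp only [mulVec, dotProduct, Fintype.sum_prod_type, GM, Finset.mul_sum]
  exact Finset.sum_congr rfl fun a _ => Finset.sum_congr rfl fun b _ => by ring

lemma continuous_GM (W : Matrix R N ℝ) (u : Mi → ℝ) :
    Continuous fun g : N × Mi → ℝ => W *ᵥ (GM g *ᵥ u) := by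
  simp_rw [GM_mulVec]
  fun_prop

lemma tail_fin [DecidableEq R] [Nonempty I] (W : Matrix R N ℝ) (hW : W * Wᵀ = 1) (u : I → Mi → ℝ)
    (hu : ∀ v, u v ⬝ᵥ u v = 1) {ε σ β l : ℝ} (hε : 0 < ε) (hσ : |σ| = 1) (hl : 0 < l) (hlβ : l ≤ β) (c : ℝ) :
    (gam (N × Mi)).real {g | ∃ v, c ≤ σ * nr ε (W *ᵥ (GM g *ᵥ u v))} * Real.exp (l * c + l ^ 2 / 2) ≤
      (Fintype.card I : ℝ) ^ (l / β) * ((∫ x, Real.exp ((l * σ) * nr ε x) ∂(gam R)) *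
        ∫ x, Real.exp (l * nr ε x) ∂(gam Mi)) := by
  have hβ : 0 < β := hl.trans_le hlβ
  have main := gibbs_interp (LJ W u) (MJ u : Matrix ((I × R) ⊕ I) (R ⊕ Mi) ℝ) β l hl hlβ (fJ (R := R) σ ε)
    (pJ σ ε) (qJ σ ε) (hf_J hε σ) (hp_J hε σ) (bp_J hε hσ) (2 * ε⁻¹) (bq_J hε hσ) (mq_J σ ε)
    (gf_J hε σ β) (by simp_rw [CJ_eq W hW]; exact hC1_J hε hσ u hu)
    (by simp_rw [CJ_eq W hW]; exact hC2_J u hu)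
  simp only [fJ, wc_LJ, inr_LJ, wc_MJ, inr_MJ] at main
  let Φ : (N × Mi → ℝ) → ℝ := fun g => (∑ v, Real.exp (β * (σ * nr ε (W *ᵥ (GM g *ᵥ u v))))) ^ (l / β)
  have Sp : ∀ g : N × Mi → ℝ, 0 < ∑ v, Real.exp (β * (σ * nr ε (W *ᵥ (GM g *ᵥ u v)))) := fun g =>
    Finset.sum_pos (fun v _ => Real.exp_pos _) Finset.univ_nonempty
  have expβ : ∀ y : ℝ, Real.exp (β * y) ^ (l / β) = Real.exp (l * y) := fun y => by
    rw [← Real.exp_mul]; congr 1; field_simp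
  have hL : ∫ x, (∑ v, Real.exp (β * (σ * nr ε (W *ᵥ (GM (fun a => x (Sum.inl a)) *ᵥ u v)) + x (Sum.inr ())))) ^
      (l / β) ∂(gam ((N × Mi) ⊕ Unit)) = (∫ g, Φ g ∂(gam (N × Mi))) * Real.exp (l ^ 2 / 2) := by
    rw [← mgf_unit l, ← integral_gam_mul Φ (fun x : Unit → ℝ => Real.exp (l * x ()))]
    refine integral_congr_ae (ae_of_all _ fun x => ?_)
    simp only [mul_add, Real.exp_add, Φ]
    rw [← Finset.sum_mul, Real.mul_rpow (Sp _).le (Real.exp_pos _).le, expβ]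
  rw [hL] at main
  have cn := continuous_nr (K := R) ε
  have cn' := continuous_nr (K := Mi) ε
  have gi1 : Integrable (fun x : R ⊕ Mi → ℝ => Real.exp ((l * σ) * nr ε (fun i => x (Sum.inl i)))
      * Real.exp (l * nr ε (fun i => x (Sum.inr i)))) (gam (R ⊕ Mi)) := by
    have a : EG (fun x : R ⊕ Mi → ℝ => Real.exp ((l * σ) * nr ε (fun i => x (Sum.inl i)))) :=
      (EG_exp_nr hε (l * σ)).comp _ 1 zero_le_one fun z => by
        rw [one_mul, pi_norm_le_iff_of_nonneg (norm_nonneg _)]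
        exact fun i => norm_le_pi_norm z (Sum.inl i)
    have b : EG (fun x : R ⊕ Mi → ℝ => Real.exp (l * nr ε (fun i => x (Sum.inr i)))) :=
      (EG_exp_nr hε l).comp _ 1 zero_le_one fun z => by
        rw [one_mul, pi_norm_le_iff_of_nonneg (norm_nonneg _)]
        exact fun i => norm_le_pi_norm z (Sum.inr i)
    refine (a.mul b).integrable ?_
    fun_prop
  have hR : ∫ x, (∑ v, Real.exp (β * (σ * nr ε (fun i => x (Sum.inl i)) + u v ⬝ᵥ fun b => x (Sum.inr b)))) ^
      (l / β) ∂(gam (R ⊕ Mi)) ≤ (Fintype.card I : ℝ) ^ (l / β) * ((∫ x, Real.exp ((l * σ) * nr ε x) ∂(gam R)) *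
        ∫ x, Real.exp (l * nr ε x) ∂(gam Mi)) := by
    rw [← integral_gam_mul (fun x => Real.exp ((l * σ) * nr ε x)) (fun x => Real.exp (l * nr ε x)),
      ← integral_const_mul]
    refine integral_mono_of_nonneg (ae_of_all _ fun x => ?_) (gi1.const_mul _) (ae_of_all _ fun x => ?_)
    · exact Real.rpow_nonneg (Finset.sum_nonneg fun v _ => (Real.exp_pos _).le) _
    · simp only
      calc _ ≤ (∑ _v : I, Real.exp (β * (σ * nr ε (fun i => x (Sum.inl i)) + nr ε (fun i => x (Sum.inr i))))) ^ (l / β) := by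
            gcongr
            · exact dot_le_nr _ _ (hu _)
        _ = _ := by
            rw [Finset.sum_const, Finset.card_univ, nsmul_eq_mul, Real.mul_rpow (by positivity) (Real.exp_pos _).le,
              expβ, ← Real.exp_add]
            congr 2; ring
  have main2 := main.trans hR
  refine le_trans ?_ main2
  rw [Real.exp_add, ← mul_assoc]
  refine mul_le_mul_of_nonneg_right ?_ (Real.exp_pos _).le
  have Φle : ∀ g v, Real.exp (l * (σ * nr ε (W *ᵥ (GM g *ᵥ u v)))) ≤ Φ g := by
    intro g v
    rw [← expβ]
    refine Real.rpow_le_rpow (Real.exp_pos _).le ?_ (by positivity)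
    exact Finset.single_le_sum (f := fun v => Real.exp (β * (σ * nr ε (W *ᵥ (GM g *ᵥ u v)))))
      (fun v _ => (Real.exp_pos _).le) (Finset.mem_univ v)
  have iΦ : Integrable Φ (gam (N × Mi)) := by
    have cΦ : Continuous fun g : N × Mi → ℝ => ∑ v, Real.exp (β * (σ * nr ε (W *ᵥ (GM g *ᵥ u v)))) := by
      refine continuous_finset_sum _ fun v _ => ?_
      exact ((cn.comp (continuous_GM W (u v))).const_mul σ |>.const_mul β).rexp
    have gS : EG (fun g : N × Mi → ℝ => ∑ v, Real.exp (β * (σ * nr ε (W *ᵥ (GM g *ᵥ u v))))) := by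
      refine EG.sum _ fun v => ?_
      simp_rw [GM_mulVec, ← mul_assoc]
      exact (EG_exp_nr hε (β * σ)).mulVec _
    refine EG.integrable (((EG.const (1 : ℝ)).add gS).mono fun z => ?_) (cΦ.measurable.pow_const _)
    have Sz := Sp z
    have Fp : 0 < Φ z := Real.rpow_pos_of_pos Sz _
    rw [abs_of_pos Fp, abs_of_pos (by linarith)]
    rcases le_total (∑ v, Real.exp (β * (σ * nr ε (W *ᵥ (GM z *ᵥ u v))))) 1 with h | h
    · have := Real.rpow_le_one Sz.le h (by positivity : 0 ≤ l / β)
      linarith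
    · have := Real.rpow_le_rpow_of_exponent_le h ((div_le_one hβ).2 hlβ)
      rw [Real.rpow_one] at this
      linarith
  have mk := mul_meas_ge_le_integral_of_nonneg (μ := gam (N × Mi)) (f := Φ)
    (ae_of_all _ fun g => Real.rpow_nonneg (Sp g).le _) iΦ (Real.exp (l * c))
  rw [mul_comm]
  refine le_trans ?_ mk
  refine mul_le_mul_of_nonneg_left (measureReal_mono ?_) (Real.exp_pos _).le
  rintro g ⟨v, hv⟩
  exact le_trans (Real.exp_le_exp.2 (mul_le_mul_of_nonneg_left hv hl.le)) (Φle g v)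

/-- remove the temperature -/
lemma tail_fin2 [DecidableEq R] [Nonempty I] (W : Matrix R N ℝ) (hW : W * Wᵀ = 1) (u : I → Mi → ℝ)
    (hu : ∀ v, u v ⬝ᵥ u v = 1) {ε σ l : ℝ} (hε : 0 < ε) (hσ : |σ| = 1) (hl : 0 < l) (c : ℝ) :
    (gam (N × Mi)).real {g | ∃ v, c ≤ σ * nr ε (W *ᵥ (GM g *ᵥ u v))} * Real.exp (l * c + l ^ 2 / 2) ≤
      ((∫ x, Real.exp ((l * σ) * nr ε x) ∂(gam R)) * ∫ x, Real.exp (l * nr ε x) ∂(gam Mi)) := by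
  have h1 : Tendsto (fun β : ℝ => (Fintype.card I : ℝ) ^ (l / β)) atTop (nhds 1) := by
    have h0 : Tendsto (fun β : ℝ => l / β) atTop (nhds 0) := tendsto_const_nhds.div_atTop tendsto_id
    have hc : (Fintype.card I : ℝ) ≠ 0 := by simp
    have := (Real.continuousAt_const_rpow (b := 0) hc).tendsto.comp h0
    simpa [Function.comp_def] using this
  have h2 := h1.mul_const ((∫ x, Real.exp ((l * σ) * nr ε x) ∂(gam R)) * ∫ x, Real.exp (l * nr ε x) ∂(gam Mi))
  rw [one_mul] at h2
  refine ge_of_tendsto h2 ?_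
  filter_upwards [eventually_ge_atTop l] with β hβ
  exact tail_fin W hW u hu hε hσ hl hβ c

lemma nr_zero_le {K : Type*} [Fintype K] (ε : ℝ) (x : K → ℝ) : nr 0 x ≤ nr ε x := by
  unfold nr
  apply Real.sqrt_le_sqrt
  nlinarith [sq_nonneg ε]

lemma nr_le_zero_add {K : Type*} [Fintype K] {ε : ℝ} (hε : 0 < ε) (x : K → ℝ) : nr ε x ≤ nr 0 x + ε := by
  refine (abs_le_of_sq_le_sq' ?_ (by have := nr_nonneg 0 x; linarith)).2
  have := nr_sq ε x
  have := nr_sq 0 x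
  nlinarith [mul_nonneg (nr_nonneg 0 x) hε.le]

lemma tail_finU [DecidableEq R] [Nonempty I] (W : Matrix R N ℝ) (hW : W * Wᵀ = 1) (u : I → Mi → ℝ)
    (hu : ∀ v, u v ⬝ᵥ u v = 1) {l : ℝ} (hl : 0 < l) (c : ℝ) :
    (gam (N × Mi)).real {g | ∃ v, c ≤ nr 0 (W *ᵥ (GM g *ᵥ u v))} ≤
      Real.exp (l * (√(Fintype.card R) + √(Fintype.card Mi) - c) + l ^ 2 / 2) := by
  have hlim : Tendsto (fun ε : ℝ => Real.exp (l * (√(Fintype.card R + ε ^ 2) + √(Fintype.card Mi + ε ^ 2) - c)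
      + l ^ 2 / 2)) (nhdsWithin 0 (Set.Ioi 0))
      (nhds (Real.exp (l * (√(Fintype.card R) + √(Fintype.card Mi) - c) + l ^ 2 / 2))) := by
    have hc : Continuous (fun ε : ℝ => Real.exp (l * (√(Fintype.card R + ε ^ 2) + √(Fintype.card Mi + ε ^ 2) - c)
      + l ^ 2 / 2)) := by fun_prop
    have := hc.tendsto 0
    simp only [ne_eq, OfNat.ofNat_ne_zero, not_false_eq_true, zero_pow, add_zero] at this
    exact this.mono_left nhdsWithin_le_nhds
  refine ge_of_tendsto hlim ?_
  filter_upwards [self_mem_nhdsWithin] with ε hε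
  have hε : 0 < ε := hε
  have h := tail_fin2 W hW u hu hε (σ := 1) (by simp) hl c
  simp only [mul_one, one_mul] at h
  have h1 := mgf_upper (K := R) hε l hl.le
  have h2 := mgf_upper (K := Mi) hε l hl.le
  have h3 := mul_le_mul h1 h2 (integral_nonneg fun x => (Real.exp_pos _).le) (Real.exp_pos _).le
  have h4 := h.trans h3
  rw [← Real.exp_add] at h4
  have h5 : (gam (N × Mi)).real {g | ∃ v, c ≤ nr 0 (W *ᵥ (GM g *ᵥ u v))} ≤
    (gam (N × Mi)).real {g | ∃ v, c ≤ nr ε (W *ᵥ (GM g *ᵥ u v))} := by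
    refine measureReal_mono ?_
    rintro g ⟨v, hv⟩
    exact ⟨v, hv.trans (nr_zero_le _ _)⟩
  refine h5.trans ?_
  rw [← le_div_iff₀ (Real.exp_pos _), ← Real.exp_sub] at h4
  refine h4.trans (Real.exp_le_exp.2 (le_of_eq ?_))
  ring

lemma tail_finL [DecidableEq R] [Nonempty I] (W : Matrix R N ℝ) (hW : W * Wᵀ = 1) (u : I → Mi → ℝ)
    (hu : ∀ v, u v ⬝ᵥ u v = 1) {l : ℝ} (hl : 0 < l) (hR : 1 ≤ Fintype.card R) (c : ℝ) :
    (gam (N × Mi)).real {g | ∃ v, nr 0 (W *ᵥ (GM g *ᵥ u v)) ≤ c} ≤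
      Real.exp (l * (c + √(Fintype.card Mi) - √((Fintype.card R : ℝ) - 1)) + l ^ 2 / 2) := by
  have hlim : Tendsto (fun ε : ℝ => Real.exp (l * (c + ε + √(Fintype.card Mi + ε ^ 2) - √((Fintype.card R : ℝ) - 1))
      + l ^ 2 / 2)) (nhdsWithin 0 (Set.Ioi 0))
      (nhds (Real.exp (l * (c + √(Fintype.card Mi) - √((Fintype.card R : ℝ) - 1)) + l ^ 2 / 2))) := by
    have hc : Continuous (fun ε : ℝ => Real.exp (l * (c + ε + √(Fintype.card Mi + ε ^ 2) - √((Fintype.card R : ℝ) - 1))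
      + l ^ 2 / 2)) := by fun_prop
    have := hc.tendsto 0
    simp only [ne_eq, OfNat.ofNat_ne_zero, not_false_eq_true, zero_pow, add_zero] at this
    exact this.mono_left nhdsWithin_le_nhds
  refine ge_of_tendsto hlim ?_
  filter_upwards [self_mem_nhdsWithin] with ε hε
  have hε : 0 < ε := hε
  have h := tail_fin2 W hW u hu hε (σ := -1) (by simp) hl (-(c + ε))
  simp only [mul_neg, mul_one, neg_mul, one_mul, neg_le_neg_iff] at h
  have h1 := mgf_lower (K := R) hε l hl.le hR
  have h2 := mgf_upper (K := Mi) hε l hl.le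
  simp only [neg_mul] at h1
  have h3 := mul_le_mul h1 h2 (integral_nonneg fun x => (Real.exp_pos _).le) (Real.exp_pos _).le
  have h4 := h.trans h3
  rw [← Real.exp_add] at h4
  have h5 : (gam (N × Mi)).real {g | ∃ v, nr 0 (W *ᵥ (GM g *ᵥ u v)) ≤ c} ≤
    (gam (N × Mi)).real {g | ∃ v, nr ε (W *ᵥ (GM g *ᵥ u v)) ≤ c + ε} := by
    refine measureReal_mono ?_
    rintro g ⟨v, hv⟩
    exact ⟨v, (nr_le_zero_add hε _).trans (by linarith)⟩
  refine h5.trans ?_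
  rw [← le_div_iff₀ (Real.exp_pos _), ← Real.exp_sub] at h4
  refine h4.trans (Real.exp_le_exp.2 (le_of_eq ?_))
  ring

end

section
variable {R N Mi : Type*} [Fintype R] [Fintype N] [Fintype Mi]

lemma sup_of_fin {E : Type*} [MeasurableSpace E] (μ : Measure E) [IsProbabilityMeasure μ]
    (Q : E → (Mi → ℝ) → ℝ) (hQ : ∀ g, Continuous (Q g)) (c b : ℝ)
    (h : ∀ (k : ℕ) (u : Fin (k + 1) → Mi → ℝ), (∀ v, u v ⬝ᵥ u v = 1) →
      μ.real {g | ∃ v, c < Q g (u v)} ≤ b) :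
    μ {g | ∃ u, u ⬝ᵥ u = 1 ∧ c < Q g u} ≤ ENNReal.ofReal b := by
  rcases isEmpty_or_nonempty {u : Mi → ℝ // u ⬝ᵥ u = 1} with he | hne
  · have : {g | ∃ u, u ⬝ᵥ u = 1 ∧ c < Q g u} = ∅ := by
      ext g
      simp only [Set.mem_setOf_eq, Set.mem_empty_iff_false, iff_false]
      rintro ⟨u, hu, _⟩
      exact he.false ⟨u, hu⟩
    rw [this]; simp
  · let D := TopologicalSpace.denseSeq {u : Mi → ℝ // u ⬝ᵥ u = 1}
    let S : ℕ → Set E := fun k => {g | ∃ v : Fin (k + 1), c < Q g (D v).1}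
    have hS : {g | ∃ u, u ⬝ᵥ u = 1 ∧ c < Q g u} ⊆ ⋃ k, S k := by
      rintro g ⟨u, hu, hg⟩
      have hopen : IsOpen {w : {u : Mi → ℝ // u ⬝ᵥ u = 1} | c < Q g w.1} :=
        isOpen_lt continuous_const ((hQ g).comp continuous_subtype_val)
      obtain ⟨w, hw, k, rfl⟩ := (TopologicalSpace.denseRange_denseSeq
        {u : Mi → ℝ // u ⬝ᵥ u = 1}).inter_open_nonempty _ hopen ⟨⟨u, hu⟩, hg⟩
      exact Set.mem_iUnion.2 ⟨k, ⟨⟨k, Nat.lt_succ_self k⟩, hw⟩⟩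
    have hmono : Monotone S := by
      rintro a b hab g ⟨v, hv⟩
      exact ⟨⟨v.1, by have := v.2; omega⟩, hv⟩
    refine (measure_mono hS).trans ?_
    rw [hmono.measure_iUnion]
    refine iSup_le fun k => ?_
    have := h k (fun v => (D v).1) (fun v => (D v).2)
    rw [← ENNReal.ofReal_toReal (measure_ne_top μ (S k))]
    exact ENNReal.ofReal_le_ofReal this

lemma continuous_nrW (W : Matrix R N ℝ) (g : N × Mi → ℝ) :
    Continuous fun u : Mi → ℝ => nr 0 (W *ᵥ (GM g *ᵥ u)) := by
  refine (continuous_nr 0).comp ?_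
  fun_prop

lemma tailU [DecidableEq R] (W : Matrix R N ℝ) (hW : W * Wᵀ = 1) {l : ℝ} (hl : 0 < l) (c : ℝ) :
    (gam (N × Mi)) {g | ∃ u, u ⬝ᵥ u = 1 ∧ c ≤ nr 0 (W *ᵥ (GM g *ᵥ u))} ≤
      ENNReal.ofReal (Real.exp (l * (√(Fintype.card R) + √(Fintype.card Mi) - c) + l ^ 2 / 2)) := by
  have hc : Continuous fun c' : ℝ => ENNReal.ofReal
    (Real.exp (l * (√(Fintype.card R) + √(Fintype.card Mi) - c') + l ^ 2 / 2)) :=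
    ENNReal.continuous_ofReal.comp (by fun_prop)
  refine ge_of_tendsto ((hc.tendsto c).mono_left (nhdsWithin_le_nhds (s := Set.Iio c))) ?_
  filter_upwards [self_mem_nhdsWithin] with c' hc'
  refine le_trans (measure_mono ?_) (sup_of_fin (gam (N × Mi)) (fun g u => nr 0 (W *ᵥ (GM g *ᵥ u)))
    (fun g => continuous_nrW W g) c' _ ?_)
  · rintro g ⟨u, hu, hg⟩
    exact ⟨u, hu, lt_of_lt_of_le hc' hg⟩
  · intro k u hu
    refine le_trans (measureReal_mono ?_) (tail_finU W hW u hu hl c')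
    rintro g ⟨v, hv⟩
    exact ⟨v, hv.le⟩

lemma tailL [DecidableEq R] (W : Matrix R N ℝ) (hW : W * Wᵀ = 1) {l : ℝ} (hl : 0 < l)
    (hR : 1 ≤ Fintype.card R) (c : ℝ) :
    (gam (N × Mi)) {g | ∃ u, u ⬝ᵥ u = 1 ∧ nr 0 (W *ᵥ (GM g *ᵥ u)) ≤ c} ≤
      ENNReal.ofReal (Real.exp (l * (c + √(Fintype.card Mi) - √((Fintype.card R : ℝ) - 1)) + l ^ 2 / 2)) := by
  have hc : Continuous fun c' : ℝ => ENNReal.ofReal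
    (Real.exp (l * (c' + √(Fintype.card Mi) - √((Fintype.card R : ℝ) - 1)) + l ^ 2 / 2)) :=
    ENNReal.continuous_ofReal.comp (by fun_prop)
  refine ge_of_tendsto ((hc.tendsto c).mono_left (nhdsWithin_le_nhds (s := Set.Ioi c))) ?_
  filter_upwards [self_mem_nhdsWithin] with c' hc'
  have hc' : c < c' := hc'
  refine le_trans (measure_mono ?_) (sup_of_fin (gam (N × Mi)) (fun g u => -nr 0 (W *ᵥ (GM g *ᵥ u)))
    (fun g => (continuous_nrW W g).neg) (-c') _ ?_)
  · rintro g ⟨u, hu, hg⟩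
    exact ⟨u, hu, neg_lt_neg (lt_of_le_of_lt hg hc')⟩
  · intro k u hu
    refine le_trans (measureReal_mono ?_) (tail_finL W hW u hu hl hR c')
    rintro g ⟨v, hv⟩
    exact ⟨v, (neg_lt_neg_iff.1 hv).le⟩

lemma tailU' [DecidableEq R] (W : Matrix R N ℝ) (hW : W * Wᵀ = 1) {t r : ℝ} (ht : 0 < t)
    (hR : 1 ≤ Fintype.card R)
    (hr : √((Fintype.card Mi : ℝ) / Fintype.card R) + t ≤ r) :
    (gam (N × Mi)) {g | ∃ u, u ⬝ᵥ u = 1 ∧ √(Fintype.card R) * (1 + r) ≤ nr 0 (W *ᵥ (GM g *ᵥ u))} ≤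
      ENNReal.ofReal (Real.exp (-(Fintype.card R : ℝ) * t ^ 2 / 2)) := by
  have hn : (0 : ℝ) < Fintype.card R := by exact_mod_cast hR
  have hs : 0 < √(Fintype.card R : ℝ) := Real.sqrt_pos.2 hn
  refine (tailU W hW (l := √(Fintype.card R) * t) (by positivity) _).trans ?_
  refine ENNReal.ofReal_le_ofReal (Real.exp_le_exp.2 ?_)
  have h1 : √(Fintype.card R : ℝ) * √((Fintype.card Mi : ℝ) / Fintype.card R) = √(Fintype.card Mi) := by
    rw [← Real.sqrt_mul hn.le]; congr 1; field_simp
  have h2 : √(Fintype.card R : ℝ) ^ 2 = Fintype.card R := Real.sq_sqrt hn.le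
  set S := √(Fintype.card R : ℝ)
  rw [← h1]
  have h3 : S * √((Fintype.card Mi : ℝ) / Fintype.card R) + S * t ≤ S * r := by
    rw [← mul_add]; exact mul_le_mul_of_nonneg_left hr hs.le
  have h4 : 0 < S * t := by positivity
  have : S * t * (S + S * √((Fintype.card Mi : ℝ) / Fintype.card R) - S * (1 + r)) ≤ S * t * (-(S * t)) := by
    apply mul_le_mul_of_nonneg_left _ h4.le
    linarith
  rw [← h2]
  rw [← h2] at this
  nlinarith

lemma tailL' [DecidableEq R] (W : Matrix R N ℝ) (hW : W * Wᵀ = 1) {t r : ℝ} (ht : 0 < t)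
    (hR : 1 ≤ Fintype.card R) (hM : 1 ≤ Fintype.card Mi)
    (hr : √((Fintype.card Mi : ℝ) / Fintype.card R) + t ≤ r) (hr3 : r ≤ 1 / 3) :
    (gam (N × Mi)) {g | ∃ u, u ⬝ᵥ u = 1 ∧ nr 0 (W *ᵥ (GM g *ᵥ u)) ^ 2 ≤ Fintype.card R * (1 - 3 * r)} ≤
      ENNReal.ofReal (Real.exp (-(Fintype.card R : ℝ) * t ^ 2 / 2)) := by
  have hn : (0 : ℝ) < Fintype.card R := by exact_mod_cast hR
  have hm : (1 : ℝ) ≤ Fintype.card Mi := by exact_mod_cast hM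
  have hs : 0 < √(Fintype.card R : ℝ) := Real.sqrt_pos.2 hn
  refine (measure_mono ?_).trans ((tailL (Mi := Mi) W hW (l := √(Fintype.card R) * t) (by positivity) hR
    (√(Fintype.card R) * √(1 - 3 * r))).trans ?_)
  · rintro g ⟨u, hu, hg⟩
    refine ⟨u, hu, ?_⟩
    rw [← Real.sqrt_mul hn.le]
    exact Real.le_sqrt_of_sq_le hg
  refine ENNReal.ofReal_le_ofReal (Real.exp_le_exp.2 ?_)
  have h1 : √(Fintype.card R : ℝ) * √((Fintype.card Mi : ℝ) / Fintype.card R) = √(Fintype.card Mi) := by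
    rw [← Real.sqrt_mul hn.le]; congr 1; field_simp
  have h2 : √(Fintype.card R : ℝ) ^ 2 = Fintype.card R := Real.sq_sqrt hn.le
  have hr0 : 0 < r := lt_of_lt_of_le (by positivity) hr
  have hnr : 1 ≤ (Fintype.card R : ℝ) * r ^ 2 := by
    have a : √((Fintype.card Mi : ℝ) / Fintype.card R) ≤ r := by linarith
    have b : (Fintype.card Mi : ℝ) / Fintype.card R ≤ r ^ 2 := by
      rw [← Real.sqrt_le_left hr0.le]; exact a
    rw [div_le_iff₀ hn] at b
    linarith
  have h5 : √(1 - 3 * r) ≤ 1 - 3 / 2 * r := by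
    apply Real.sqrt_le_iff.2
    constructor
    · linarith
    · nlinarith [sq_nonneg r]
  have h6 : √(Fintype.card R : ℝ) * (1 - r / 2) ≤ √((Fintype.card R : ℝ) - 1) := by
    apply Real.le_sqrt_of_sq_le
    rw [mul_pow, h2]
    have : (Fintype.card R : ℝ) * r ^ 2 ≤ (Fintype.card R : ℝ) * (r * (1 / 3)) := by
      apply mul_le_mul_of_nonneg_left _ hn.le
      nlinarith
    nlinarith
  set S := √(Fintype.card R : ℝ)
  rw [← h1]
  have h3 : S * √((Fintype.card Mi : ℝ) / Fintype.card R) + S * t ≤ S * r := by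
    rw [← mul_add]; exact mul_le_mul_of_nonneg_left hr hs.le
  have h4 : 0 < S * t := by positivity
  have h7 := mul_le_mul_of_nonneg_left h5 hs.le
  have : S * t * (S * √(1 - 3 * r) + S * √((Fintype.card Mi : ℝ) / Fintype.card R) - √((Fintype.card R : ℝ) - 1)) ≤
      S * t * (-(S * t)) := by
    apply mul_le_mul_of_nonneg_left _ h4.le
    linarith
  rw [← h2]
  rw [← h2] at this
  nlinarith

end

section
variable {R N Mi : Type*} [Fintype R] [Fintype N] [Fintype Mi]

/-- signed quadratic form -/
def qf (τ c : ℝ) (W : Matrix R N ℝ) (x : N → ℝ) : ℝ := τ * ((W *ᵥ x) ⬝ᵥ (W *ᵥ x) - c * (x ⬝ᵥ x))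

lemma qf_smul (τ c : ℝ) (W : Matrix R N ℝ) (s : ℝ) (x : N → ℝ) : qf τ c W (s • x) = s ^ 2 * qf τ c W x := by
  simp only [qf, mulVec_smul, smul_dotProduct, dotProduct_smul, smul_eq_mul]
  ring

/-- coordinate embedding -/
def EM [DecidableEq N] (e : Mi → N) : Matrix N Mi ℝ := fun a b => if a = e b then 1 else 0

instance compact_sphere : CompactSpace {u : Mi → ℝ // u ⬝ᵥ u = 1} := by
  refine (isCompact_iff_compactSpace (s := {u : Mi → ℝ | u ⬝ᵥ u = 1})).1 ?_
  refine Metric.isCompact_of_isClosed_isBounded (isClosed_eq (by fun_prop) continuous_const) ?_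
  refine (Metric.isBounded_iff_subset_closedBall 0).2 ⟨1, fun u hu => ?_⟩
  rw [mem_closedBall_zero_iff, pi_norm_le_iff_of_nonneg zero_le_one]
  intro i
  rw [Real.norm_eq_abs]
  apply abs_le_of_sq_le_sq _ zero_le_one
  have hu : ∑ i, u i * u i = 1 := hu
  have := Finset.single_le_sum (f := fun a => u a * u a) (fun a _ => mul_self_nonneg _) (Finset.mem_univ i)
  nlinarith

lemma isClosed_exists_sphere {Y : Type*} [TopologicalSpace Y] (f : Y → (Mi → ℝ) → ℝ)
    (hf : Continuous (fun p : Y × (Mi → ℝ) => f p.1 p.2)) :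
    IsClosed {y | ∃ u, u ⬝ᵥ u = 1 ∧ 0 ≤ f y u} := by
  have h : IsClosed {p : Y × {u : Mi → ℝ // u ⬝ᵥ u = 1} | 0 ≤ f p.1 p.2.1} :=
    isClosed_le continuous_const (hf.comp (continuous_fst.prodMk (continuous_subtype_val.comp continuous_snd)))
  have := isClosedMap_fst_of_compactSpace _ h
  convert! this using 1
  ext y
  constructor
  · rintro ⟨u, hu, h⟩
    exact ⟨(y, ⟨u, hu⟩), h, rfl⟩
  · rintro ⟨⟨y, u⟩, h, rfl⟩
    exact ⟨u.1, u.2, h⟩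

lemma exists_rotation [DecidableEq N] (e : Mi → N) (he : Function.Injective e) (G : Matrix N Mi ℝ)
    (hG : Function.Injective (fun u => G *ᵥ u)) :
    ∃ O : Matrix N N ℝ, O * Oᵀ = 1 ∧ ∀ u, ∃ u', O *ᵥ (EM e *ᵥ u) = G *ᵥ u' := by
  classical
  let Gl : (Mi → ℝ) →ₗ[ℝ] EuclideanSpace ℝ N :=
    (WithLp.linearEquiv 2 ℝ (N → ℝ)).symm.toLinearMap ∘ₗ Matrix.mulVecLin G
  have hinj : Function.Injective Gl := (WithLp.linearEquiv 2 ℝ (N → ℝ)).symm.injective.comp hG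
  let K := LinearMap.range Gl
  have hK : Module.finrank ℝ K = Fintype.card Mi := by
    rw [LinearMap.finrank_range_of_inj hinj]; simp
  let b := (stdOrthonormalBasis ℝ K).reindex ((finCongr hK).trans (Fintype.equivFin Mi).symm)
  let v : N → EuclideanSpace ℝ N := Function.extend e (fun i => (b i : EuclideanSpace ℝ N)) 0
  have hv : ∀ i, v (e i) = b i := fun i => he.extend_apply _ _ i
  have ho : Orthonormal ℝ ((Set.range e).domRestrict v) := by
    have hb : Orthonormal ℝ (fun i => (b i : EuclideanSpace ℝ N)) := by
      have := b.orthonormal.comp_linearIsometry K.subtypeₗᵢ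
      exact this
    rw [orthonormal_iff_ite] at hb ⊢
    rintro ⟨_, i, rfl⟩ ⟨_, j, rfl⟩
    have h1 := hb i j
    change inner ℝ (v (e i)) (v (e j)) = _
    rw [hv, hv, h1]
    by_cases hij : i = j
    · subst hij; rw [if_pos rfl, if_pos rfl]
    · rw [if_neg hij, if_neg]
      intro h
      exact hij (he (congrArg Subtype.val h))
  obtain ⟨B, hB⟩ := ho.exists_orthonormalBasis_extension_of_card_eq (by simp)
  let O : Matrix N N ℝ := fun a i => B i a
  have hO : Oᵀ * O = 1 := by
    ext i j
    have := orthonormal_iff_ite.1 B.orthonormal i j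
    rw [Matrix.one_apply, ← this, Matrix.mul_apply]
    simp only [PiLp.inner_apply]
    exact Finset.sum_congr rfl fun x _ => by
      change B i x * B j x = inner ℝ (B i x) (B j x)
      simp [mul_comm]
  refine ⟨O, mul_eq_one_comm.1 hO, fun u => ?_⟩
  have hmem : (∑ i, u i • (b i : EuclideanSpace ℝ N)) ∈ K :=
    Submodule.sum_mem _ fun i _ => Submodule.smul_mem _ _ (b i).2
  obtain ⟨u', hu'⟩ := hmem
  refine ⟨u', ?_⟩
  ext a
  have h2 := congrArg (fun x : EuclideanSpace ℝ N => x a) hu'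
  have h3 : Gl u' a = (G *ᵥ u') a := rfl
  simp only [h3] at h2
  rw [h2]
  have hE : O * EM e = fun a i => (b i : EuclideanSpace ℝ N) a := by
    ext a i
    rw [Matrix.mul_apply]
    simp [EM, O, hB (e i) ⟨i, rfl⟩, hv]
  rw [mulVec_mulVec, hE]
  simp [mulVec, dotProduct, mul_comm]

lemma dot_orth [DecidableEq N] (O : Matrix N N ℝ) (hO : O * Oᵀ = 1) (x : N → ℝ) :
    (O *ᵥ x) ⬝ᵥ (O *ᵥ x) = x ⬝ᵥ x := by
  have hO' : Oᵀ * O = 1 := mul_eq_one_comm.1 hO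
  rw [dotProduct_mulVec, vecMul_mulVec, hO']
  simp

lemma EM_mulVec [DecidableEq N] (e : Mi → N) (he : Function.Injective e) (u : Mi → ℝ) :
    (EM e *ᵥ u) ⬝ᵥ (EM e *ᵥ u) = u ⬝ᵥ u := by
  classical
  have : (EM e)ᵀ * EM e = 1 := by
    ext i j
    simp [Matrix.mul_apply, EM, Matrix.one_apply, he.eq_iff, eq_comm]
  rw [dotProduct_mulVec, vecMul_mulVec, this]
  simp

lemma inv_step [DecidableEq N] (Q : Measure (R → N → ℝ)) [IsProbabilityMeasure Q]
    (hinv : ∀ O : Matrix N N ℝ, O * Oᵀ = 1 →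
      Measure.map (fun (W : R → N → ℝ) (i : R) (j : N) => (Matrix.of W * O) i j) Q = Q)
    (e : Mi → N) (he : Function.Injective e) (τ c : ℝ) (G : Matrix N Mi ℝ) :
    Q {W | ∃ u, u ⬝ᵥ u = 1 ∧ 0 ≤ qf τ c (Matrix.of W) (EM e *ᵥ u)} ≤
      Q {W | ∃ u, u ⬝ᵥ u = 1 ∧ 0 ≤ qf τ c (Matrix.of W) (G *ᵥ u)} := by
  by_cases hG : Function.Injective (fun u => G *ᵥ u)
  · obtain ⟨O, hO, hr⟩ := exists_rotation e he G hG
    have hcl : IsClosed {W : R → N → ℝ | ∃ u, u ⬝ᵥ u = 1 ∧ 0 ≤ qf τ c (Matrix.of W) (EM e *ᵥ u)} := by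
      refine isClosed_exists_sphere (fun (W : R → N → ℝ) u => qf τ c (Matrix.of W) (EM e *ᵥ u)) ?_
      simp only [qf, mulVec, dotProduct, Matrix.of_apply]
      fun_prop
    have hm : Measurable (fun (W : R → N → ℝ) (i : R) (j : N) => (Matrix.of W * O) i j) := by
      apply Continuous.measurable
      simp only [Matrix.mul_apply, Matrix.of_apply]
      fun_prop
    calc Q {W | ∃ u, u ⬝ᵥ u = 1 ∧ 0 ≤ qf τ c (Matrix.of W) (EM e *ᵥ u)}
        = Measure.map (fun (W : R → N → ℝ) (i : R) (j : N) => (Matrix.of W * O) i j) Q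
          {W | ∃ u, u ⬝ᵥ u = 1 ∧ 0 ≤ qf τ c (Matrix.of W) (EM e *ᵥ u)} := by rw [hinv O hO]
      _ = Q ((fun (W : R → N → ℝ) (i : R) (j : N) => (Matrix.of W * O) i j) ⁻¹'
          {W | ∃ u, u ⬝ᵥ u = 1 ∧ 0 ≤ qf τ c (Matrix.of W) (EM e *ᵥ u)}) :=
          Measure.map_apply hm hcl.measurableSet
      _ ≤ _ := by
        refine measure_mono ?_
        rintro W ⟨u, hu, hq⟩
        obtain ⟨u', hu'⟩ := hr u
        have hq2 : qf τ c (Matrix.of W) (G *ᵥ u') = qf τ c (Matrix.of W * O) (EM e *ᵥ u) := by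
          unfold qf
          rw [← hu', dot_orth O hO]
          simp only [mulVec_mulVec, Matrix.mul_assoc]
        have hq : 0 ≤ qf τ c (Matrix.of W * O) (EM e *ᵥ u) := hq
        rw [← hq2] at hq
        have hne : u' ≠ 0 := by
          rintro rfl
          have h1 := dot_orth O hO (EM e *ᵥ u)
          rw [hu', EM_mulVec e he, hu] at h1
          simp at h1
        have hpos : 0 < u' ⬝ᵥ u' := by
          have h0 : 0 ≤ u' ⬝ᵥ u' := Finset.sum_nonneg fun i _ => mul_self_nonneg _
          refine lt_of_le_of_ne h0 fun h => hne (dotProduct_self_eq_zero.1 h.symm)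
        refine ⟨(√(u' ⬝ᵥ u'))⁻¹ • u', ?_, ?_⟩
        · rw [smul_dotProduct, dotProduct_smul, smul_eq_mul, smul_eq_mul, ← mul_assoc, ← mul_inv,
            Real.mul_self_sqrt hpos.le, inv_mul_cancel₀ hpos.ne']
        · rw [mulVec_smul, qf_smul]
          positivity
  · -- degenerate case
    have : ∃ u, u ≠ 0 ∧ G *ᵥ u = 0 := by
      unfold Function.Injective at hG
      push Not at hG
      obtain ⟨a, b, hab, hne⟩ := hG
      exact ⟨a - b, sub_ne_zero.2 hne, by rw [mulVec_sub]; exact sub_eq_zero.2 hab⟩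
    obtain ⟨u', hne, hu'⟩ := this
    have hpos : 0 < u' ⬝ᵥ u' := by
      have h0 : 0 ≤ u' ⬝ᵥ u' := Finset.sum_nonneg fun i _ => mul_self_nonneg _
      refine lt_of_le_of_ne h0 fun h => hne (dotProduct_self_eq_zero.1 h.symm)
    refine measure_mono fun W _ => ?_
    refine ⟨(√(u' ⬝ᵥ u'))⁻¹ • u', ?_, ?_⟩
    · rw [smul_dotProduct, dotProduct_smul, smul_eq_mul, smul_eq_mul, ← mul_assoc, ← mul_inv,
        Real.mul_self_sqrt hpos.le, inv_mul_cancel₀ hpos.ne']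
    · rw [mulVec_smul, hu', qf_smul]
      simp [qf]

lemma fubini_step [DecidableEq N] [DecidableEq R] (Q : Measure (R → N → ℝ)) [IsProbabilityMeasure Q]
    (hinv : ∀ O : Matrix N N ℝ, O * Oᵀ = 1 →
      Measure.map (fun (W : R → N → ℝ) (i : R) (j : N) => (Matrix.of W * O) i j) Q = Q)
    (hW : ∀ᵐ W ∂Q, (Matrix.of W : Matrix R N ℝ) * (Matrix.of W)ᵀ = 1)
    (e : Mi → N) (he : Function.Injective e) (τ c : ℝ) (b : ℝ≥0∞)
    (hb : ∀ W : Matrix R N ℝ, W * Wᵀ = 1 →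
      gam (N × Mi) {g | ∃ u, u ⬝ᵥ u = 1 ∧ 0 ≤ qf τ c W (GM g *ᵥ u)} ≤ b) :
    Q {W | ∃ u, u ⬝ᵥ u = 1 ∧ 0 ≤ qf τ c (Matrix.of W) (EM e *ᵥ u)} ≤ b := by
  let D : Set ((R → N → ℝ) × (N × Mi → ℝ)) :=
    {y | ∃ u, u ⬝ᵥ u = 1 ∧ 0 ≤ qf τ c (Matrix.of y.1) (GM y.2 *ᵥ u)}
  have hcl : IsClosed D := by
    refine isClosed_exists_sphere
      (fun (y : (R → N → ℝ) × (N × Mi → ℝ)) u => qf τ c (Matrix.of y.1) (GM y.2 *ᵥ u)) ?_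
    simp only [qf, mulVec, dotProduct, Matrix.of_apply, GM]
    fun_prop
  have hD : MeasurableSet D := hcl.measurableSet
  calc Q {W | ∃ u, u ⬝ᵥ u = 1 ∧ 0 ≤ qf τ c (Matrix.of W) (EM e *ᵥ u)}
      = ∫⁻ _g, Q {W | ∃ u, u ⬝ᵥ u = 1 ∧ 0 ≤ qf τ c (Matrix.of W) (EM e *ᵥ u)} ∂(gam (N × Mi)) := by simp
    _ ≤ ∫⁻ g, Q ((fun W => (W, g)) ⁻¹' D) ∂(gam (N × Mi)) :=
        lintegral_mono fun g => inv_step Q hinv e he τ c (GM g)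
    _ = (Q.prod (gam (N × Mi))) D := (Measure.prod_apply_symm hD).symm
    _ = ∫⁻ W, gam (N × Mi) (Prod.mk W ⁻¹' D) ∂Q := Measure.prod_apply hD
    _ ≤ ∫⁻ _W, b ∂Q := by
        refine lintegral_mono_ae ?_
        filter_upwards [hW] with W h
        exact hb _ h
    _ = b := by simp
end

section
variable {R N Mi : Type*} [Fintype R] [Fintype N] [Fintype Mi] [DecidableEq R] [DecidableEq N]

lemma nr_zero_dot {K : Type*} [Fintype K] (x : K → ℝ) : nr 0 x ^ 2 = x ⬝ᵥ x := by
  rw [nr_sq]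
  simp [dotProduct, sq]

lemma gam_part1 (W : Matrix R N ℝ) (hW : W * Wᵀ = 1) {t t' a r Δ : ℝ} (ht : 0 < t) (ht' : 0 < t')
    (hR : 1 ≤ Fintype.card R) (hN : 1 ≤ Fintype.card N) (hM : 1 ≤ Fintype.card Mi)
    (ha : √((Fintype.card Mi : ℝ) / Fintype.card R) + t ≤ a) (ha1 : a ≤ 1)
    (hr : √((Fintype.card Mi : ℝ) / Fintype.card N) + t' ≤ r) (hr3 : r ≤ 1 / 3)
    (hΔ0 : 0 ≤ Δ) (hΔ : 1 + 3 * a ≤ (1 + Δ) * (1 - 3 * r)) :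
    gam (N × Mi) {g | ∃ u, u ⬝ᵥ u = 1 ∧
      0 ≤ qf 1 ((Fintype.card R : ℝ) / Fintype.card N * (1 + Δ)) W (GM g *ᵥ u)} ≤
      ENNReal.ofReal (Real.exp (-(Fintype.card R : ℝ) * t ^ 2 / 2)) +
      ENNReal.ofReal (Real.exp (-(Fintype.card N : ℝ) * t' ^ 2 / 2)) := by
  have h1 := tailU' (Mi := Mi) W hW ht hR ha
  have h2 := tailL' (Mi := Mi) (1 : Matrix N N ℝ) (by simp) ht' hN hM hr hr3
  refine le_trans (le_trans (measure_mono ?_) (measure_union_le _ _)) (add_le_add h1 h2)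
  rintro g ⟨u, hu, hq⟩
  by_contra hcon
  simp only [Set.mem_union, Set.mem_setOf_eq, not_or, not_exists, not_and, not_le] at hcon
  have g1 := hcon.1 u hu
  have g2 := hcon.2 u hu
  rw [one_mulVec, nr_zero_dot] at g2
  have ha0 : 0 ≤ a := le_trans (by positivity) ha
  have hk : (1 : ℝ) ≤ Fintype.card R := by exact_mod_cast hR
  have hD : (1 : ℝ) ≤ Fintype.card N := by exact_mod_cast hN
  have g3 : (W *ᵥ (GM g *ᵥ u)) ⬝ᵥ (W *ᵥ (GM g *ᵥ u)) < Fintype.card R * (1 + a) ^ 2 := by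
    rw [← nr_zero_dot]
    calc _ < (√(Fintype.card R : ℝ) * (1 + a)) ^ 2 := by
          apply pow_lt_pow_left₀ g1 (nr_nonneg _ _) two_ne_zero
      _ = _ := by rw [mul_pow, Real.sq_sqrt (by positivity)]
  unfold qf at hq
  set X := (W *ᵥ (GM g *ᵥ u)) ⬝ᵥ (W *ᵥ (GM g *ᵥ u))
  set Y := (GM g *ᵥ u) ⬝ᵥ (GM g *ᵥ u)
  set k : ℝ := (Fintype.card R : ℝ)
  set D : ℝ := (Fintype.card N : ℝ)
  have g4 : k / D * (1 + Δ) * (D * (1 - 3 * r)) ≤ k / D * (1 + Δ) * Y := by gcongr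
  have g5 : k / D * (1 + Δ) * (D * (1 - 3 * r)) = k * ((1 + Δ) * (1 - 3 * r)) := by field_simp
  have g6 : k * (1 + 3 * a) ≤ k * ((1 + Δ) * (1 - 3 * r)) := by gcongr
  have g7 : k * (1 + a) ^ 2 ≤ k * (1 + 3 * a) := by gcongr; nlinarith
  linarith

lemma gam_part2 (W : Matrix R N ℝ) (hW : W * Wᵀ = 1) {t t' a r Δ : ℝ} (ht : 0 < t) (ht' : 0 < t')
    (hR : 1 ≤ Fintype.card R) (hN : 1 ≤ Fintype.card N) (hM : 1 ≤ Fintype.card Mi)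
    (ha : √((Fintype.card Mi : ℝ) / Fintype.card R) + t ≤ a) (ha1 : a ≤ 1 / 3)
    (hr : √((Fintype.card Mi : ℝ) / Fintype.card N) + t' ≤ r)
    (hΔ0 : Δ ≤ 1) (hΔ : (1 - Δ) * (1 + r) ^ 2 ≤ 1 - 3 * a) :
    gam (N × Mi) {g | ∃ u, u ⬝ᵥ u = 1 ∧
      0 ≤ qf (-1) ((Fintype.card R : ℝ) / Fintype.card N * (1 - Δ)) W (GM g *ᵥ u)} ≤
      ENNReal.ofReal (Real.exp (-(Fintype.card R : ℝ) * t ^ 2 / 2)) +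
      ENNReal.ofReal (Real.exp (-(Fintype.card N : ℝ) * t' ^ 2 / 2)) := by
  have h1 := tailL' (Mi := Mi) W hW ht hR hM ha ha1
  have h2 := tailU' (Mi := Mi) (1 : Matrix N N ℝ) (by simp) ht' hN hr
  refine le_trans (le_trans (measure_mono ?_) (measure_union_le _ _)) (add_le_add h1 h2)
  rintro g ⟨u, hu, hq⟩
  by_contra hcon
  simp only [Set.mem_union, Set.mem_setOf_eq, not_or, not_exists, not_and, not_le] at hcon
  have g1 := hcon.1 u hu
  have g2 := hcon.2 u hu
  rw [one_mulVec] at g2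
  rw [nr_zero_dot] at g1
  have hr0 : 0 ≤ r := le_trans (by positivity) hr
  have hk : (1 : ℝ) ≤ Fintype.card R := by exact_mod_cast hR
  have hD : (1 : ℝ) ≤ Fintype.card N := by exact_mod_cast hN
  have g3 : (GM g *ᵥ u) ⬝ᵥ (GM g *ᵥ u) < Fintype.card N * (1 + r) ^ 2 := by
    rw [← nr_zero_dot]
    calc _ < (√(Fintype.card N : ℝ) * (1 + r)) ^ 2 := by
          apply pow_lt_pow_left₀ g2 (nr_nonneg _ _) two_ne_zero
      _ = _ := by rw [mul_pow, Real.sq_sqrt (by positivity)]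
  unfold qf at hq
  set X := (W *ᵥ (GM g *ᵥ u)) ⬝ᵥ (W *ᵥ (GM g *ᵥ u))
  set Y := (GM g *ᵥ u) ⬝ᵥ (GM g *ᵥ u)
  set k : ℝ := (Fintype.card R : ℝ)
  set D : ℝ := (Fintype.card N : ℝ)
  have h0 : 0 ≤ 1 - Δ := by linarith
  have g4 : k / D * (1 - Δ) * Y ≤ k / D * (1 - Δ) * (D * (1 + r) ^ 2) := by gcongr
  have g5 : k / D * (1 - Δ) * (D * (1 + r) ^ 2) = k * ((1 - Δ) * (1 + r) ^ 2) := by field_simp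
  have g6 : k * ((1 - Δ) * (1 + r) ^ 2) ≤ k * (1 - 3 * a) := by gcongr
  linarith
end

section
lemma normalize_dot {K : Type*} [Fintype K] (u : K → ℝ) (hu : u ≠ 0) :
    0 < u ⬝ᵥ u ∧ ((√(u ⬝ᵥ u))⁻¹ • u) ⬝ᵥ ((√(u ⬝ᵥ u))⁻¹ • u) = 1 := by
  have hpos : 0 < u ⬝ᵥ u := by
    have h0 : 0 ≤ u ⬝ᵥ u := Finset.sum_nonneg fun i _ => mul_self_nonneg _
    refine lt_of_le_of_ne h0 fun h => hu (dotProduct_self_eq_zero.1 h.symm)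
  refine ⟨hpos, ?_⟩
  rw [smul_dotProduct, dotProduct_smul, smul_eq_mul, smul_eq_mul, ← mul_assoc, ← mul_inv,
    Real.mul_self_sqrt hpos.le, inv_mul_cancel₀ hpos.ne']

lemma eucl_norm_sq {K : Type*} [Fintype K] (u : EuclideanSpace ℝ K) :
    ‖u‖ ^ 2 = u.ofLp ⬝ᵥ u.ofLp := by
  rw [EuclideanSpace.norm_sq_eq]
  simp [dotProduct, sq]

lemma specNorm_le_of {m n : Type*} [Fintype m] [Fintype n] [DecidableEq n] (A : Matrix m n ℝ)
    (C : ℝ) (hC : 0 ≤ C) (h : ∀ u, u ⬝ᵥ u = 1 → (A *ᵥ u) ⬝ᵥ (A *ᵥ u) ≤ C ^ 2) : specNorm A ≤ C := by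
  refine ContinuousLinearMap.opNorm_le_bound _ hC fun v => ?_
  apply le_of_sq_le_sq _ (by positivity)
  rw [mul_pow, eucl_norm_sq, eucl_norm_sq]
  have e1 : (LinearMap.toContinuousLinearMap (Matrix.toEuclideanLin A) v).ofLp = A *ᵥ v.ofLp := rfl
  rw [e1]
  by_cases hv : v.ofLp = 0
  · rw [hv]; simp
  obtain ⟨hp, h1⟩ := normalize_dot _ hv
  have h2 := h _ h1
  rw [mulVec_smul, smul_dotProduct, dotProduct_smul, smul_eq_mul, smul_eq_mul, ← mul_assoc, ← mul_inv,
    Real.mul_self_sqrt hp.le, inv_mul_le_iff₀ hp] at h2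
  linarith

lemma specNorm_exists {m n : Type*} [Fintype m] [Fintype n] [DecidableEq n] (A : Matrix m n ℝ)
    (x : ℝ) (hx : 0 < x) (h : x ≤ specNorm A) :
    ∃ u, u ⬝ᵥ u = 1 ∧ x ^ 2 ≤ (A *ᵥ u) ⬝ᵥ (A *ᵥ u) := by
  by_contra hcon
  push Not at hcon
  have hc : Continuous (fun u : {u : n → ℝ // u ⬝ᵥ u = 1} => (A *ᵥ u.1) ⬝ᵥ (A *ᵥ u.1)) := by
    have hc0 : Continuous (fun u : n → ℝ => (A *ᵥ u) ⬝ᵥ (A *ᵥ u)) := by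
      simp only [mulVec, dotProduct]
      fun_prop
    exact hc0.comp continuous_subtype_val
  rcases isEmpty_or_nonempty {u : n → ℝ // u ⬝ᵥ u = 1} with he | he
  · have := specNorm_le_of A 0 le_rfl fun u hu => (he.false ⟨u, hu⟩).elim
    linarith
  · obtain ⟨u0, -, hu0⟩ := isCompact_univ.exists_isMaxOn Set.univ_nonempty hc.continuousOn
    have h0 : 0 ≤ (A *ᵥ u0.1) ⬝ᵥ (A *ᵥ u0.1) := Finset.sum_nonneg fun i _ => mul_self_nonneg _
    have h1 := specNorm_le_of A (√((A *ᵥ u0.1) ⬝ᵥ (A *ᵥ u0.1))) (Real.sqrt_nonneg _) fun u hu => by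
      rw [Real.sq_sqrt h0]
      exact hu0 (Set.mem_univ (⟨u, hu⟩ : {u : n → ℝ // u ⬝ᵥ u = 1}))
    have h2 := hcon _ u0.2
    have h3 : √((A *ᵥ u0.1) ⬝ᵥ (A *ᵥ u0.1)) < x := (Real.sqrt_lt' hx).2 h2
    linarith

lemma inv_exists {m n : Type*} [Fintype m] [Fintype n] [DecidableEq n] (B : Matrix m n ℝ)
    (κ δ : ℝ) (hκ : 0 < κ) (hδ : 0 < δ)
    (h : ¬ IsUnit (κ • (Bᵀ * B)) ∨ δ⁻¹ ≤ specNorm (κ • (Bᵀ * B))⁻¹) :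
    ∃ u, u ≠ 0 ∧ κ * ((B *ᵥ u) ⬝ᵥ (B *ᵥ u)) ≤ δ * (u ⬝ᵥ u) := by
  have key : ∀ u : n → ℝ, u ⬝ᵥ ((κ • (Bᵀ * B)) *ᵥ u) = κ * ((B *ᵥ u) ⬝ᵥ (B *ᵥ u)) := by
    intro u
    rw [smul_mulVec, dotProduct_smul, smul_eq_mul, ← mulVec_mulVec, dotProduct_mulVec, vecMul_transpose]
  by_cases hu : IsUnit (κ • (Bᵀ * B))
  · have h := h.resolve_left (not_not.2 hu)
    obtain ⟨w, hw, hx⟩ := specNorm_exists _ _ (inv_pos.2 hδ) h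
    set v := (κ • (Bᵀ * B))⁻¹ *ᵥ w with hv
    have hMv : (κ • (Bᵀ * B)) *ᵥ v = w := by
      rw [hv, mulVec_mulVec, Matrix.mul_nonsing_inv _ ((Matrix.isUnit_iff_isUnit_det _).1 hu), one_mulVec]
    have hy : 0 < v ⬝ᵥ v := lt_of_lt_of_le (by positivity) hx
    refine ⟨v, ?_, ?_⟩
    · intro h0
      rw [h0] at hy; simp at hy
    · rw [← key, hMv]
      have hcs : (v ⬝ᵥ w) ^ 2 ≤ (v ⬝ᵥ v) * (w ⬝ᵥ w) := by
        have := Finset.sum_mul_sq_le_sq_mul_sq Finset.univ v w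
        simpa [dotProduct, sq] using this
      rw [hw, mul_one] at hcs
      apply le_of_sq_le_sq _ (by positivity)
      have h3 : 1 ≤ δ ^ 2 * (v ⬝ᵥ v) := by
        rw [inv_pow, inv_le_iff_one_le_mul₀ (by positivity)] at hx
        linarith
      nlinarith
  · have hd : (κ • (Bᵀ * B)).det = 0 := by
      by_contra hd
      exact hu ((Matrix.isUnit_iff_isUnit_det _).2 (isUnit_iff_ne_zero.2 hd))
    obtain ⟨v, hv, hM⟩ := Matrix.exists_mulVec_eq_zero_iff.2 hd
    refine ⟨v, hv, ?_⟩
    rw [← key, hM]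
    have := (normalize_dot v hv).1
    simp
    positivity

lemma stiefel_event {Ω : Type*} [MeasurableSpace Ω] (P : Measure Ω) [IsProbabilityMeasure P]
    {N Mi : Type*} [Fintype N] [Fintype Mi] [DecidableEq N]
    {n : ℕ} (V : Ω → Matrix (Fin n) N ℝ) (hV : IsUniformStiefel P V)
    (e : Mi → N) (he : Function.Injective e) (τ c : ℝ) (b : ℝ≥0∞)
    (hb : ∀ W : Matrix (Fin n) N ℝ, W * Wᵀ = 1 →
      gam (N × Mi) {g | ∃ u, u ⬝ᵥ u = 1 ∧ 0 ≤ qf τ c W (GM g *ᵥ u)} ≤ b) :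
    P {ω | ∃ u, u ⬝ᵥ u = 1 ∧ 0 ≤ qf τ c (V ω) (EM e *ᵥ u)} ≤ b := by
  obtain ⟨hm, h1, hinv⟩ := hV
  let V' : Ω → (Fin n → N → ℝ) := V
  have hm' : Measurable V' := hm
  let Q : Measure (Fin n → N → ℝ) := Measure.map V' P
  have hQ : IsProbabilityMeasure Q := Measure.isProbabilityMeasure_map hm'.aemeasurable
  have hcl : IsClosed {W : Fin n → N → ℝ | (Matrix.of W : Matrix (Fin n) N ℝ) * (Matrix.of W)ᵀ = 1} := by
    have : {W : Fin n → N → ℝ | (Matrix.of W : Matrix (Fin n) N ℝ) * (Matrix.of W)ᵀ = 1} =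
        {W : Fin n → N → ℝ | ∀ i j, ∑ x, W i x * W j x = (1 : Matrix (Fin n) (Fin n) ℝ) i j} := by
      ext W
      exact Matrix.ext_iff.symm
    rw [this]
    simp only [Set.setOf_forall]
    exact isClosed_iInter fun i => isClosed_iInter fun j => isClosed_eq (by fun_prop) continuous_const
  have hW : ∀ᵐ W ∂Q, (Matrix.of W : Matrix (Fin n) N ℝ) * (Matrix.of W)ᵀ = 1 :=
    (ae_map_iff hm'.aemeasurable hcl.measurableSet).2 h1
  have hinv' : ∀ O : Matrix N N ℝ, O * Oᵀ = 1 →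
      Measure.map (fun (W : Fin n → N → ℝ) (i : Fin n) (j : N) => (Matrix.of W * O) i j) Q = Q := by
    intro O hO
    have hmo : Measurable (fun (W : Fin n → N → ℝ) (i : Fin n) (j : N) => (Matrix.of W * O) i j) := by
      apply Continuous.measurable
      simp only [Matrix.mul_apply, Matrix.of_apply]
      fun_prop
    rw [Measure.map_map hmo hm']
    exact hinv O hO
  exact le_trans (Measure.le_map_apply hm'.aemeasurable _) (fubini_step Q hinv' hW e he τ c b hb)

lemma blockCols_eq {n p d : ℕ} (V : Matrix (Fin n) (Fin p × Fin d) ℝ) (J : Finset (Fin p))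
    (u : {j // j ∈ J} × Fin d → ℝ) :
    blockCols V J *ᵥ u = V *ᵥ (EM (fun jk : {j // j ∈ J} × Fin d => ((jk.1.1, jk.2) : Fin p × Fin d)) *ᵥ u) := by
  rw [mulVec_mulVec]
  congr 1
  ext i jk
  rw [Matrix.mul_apply]
  simp [EM, blockCols]
end

/-- **Lemma S.3.** Gram concentration for a sub-collection `A` of the important blocks `T`
(`|T| = s`) of a uniform Stiefel matrix: bounds on `‖√(pd/n)·V_A‖` and on
`‖((pd/n)·V_Aᵀ V_A)⁻¹‖` (the latter with `V_Aᵀ V_A` invertible on the complementary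
event, provided `Δ < 1`). -/
theorem stiefel_gram_concentration
    {Ω : Type*} [MeasurableSpace Ω] (P : Measure Ω) [IsProbabilityMeasure P]
    (n p d s : ℕ) (V : Ω → Matrix (Fin n) (Fin p × Fin d) ℝ)
    (hV : IsUniformStiefel P V)
    (T A : Finset (Fin p)) (hT : T.card = s) (hA : A ⊆ T)
    (hpsd : n ≤ (p - s) * d)
    (t₄ t₅ t₆ : ℝ) (ht₄ : 0 < t₄) (ht₅ : 0 < t₅) (ht₆ : 0 < t₆)
    (h₁ : Real.sqrt ((s * d : ℕ) / (n : ℝ)) + t₄ < 1)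
    (h₂ : Real.sqrt ((s : ℝ) / p) + t₅ < 1)
    (h₃ : Real.sqrt ((s : ℝ) / p) + t₆ < 1 / 3)
    (Δ : ℝ)
    (hΔ : Δ = (3 * (Real.sqrt ((s * d : ℕ) / (n : ℝ)) + t₄)
                + 3 * (Real.sqrt ((s : ℝ) / p) + t₅))
              / (1 - 3 * (Real.sqrt ((s : ℝ) / p) + t₆))) :
    P {ω | Real.sqrt (1 + Δ)
          ≤ specNorm (Real.sqrt ((p * d : ℕ) / (n : ℝ)) • blockCols (V ω) A)}
      ≤ ENNReal.ofReal (2 * Real.exp (-(n : ℝ) * t₄ ^ 2 / 2)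
          + 2 * Real.exp (-((p * d : ℕ) : ℝ) * t₅ ^ 2 / 2)
          + Real.exp (-((p * d : ℕ) : ℝ) * t₆ ^ 2 / 2))
    ∧ (Δ < 1 →
      P {ω | ¬ IsUnit (((p * d : ℕ) / (n : ℝ)) • ((blockCols (V ω) A)ᵀ * blockCols (V ω) A))
            ∨ (1 - Δ)⁻¹
              ≤ specNorm ((((p * d : ℕ) / (n : ℝ)) •
                  ((blockCols (V ω) A)ᵀ * blockCols (V ω) A))⁻¹)}
        ≤ ENNReal.ofReal (2 * Real.exp (-(n : ℝ) * t₄ ^ 2 / 2)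
            + 2 * Real.exp (-((p * d : ℕ) : ℝ) * t₅ ^ 2 / 2)
            + Real.exp (-((p * d : ℕ) : ℝ) * t₆ ^ 2 / 2))) := by
  set B := 2 * Real.exp (-(n : ℝ) * t₄ ^ 2 / 2)
          + 2 * Real.exp (-((p * d : ℕ) : ℝ) * t₅ ^ 2 / 2)
          + Real.exp (-((p * d : ℕ) : ℝ) * t₆ ^ 2 / 2) with hB
  have htriv : n = 0 ∨ p * d = 0 → 1 ≤ B := by
    have e4 := Real.exp_pos (-(n : ℝ) * t₄ ^ 2 / 2)
    have e5 := Real.exp_pos (-((p * d : ℕ) : ℝ) * t₅ ^ 2 / 2)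
    have e6 := Real.exp_pos (-((p * d : ℕ) : ℝ) * t₆ ^ 2 / 2)
    rintro (h | h)
    · have : Real.exp (-(n : ℝ) * t₄ ^ 2 / 2) = 1 := by simp [h]
      linarith
    · have : Real.exp (-((p * d : ℕ) : ℝ) * t₆ ^ 2 / 2) = 1 := by rw [h]; simp
      linarith
  by_cases h0 : n = 0 ∨ p * d = 0
  · have h1 : (1 : ℝ≥0∞) ≤ ENNReal.ofReal B := by
      rw [← ENNReal.ofReal_one]
      exact ENNReal.ofReal_le_ofReal (htriv h0)
    exact ⟨prob_le_one.trans h1, fun _ => prob_le_one.trans h1⟩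
  push Not at h0
  obtain ⟨hn0, hpd0⟩ := h0
  have hn1 : 1 ≤ n := Nat.one_le_iff_ne_zero.2 hn0
  have hD1 : 1 ≤ p * d := Nat.one_le_iff_ne_zero.2 hpd0
  have hp0 : p ≠ 0 := fun h => hpd0 (by simp [h])
  have hd0 : d ≠ 0 := fun h => hpd0 (by simp [h])
  have hnR : (0 : ℝ) < n := by positivity
  have hDR : (0 : ℝ) < (p * d : ℕ) := by positivity
  set x := Real.sqrt ((s * d : ℕ) / (n : ℝ)) with hx
  set y := Real.sqrt ((s : ℝ) / p) with hy
  have hx0 : 0 ≤ x := Real.sqrt_nonneg _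
  have hy0 : 0 ≤ y := Real.sqrt_nonneg _
  let e : {j // j ∈ A} × Fin d → Fin p × Fin d := fun jk => (jk.1.1, jk.2)
  have he : Function.Injective e := by
    rintro ⟨⟨a, ha⟩, b⟩ ⟨⟨a', ha'⟩, b'⟩ h
    simp only [e, Prod.mk.injEq] at h
    obtain ⟨rfl, rfl⟩ := h
    rfl
  have hAs : A.card ≤ s := hT ▸ Finset.card_le_card hA
  have cR : Fintype.card (Fin n) = n := Fintype.card_fin n
  have cN : Fintype.card (Fin p × Fin d) = p * d := by simp
  have cM : Fintype.card ({j // j ∈ A} × Fin d) = A.card * d := by simp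
  have hxa : √((Fintype.card ({j // j ∈ A} × Fin d) : ℝ) / Fintype.card (Fin n)) ≤ x := by
    rw [cR, cM]
    apply Real.sqrt_le_sqrt
    gcongr
  have hya : √((Fintype.card ({j // j ∈ A} × Fin d) : ℝ) / Fintype.card (Fin p × Fin d)) ≤ y := by
    rw [cN, cM]
    apply Real.sqrt_le_sqrt
    push_cast
    rw [mul_div_mul_right _ _ (by positivity)]
    gcongr
  have hden : 0 < 1 - 3 * (y + t₆) := by linarith
  have hΔm : Δ * (1 - 3 * (y + t₆)) = 3 * (x + t₄) + 3 * (y + t₅) := by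
    rw [hΔ]; field_simp
  have hΔ0 : 0 ≤ Δ := by rw [hΔ]; positivity
  set κ : ℝ := (p * d : ℕ) / (n : ℝ) with hκ
  have hκ0 : 0 < κ := by positivity
  have hκi : (n : ℝ) / (p * d : ℕ) = κ⁻¹ := by rw [hκ, inv_div]
  -- event bound, including the degenerate case
  have main : ∀ (τ c t t' : ℝ),
      (1 ≤ Fintype.card ({j // j ∈ A} × Fin d) → ∀ W : Matrix (Fin n) (Fin p × Fin d) ℝ, W * Wᵀ = 1 →
        gam ((Fin p × Fin d) × ({j // j ∈ A} × Fin d))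
          {g | ∃ u, u ⬝ᵥ u = 1 ∧ 0 ≤ qf τ c W (GM g *ᵥ u)} ≤
        ENNReal.ofReal (Real.exp (-(n : ℝ) * t ^ 2 / 2)) +
        ENNReal.ofReal (Real.exp (-((p * d : ℕ) : ℝ) * t' ^ 2 / 2))) →
      Real.exp (-(n : ℝ) * t ^ 2 / 2) + Real.exp (-((p * d : ℕ) : ℝ) * t' ^ 2 / 2) ≤ B →
      P {ω | ∃ u, u ≠ 0 ∧ 0 ≤ qf τ c (V ω) (EM e *ᵥ u)} ≤ ENNReal.ofReal B := by
    intro τ c t t' hg hle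
    by_cases hM : 1 ≤ Fintype.card ({j // j ∈ A} × Fin d)
    · have := stiefel_event P V hV e he τ c _ (hg hM)
      rw [← ENNReal.ofReal_add (Real.exp_pos _).le (Real.exp_pos _).le] at this
      refine le_trans (measure_mono ?_) (this.trans (ENNReal.ofReal_le_ofReal hle))
      rintro ω ⟨u, hu, hq⟩
      refine ⟨_, (normalize_dot u hu).2, ?_⟩
      rw [mulVec_smul, qf_smul]
      positivity
    · have hemp : IsEmpty ({j // j ∈ A} × Fin d) := by
        rw [← Fintype.card_eq_zero_iff]; omega
      have : {ω | ∃ u, u ≠ 0 ∧ 0 ≤ qf τ c (V ω) (EM e *ᵥ u)} = ∅ := by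
        ext ω
        simp only [Set.mem_ofPred_eq, Set.mem_empty_iff_false, iff_false]
        rintro ⟨u, hu, -⟩
        exact hu (Subsingleton.elim _ _)
      rw [this]; simp
  refine ⟨?_, fun hΔ1 => ?_⟩
  · set t := min t₅ t₆ with ht
    have ht0 : 0 < t := lt_min ht₅ ht₆
    refine le_trans (measure_mono ?_) (main 1 ((n : ℝ) / (p * d : ℕ) * (1 + Δ)) t₄ t ?_ ?_)
    · intro ω hω
      obtain ⟨u, hu, hq⟩ := specNorm_exists _ _ (Real.sqrt_pos.2 (by linarith)) hω
      refine ⟨u, ?_, ?_⟩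
      · rintro rfl; simp at hu
      · rw [smul_mulVec, smul_dotProduct, dotProduct_smul, smul_eq_mul, smul_eq_mul, ← mul_assoc,
          Real.mul_self_sqrt hκ0.le, Real.sq_sqrt (by linarith), blockCols_eq] at hq
        unfold qf
        rw [EM_mulVec e he, hu, hκi]
        have h3 : κ⁻¹ * (1 + Δ) ≤ (V ω *ᵥ EM e *ᵥ u) ⬝ᵥ (V ω *ᵥ EM e *ᵥ u) := by
          rw [inv_mul_le_iff₀ hκ0]; exact hq
        linarith
    · intro hM W hW
      have h5 : t ≤ t₅ := min_le_left _ _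
      have h6 : t ≤ t₆ := min_le_right _ _
      have := gam_part1 (Mi := {j // j ∈ A} × Fin d) W hW (t := t₄) (t' := t) (a := x + t₄)
        (r := y + t) (Δ := Δ) ht₄ ht0 (by rw [cR]; exact hn1) (by rw [cN]; exact hD1) hM
        (by linarith) h₁.le (by linarith) (by linarith) hΔ0 (by nlinarith)
      rwa [cR, cN] at this
    · have e4 := Real.exp_pos (-(n : ℝ) * t₄ ^ 2 / 2)
      have e5 := Real.exp_pos (-((p * d : ℕ) : ℝ) * t₅ ^ 2 / 2)
      have e6 := Real.exp_pos (-((p * d : ℕ) : ℝ) * t₆ ^ 2 / 2)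
      rcases min_choice t₅ t₆ with h | h
      · rw [ht, h]; linarith
      · rw [ht, h]; linarith
  · have hab : 3 * (x + t₄) + 3 * (y + t₅) ≤ Δ := by nlinarith
    refine le_trans (measure_mono ?_) (main (-1) ((n : ℝ) / (p * d : ℕ) * (1 - Δ)) t₄ t₅ ?_ ?_)
    · intro ω hω
      obtain ⟨u, hu, hq⟩ := inv_exists _ _ _ hκ0 (sub_pos.2 hΔ1) hω
      refine ⟨u, hu, ?_⟩
      rw [blockCols_eq] at hq
      unfold qf
      rw [EM_mulVec e he, hκi]
      have h3 : (V ω *ᵥ EM e *ᵥ u) ⬝ᵥ (V ω *ᵥ EM e *ᵥ u) ≤ κ⁻¹ * ((1 - Δ) * (u ⬝ᵥ u)) := by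
        rw [le_inv_mul_iff₀ hκ0]; exact hq
      linarith
    · intro hM W hW
      have hbb : (1 - Δ) * (1 + (y + t₅)) ^ 2 ≤ 1 - 3 * (x + t₄) := by
        have k1 : (1 + (y + t₅)) ^ 2 ≤ 1 + 3 * (y + t₅) := by nlinarith
        have k2 : (1 - Δ) * (1 + (y + t₅)) ^ 2 ≤ (1 - Δ) * (1 + 3 * (y + t₅)) :=
          mul_le_mul_of_nonneg_left k1 (by linarith)
        have k3 : (1 - Δ) * (1 + 3 * (y + t₅)) = 1 + 3 * (y + t₅) - Δ - 3 * (Δ * (y + t₅)) := by ring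
        have k4 : 0 ≤ Δ * (y + t₅) := mul_nonneg hΔ0 (by linarith)
        linarith
      have := gam_part2 (Mi := {j // j ∈ A} × Fin d) W hW (t := t₄) (t' := t₅) (a := x + t₄)
        (r := y + t₅) (Δ := Δ) ht₄ ht₅ (by rw [cR]; exact hn1) (by rw [cN]; exact hD1) hM
        (by linarith) (by linarith) (by linarith) hΔ1.le hbb
      rwa [cR, cN] at this
    · have e4 := Real.exp_pos (-(n : ℝ) * t₄ ^ 2 / 2)
      have e5 := Real.exp_pos (-((p * d : ℕ) : ℝ) * t₅ ^ 2 / 2)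
      have e6 := Real.exp_pos (-((p * d : ℕ) : ℝ) * t₆ ^ 2 / 2)
      linarith
end
end

section
/- Let V be an n×(p·d) random real matrix uniformly distributed on the Stiefel manifold V(n, p·d), with columns partitioned into p consecutive blocks of d columns. Let T ⊆ {1,…,p} with |T| = s and A ⊆ T. Suppose (p − s)·d ≥ n, √(s d/n) ≤ 1/120, and √(s/p) ≤ 1/120. Then P[ ‖√(p d/n)·V_A‖ ≥ √(8/7) ] ≤ 5·exp(−n/28800) and P[ ‖((p d/n)·V_Aᵀ V_A)^{−1}‖ ≥ 7/6 ] ≤ 5·exp(−n/28800) (with V_AᵀV_A invertible on the complementary event). -/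
open MeasureTheory ProbabilityTheory Filter Matrix
open scoped ENNReal NNReal

noncomputable section

namespace SGC

lemma lintegral_exp_sq (c : ℝ) (hc : c < 1 / 2) :
    ∫⁻ x, ENNReal.ofReal (Real.exp (c * x ^ 2)) ∂(gaussianReal 0 1)
      = ENNReal.ofReal (√(1 - 2 * c))⁻¹ := by
  have hb : 0 < 1 / 2 - c := by linarith
  rw [gaussianReal_of_var_ne_zero _ one_ne_zero,
    lintegral_withDensity_eq_lintegral_mul _ (measurable_gaussianPDF _ _) (by fun_prop)]
  have h1 : ∀ x : ℝ, (gaussianPDF 0 1 * fun x => ENNReal.ofReal (Real.exp (c * x ^ 2))) x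
      = ENNReal.ofReal ((√(2 * Real.pi))⁻¹ * Real.exp (-(1 / 2 - c) * x ^ 2)) := by
    intro x
    rw [Pi.mul_apply, gaussianPDF, ← ENNReal.ofReal_mul (gaussianPDFReal_nonneg _ _ _),
      gaussianPDFReal]
    congr 1
    simp only [NNReal.coe_one, mul_one, sub_zero, mul_assoc, ← Real.exp_add]
    congr 2
    ring
  simp_rw [h1]
  rw [← ofReal_integral_eq_lintegral_ofReal ((integrable_exp_neg_mul_sq hb).const_mul _)
    (ae_of_all _ fun x => by positivity), integral_const_mul, integral_gaussian]
  congr 1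
  rw [← Real.sqrt_inv, ← Real.sqrt_inv, ← Real.sqrt_mul (by positivity)]
  congr 1
  have : 1 - 2 * c ≠ 0 := by linarith
  have := Real.pi_ne_zero
  field_simp

lemma lintegral_exp_norm_sq {ι : Type*} [Fintype ι] (c : ℝ) (hc : c < 1 / 2) :
    ∫⁻ g, ENNReal.ofReal (Real.exp (c * ‖g‖ ^ 2)) ∂(stdGaussian (EuclideanSpace ℝ ι))
      = ENNReal.ofReal (√(1 - 2 * c))⁻¹ ^ (Fintype.card ι) := by
  rw [← map_pi_eq_stdGaussian, lintegral_map (by fun_prop) (by fun_prop)]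
  simp_rw [EuclideanSpace.real_norm_sq_eq, Finset.mul_sum, Real.exp_sum]
  have h1 : ∀ x : ι → ℝ, ENNReal.ofReal (∏ i, Real.exp (c * x i ^ 2))
      = ∏ i, ENNReal.ofReal (Real.exp (c * x i ^ 2)) := fun x =>
    ENNReal.ofReal_prod_of_nonneg fun i _ => by positivity
  simp_rw [h1]
  have hind : iIndepFun (fun (i : ι) (x : ι → ℝ) => ENNReal.ofReal (Real.exp (c * x i ^ 2)))
      (Measure.pi (fun _ : ι => gaussianReal 0 1)) :=
    iIndepFun_pi (X := fun (_ : ι) (x : ℝ) => ENNReal.ofReal (Real.exp (c * x ^ 2)))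
      (fun i => by fun_prop)
  rw [lintegral_prod_eq_prod_lintegral_of_indepFun _ _ hind (fun i => by fun_prop)]
  have h2 : ∀ i : ι, ∫⁻ x, ENNReal.ofReal (Real.exp (c * x i ^ 2))
      ∂(Measure.pi (fun _ : ι => gaussianReal 0 1)) = ENNReal.ofReal (√(1 - 2 * c))⁻¹ := by
    intro i
    rw [← lintegral_exp_sq c hc,
      ← (measurePreserving_eval (fun _ : ι => gaussianReal 0 1) i).lintegral_comp
        (f := fun x => ENNReal.ofReal (Real.exp (c * x ^ 2))) (by fun_prop)]
  simp_rw [h2]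
  simp

lemma exp_le_pow (c : ℝ) (hc : c < 1 / 2) (N : ℕ) :
    ENNReal.ofReal (Real.exp (c * N)) ≤ ENNReal.ofReal (√(1 - 2 * c))⁻¹ ^ N := by
  rw [mul_comm, Real.exp_nat_mul, ENNReal.ofReal_pow (by positivity)]
  gcongr
  have h0 : 0 < 1 - 2 * c := by linarith
  rw [← inv_inv (Real.exp c), ← Real.exp_neg]
  have : √(1 - 2 * c) ≤ Real.exp (-c) := by
    rw [Real.sqrt_le_left (by positivity), ← Real.exp_nat_mul]
    have := Real.add_one_le_exp (((2 : ℕ) : ℝ) * -c)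
    push_cast at this ⊢
    linarith
  gcongr

lemma pow_le_exp (c : ℝ) (hc : |c| ≤ 1 / 8) (N : ℕ) :
    ENNReal.ofReal (√(1 - 2 * c))⁻¹ ^ N ≤ ENNReal.ofReal (Real.exp ((c + 2 * c ^ 2) * N)) := by
  rw [mul_comm _ (N : ℝ), Real.exp_nat_mul, ENNReal.ofReal_pow (by positivity)]
  gcongr
  obtain ⟨h1, h2⟩ := abs_le.1 hc
  have h0 : 0 < 1 - 2 * c := by linarith
  rw [← inv_inv (Real.exp _), ← Real.exp_neg]
  have : Real.exp (-(c + 2 * c ^ 2)) ≤ √(1 - 2 * c) := by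
    apply Real.le_sqrt_of_sq_le
    rw [← Real.exp_nat_mul]
    have e1 : ((2 : ℕ) : ℝ) * -(c + 2 * c ^ 2) = -(2 * c + (2 * c) ^ 2) := by push_cast; ring
    rw [e1, Real.exp_neg, inv_le_iff_one_le_mul₀ (by positivity)]
    set x := 2 * c with hx
    have hx1 : -(1 / 4) ≤ x := by linarith
    have hx2 : x ≤ 1 / 4 := by linarith
    rcases le_total 0 x with h | h
    · have := Real.quadratic_le_exp_of_nonneg (x := x + x ^ 2) (by positivity)
      have h5 : (1 - x) * (1 + (x + x ^ 2) + (x + x ^ 2) ^ 2 / 2) ≤ (1 - x) * Real.exp (x + x ^ 2) :=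
        mul_le_mul_of_nonneg_left this h0.le
      have h6 : 0 ≤ x ^ 2 * (1 - 3 * x) := by
        apply mul_nonneg (sq_nonneg _); linarith
      have h7 : 0 ≤ (1 - x) * x ^ 3 := by
        apply mul_nonneg (by linarith); positivity
      have h8 : 0 ≤ (1 - x) * x ^ 4 := by
        apply mul_nonneg (by linarith); positivity
      nlinarith
    · have := Real.add_one_le_exp (x + x ^ 2)
      have h5 : (1 - x) * (x + x ^ 2 + 1) ≤ (1 - x) * Real.exp (x + x ^ 2) :=
        mul_le_mul_of_nonneg_left this h0.le
      have h6 : 0 ≤ x ^ 2 * (-x) := by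
        apply mul_nonneg (sq_nonneg _); linarith
      nlinarith
  gcongr

end SGC

namespace SGC

/-- squared norm of `W g`. -/
def Q {n : ℕ} {ι : Type*} [Fintype ι] (W : Matrix (Fin n) ι ℝ) (g : ι → ℝ) : ℝ :=
  ∑ i, (W *ᵥ g) i ^ 2

lemma Q_nonneg {n : ℕ} {ι : Type*} [Fintype ι] (W : Matrix (Fin n) ι ℝ) (g : ι → ℝ) :
    0 ≤ Q W g := Finset.sum_nonneg fun _ _ => sq_nonneg _

lemma Q_smul {n : ℕ} {ι : Type*} [Fintype ι] (W : Matrix (Fin n) ι ℝ) (r : ℝ) (g : ι → ℝ) :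
    Q W (r • g) = r ^ 2 * Q W g := by
  simp [Q, Matrix.mulVec_smul, mul_pow, Finset.mul_sum]

lemma Q_mul {n : ℕ} {ι : Type*} [Fintype ι] (W : Matrix (Fin n) ι ℝ) (O : Matrix ι ι ℝ)
    (g : ι → ℝ) : Q (W * O) g = Q W (O *ᵥ g) := by
  simp [Q, Matrix.mulVec_mulVec]

lemma Q_eq {n : ℕ} {ι : Type*} [Fintype ι] [DecidableEq ι] (W : Matrix (Fin n) ι ℝ)
    (g : EuclideanSpace ℝ ι) :
    Q W g = ‖Matrix.toEuclideanLin W g‖ ^ 2 := by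
  rw [EuclideanSpace.real_norm_sq_eq]; rfl

lemma inner_transpose {n : ℕ} {ι : Type*} [Fintype ι] [DecidableEq ι] (W : Matrix (Fin n) ι ℝ)
    (g : EuclideanSpace ℝ ι) (t : EuclideanSpace ℝ (Fin n)) :
    inner ℝ (Matrix.toEuclideanLin W g) t = inner ℝ g (Matrix.toEuclideanLin Wᵀ t) := by
  rw [← LinearMap.adjoint_inner_right, ← Matrix.toEuclideanLin_conjTranspose_eq_adjoint,
    Matrix.conjTranspose_eq_transpose_of_trivial]

lemma norm_transpose {n : ℕ} {ι : Type*} [Fintype ι] [DecidableEq ι] (W : Matrix (Fin n) ι ℝ)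
    (hW : W * Wᵀ = 1) (t : EuclideanSpace ℝ (Fin n)) :
    ‖Matrix.toEuclideanLin Wᵀ t‖ ^ 2 = ‖t‖ ^ 2 := by
  rw [← real_inner_self_eq_norm_sq, ← inner_transpose, ← real_inner_self_eq_norm_sq]
  congr 1
  ext i
  simp [Matrix.toLpLin_apply, Matrix.mulVec_mulVec, hW]

lemma Q_le {n : ℕ} {ι : Type*} [Fintype ι] [DecidableEq ι] (W : Matrix (Fin n) ι ℝ)
    (hW : W * Wᵀ = 1) (g : EuclideanSpace ℝ ι) : Q W g ≤ ‖g‖ ^ 2 := by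
  rw [Q_eq]
  set y := Matrix.toEuclideanLin W g with hy
  have h1 : ‖y‖ ^ 2 = inner ℝ g (Matrix.toEuclideanLin Wᵀ y) := by
    rw [← inner_transpose, real_inner_self_eq_norm_sq]
  have h2 := real_inner_le_norm g (Matrix.toEuclideanLin Wᵀ y)
  have h3 := norm_transpose W hW y
  have h4 : ‖Matrix.toEuclideanLin Wᵀ y‖ = ‖y‖ := by
    rwa [sq_eq_sq₀ (norm_nonneg _) (norm_nonneg _)] at h3
  rw [h4] at h2
  have h5 : ‖y‖ ^ 2 ≤ ‖g‖ * ‖y‖ := by linarith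
  have := norm_nonneg y
  have := norm_nonneg g
  nlinarith [sq_nonneg (‖g‖ - ‖y‖)]

lemma map_stdGaussian {n : ℕ} {ι : Type*} [Fintype ι] [DecidableEq ι] (W : Matrix (Fin n) ι ℝ)
    (hW : W * Wᵀ = 1) :
    (stdGaussian (EuclideanSpace ℝ ι)).map (Matrix.toEuclideanLin W)
      = stdGaussian (EuclideanSpace ℝ (Fin n)) := by
  have hm : Measurable (Matrix.toEuclideanLin W) :=
    (LinearMap.continuous_of_finiteDimensional _).measurable
  have : IsFiniteMeasure ((stdGaussian (EuclideanSpace ℝ ι)).map (Matrix.toEuclideanLin W)) :=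
    Measure.isFiniteMeasure_map _ _
  apply Measure.ext_of_charFun
  ext t
  rw [charFun_apply, integral_map hm.aemeasurable (by fun_prop)]
  simp_rw [inner_transpose]
  rw [← charFun_apply, charFun_stdGaussian, charFun_stdGaussian]
  have := norm_transpose W hW t
  norm_cast
  rw [this]

lemma lintegral_Q {n : ℕ} {ι : Type*} [Fintype ι] [DecidableEq ι] (W : Matrix (Fin n) ι ℝ)
    (hW : W * Wᵀ = 1) (c : ℝ) (hc : c < 1 / 2) :
    ∫⁻ g, ENNReal.ofReal (Real.exp (c * Q W g)) ∂(stdGaussian (EuclideanSpace ℝ ι))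
      = ENNReal.ofReal (√(1 - 2 * c))⁻¹ ^ n := by
  have hm : Measurable (Matrix.toEuclideanLin W) :=
    (LinearMap.continuous_of_finiteDimensional _).measurable
  have := lintegral_exp_norm_sq (ι := Fin n) c hc
  rw [← map_stdGaussian W hW, lintegral_map (by fun_prop) hm, Fintype.card_fin] at this
  rw [← this]
  simp_rw [Q_eq]

lemma exists_rot {ι : Type*} [Fintype ι] [DecidableEq ι] (v w : EuclideanSpace ℝ ι)
    (h : ‖v‖ = ‖w‖) : ∃ O : Matrix ι ι ℝ, O * Oᵀ = 1 ∧ O *ᵥ v = w := by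
  let R := Submodule.reflection (ℝ ∙ (v - w))ᗮ
  let O : Matrix ι ι ℝ := Matrix.toEuclideanLin.symm (R : EuclideanSpace ℝ ι →ₗ[ℝ] EuclideanSpace ℝ ι)
  have hO : ∀ x, Matrix.toEuclideanLin O x = R x := fun x => by simp [O]
  refine ⟨O, ?_, ?_⟩
  · have h1 : Oᵀ * O = 1 := by
      apply Matrix.toEuclideanLin.injective
      apply LinearMap.ext
      intro x
      apply ext_inner_left ℝ
      intro y
      have e1 : Matrix.toEuclideanLin (Oᵀ * O) x
          = Matrix.toEuclideanLin Oᵀ (Matrix.toEuclideanLin O x) := by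
        ext i; simp [Matrix.toLpLin_apply, Matrix.mulVec_mulVec]
      have e2 : Matrix.toEuclideanLin (1 : Matrix ι ι ℝ) x = x := by
        ext i; simp [Matrix.toLpLin_apply]
      rw [e1, e2, ← Matrix.conjTranspose_eq_transpose_of_trivial,
        Matrix.toEuclideanLin_conjTranspose_eq_adjoint, LinearMap.adjoint_inner_right, hO, hO,
        R.inner_map_map]
    exact mul_eq_one_comm.1 h1
  · have h2 := hO v
    have h3 : R v = w := Submodule.reflection_sub h
    rw [h3] at h2
    have := congrArg WithLp.ofLp h2
    simpa [Matrix.toLpLin_apply] using this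

lemma measurable_Q {Ω : Type*} [MeasurableSpace Ω] {n : ℕ} {ι : Type*} [Fintype ι]
    (W : Ω → Matrix (Fin n) ι ℝ) (g : Ω → ι → ℝ) (hW : ∀ i j, Measurable fun x => W x i j)
    (hg : ∀ j, Measurable fun x => g x j) :
    Measurable fun x => Q (W x) (g x) := by
  unfold Q Matrix.mulVec dotProduct
  exact Finset.measurable_sum _ fun i _ => Measurable.pow_const
    (Finset.measurable_sum _ fun j _ => Measurable.mul (hW i j) (hg j)) _

lemma measurable_entry {Ω : Type*} [MeasurableSpace Ω] {n : ℕ} {ι : Type*}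
    (W : Ω → Matrix (Fin n) ι ℝ) (hW : Measurable W) (i : Fin n) (j : ι) :
    Measurable fun x => W x i j :=
  (measurable_pi_apply j).comp ((measurable_pi_apply i).comp hW)

lemma measurable_Q_left {n : ℕ} {ι : Type*} [Fintype ι] (g : ι → ℝ) :
    Measurable fun W : Matrix (Fin n) ι ℝ => Q W g :=
  measurable_Q _ _ (measurable_entry _ measurable_id) (fun _ => measurable_const)

lemma measurable_mul_right' {Ω ι : Type*} [MeasurableSpace Ω] [Fintype ι] {n : ℕ}
    (V : Ω → Matrix (Fin n) ι ℝ) (hm : Measurable V) (O : Matrix ι ι ℝ) :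
    Measurable fun ω => V ω * O := by
  refine measurable_pi_lambda _ fun i => measurable_pi_lambda _ fun j => ?_
  simp only [Matrix.mul_apply]
  refine Finset.measurable_sum _ fun k _ => Measurable.mul_const ?_ _
  exact (measurable_pi_apply k).comp ((measurable_pi_apply i).comp hm)

lemma rot_key {Ω ι : Type*} [MeasurableSpace Ω] [Fintype ι] [DecidableEq ι]
    (P : Measure Ω) {n : ℕ} (V : Ω → Matrix (Fin n) ι ℝ)
    (hV : IsUniformStiefel P V) (u : EuclideanSpace ℝ ι) (hu : ‖u‖ = 1) (c : ℝ)
    (g : EuclideanSpace ℝ ι) :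
      ∫⁻ ω, ENNReal.ofReal (Real.exp (c * Q (V ω) g)) ∂P
        = ∫⁻ ω, ENNReal.ofReal (Real.exp (c * Q (V ω) u * ‖g‖ ^ 2)) ∂P := by
  obtain ⟨hm, h1, hO⟩ := hV
  obtain ⟨O, hO1, hO2⟩ := exists_rot (‖g‖ • u) g (by simp [norm_smul, hu])
  have hF : Measurable fun W : Matrix (Fin n) ι ℝ =>
      ENNReal.ofReal (Real.exp (c * Q W (‖g‖ • u : EuclideanSpace ℝ ι))) :=
    ((measurable_Q_left _).const_mul c).exp.ennreal_ofReal
  have e0 := lintegral_map (μ := P) hF hm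
  have e1 := lintegral_map (μ := P) hF (measurable_mul_right' V hm O)
  rw [hO O hO1, e0] at e1
  calc _ = ∫⁻ ω, ENNReal.ofReal (Real.exp (c * Q (V ω * O) (‖g‖ • u : EuclideanSpace ℝ ι))) ∂P := by
        refine lintegral_congr fun ω => ?_
        rw [Q_mul, hO2]
    _ = ∫⁻ ω, ENNReal.ofReal (Real.exp (c * Q (V ω) (‖g‖ • u : EuclideanSpace ℝ ι))) ∂P := e1.symm
    _ = _ := by
        refine lintegral_congr fun ω => ?_
        rw [WithLp.ofLp_smul, Q_smul]
        congr 2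
        ring

lemma measurable_Q_joint {Ω ι : Type*} [MeasurableSpace Ω] [Fintype ι]
    {n : ℕ} (V : Ω → Matrix (Fin n) ι ℝ) (hm : Measurable V) :
    Measurable fun x : Ω × EuclideanSpace ℝ ι => Q (V x.1) x.2 := by
  have h1 : Measurable fun x : EuclideanSpace ℝ ι => (x : ι → ℝ) := by fun_prop
  exact measurable_Q _ _ (fun i j => (measurable_entry V hm i j).comp measurable_fst)
    (fun j => ((measurable_pi_apply j).comp h1).comp measurable_snd)

lemma mgf_le {Ω ι : Type*} [MeasurableSpace Ω] [Fintype ι] [DecidableEq ι]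
    (P : Measure Ω) [IsProbabilityMeasure P] {n : ℕ} (V : Ω → Matrix (Fin n) ι ℝ)
    (hV : IsUniformStiefel P V) (u : EuclideanSpace ℝ ι) (hu : ‖u‖ = 1) (c : ℝ)
    (hc : c < 1 / 2) :
    ∫⁻ ω, ENNReal.ofReal (Real.exp (c * (Fintype.card ι * Q (V ω) u))) ∂P
      ≤ ENNReal.ofReal (√(1 - 2 * c))⁻¹ ^ n := by
  have key := rot_key P V hV u hu c
  obtain ⟨hm, h1, hO⟩ := hV
  have e2 : ∫⁻ ω, ∫⁻ g, ENNReal.ofReal (Real.exp (c * Q (V ω) g))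
      ∂(stdGaussian (EuclideanSpace ℝ ι)) ∂P
      = ENNReal.ofReal (√(1 - 2 * c))⁻¹ ^ n := by
    have : ∀ᵐ ω ∂P, ∫⁻ g, ENNReal.ofReal (Real.exp (c * Q (V ω) g))
        ∂(stdGaussian (EuclideanSpace ℝ ι))
        = ENNReal.ofReal (√(1 - 2 * c))⁻¹ ^ n := by
      filter_upwards [h1] with ω hω
      exact lintegral_Q _ hω c hc
    rw [lintegral_congr_ae this, lintegral_const, measure_univ, mul_one]
  have hm1 : AEMeasurable (Function.uncurry fun (ω : Ω) (g : EuclideanSpace ℝ ι) =>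
      ENNReal.ofReal (Real.exp (c * Q (V ω) g))) (P.prod (stdGaussian (EuclideanSpace ℝ ι))) :=
    ((measurable_Q_joint V hm).const_mul c).exp.ennreal_ofReal.aemeasurable
  have hQu : Measurable fun ω => Q (V ω) u := (measurable_Q_left _).comp hm
  have hm2 : AEMeasurable (Function.uncurry fun (g : EuclideanSpace ℝ ι) (ω : Ω) =>
      ENNReal.ofReal (Real.exp (c * Q (V ω) u * ‖g‖ ^ 2)))
      ((stdGaussian (EuclideanSpace ℝ ι)).prod P) :=
    (((hQu.comp measurable_snd).const_mul c).mul
      ((measurable_norm.comp measurable_fst).pow_const 2)).exp.ennreal_ofReal.aemeasurable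
  rw [← e2, lintegral_lintegral_swap hm1, lintegral_congr key, lintegral_lintegral_swap hm2]
  refine lintegral_mono_ae ?_
  filter_upwards [h1] with ω hω
  have hq0 := Q_nonneg (V ω) u
  have hq1 := Q_le (V ω) hω u
  rw [hu] at hq1
  have hc' : c * Q (V ω) u < 1 / 2 := by
    rcases le_total 0 c with h | h
    · nlinarith
    · nlinarith
  rw [lintegral_exp_norm_sq _ hc']
  refine le_trans (le_of_eq ?_) (exp_le_pow _ hc' _)
  congr 2
  ring

end SGC

namespace SGC

lemma chernoff {Ω : Type*} [MeasurableSpace Ω] (P : Measure Ω) (X : Ω → ℝ) (hX : Measurable X)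
    (c a b : ℝ) (h : ∫⁻ ω, ENNReal.ofReal (Real.exp (c * X ω)) ∂P ≤ ENNReal.ofReal (Real.exp b)) :
    P {ω | a ≤ c * X ω} ≤ ENNReal.ofReal (Real.exp (b - a)) := by
  have h1 := mul_meas_ge_le_lintegral (μ := P)
    (f := fun ω => ENNReal.ofReal (Real.exp (c * X ω)))
    ((hX.const_mul c).exp.ennreal_ofReal) (ENNReal.ofReal (Real.exp a))
  have h2 : {ω | a ≤ c * X ω}
      = {ω | ENNReal.ofReal (Real.exp a) ≤ ENNReal.ofReal (Real.exp (c * X ω))} := by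
    ext ω
    simp only [Set.mem_ofPred_eq]
    rw [ENNReal.ofReal_le_ofReal_iff (by positivity), Real.exp_le_exp]
  rw [h2, Real.exp_sub, ENNReal.ofReal_div_of_pos (by positivity),
    ENNReal.le_div_iff_mul_le (by simp [Real.exp_pos]) (by simp), mul_comm]
  exact h1.trans h

lemma tail {Ω ι : Type*} [MeasurableSpace Ω] [Fintype ι] [DecidableEq ι]
    (P : Measure Ω) [IsProbabilityMeasure P] {n : ℕ} (V : Ω → Matrix (Fin n) ι ℝ)
    (hV : IsUniformStiefel P V) (u : EuclideanSpace ℝ ι) (hu : ‖u‖ = 1) :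
    P {ω | (n : ℝ) / 14 ≤ |Fintype.card ι * Q (V ω) u - n|}
      ≤ ENNReal.ofReal (2 * Real.exp (-(n : ℝ) / 1568)) := by
  have hX : Measurable fun ω => (Fintype.card ι : ℝ) * Q (V ω) u :=
    ((measurable_Q_left _).comp hV.1).const_mul _
  have hp := chernoff P _ hX (1 / 56) (1 / 56 * (15 / 14 * n)) _
    ((mgf_le P V hV u hu (1 / 56) (by norm_num)).trans
      (pow_le_exp (1 / 56) (by rw [abs_of_pos] <;> norm_num) n))
  have hn := chernoff P _ hX (-1 / 56) (-1 / 56 * (13 / 14 * n)) _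
    ((mgf_le P V hV u hu (-1 / 56) (by norm_num)).trans
      (pow_le_exp (-1 / 56) (by rw [abs_of_neg] <;> norm_num) n))
  have e1 : (1 / 56 + 2 * (1 / 56) ^ 2) * (n : ℝ) - 1 / 56 * (15 / 14 * n) = -(n : ℝ) / 1568 := by
    ring
  have e2 : (-1 / 56 + 2 * (-1 / 56) ^ 2) * (n : ℝ) - -1 / 56 * (13 / 14 * n)
      = -(n : ℝ) / 1568 := by ring
  rw [e1] at hp
  rw [e2] at hn
  rw [two_mul, ENNReal.ofReal_add (by positivity) (by positivity)]
  refine le_trans (measure_mono ?_) ((measure_union_le _ _).trans (add_le_add hp hn))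
  intro ω hω
  simp only [Set.mem_ofPred_eq, Set.mem_union] at hω ⊢
  rcases le_abs.1 hω with h | h
  · left; linarith
  · right; linarith

open Metric Module in
lemma card_le {E : Type*} [NormedAddCommGroup E] [NormedSpace ℝ E] [FiniteDimensional ℝ E]
    (s : Finset E) (hs : ∀ c ∈ s, ‖c‖ = 1)
    (h : ∀ c ∈ s, ∀ d ∈ s, c ≠ d → 1 / 4 ≤ ‖c - d‖) : s.card ≤ 9 ^ finrank ℝ E := by
  borelize E
  let μ : Measure E := Measure.addHaar
  let δ : ℝ := (1 : ℝ) / 8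
  let ρ : ℝ := (9 : ℝ) / 8
  have ρpos : 0 < ρ := by norm_num [ρ]
  set A := ⋃ c ∈ s, ball (c : E) δ with hA
  have D : Set.Pairwise (s : Set E) (Function.onFun Disjoint fun c => ball (c : E) δ) := by
    rintro c hc d hd hcd
    apply ball_disjoint_ball
    rw [dist_eq_norm]
    refine le_trans (by norm_num [δ]) (h c hc d hd hcd)
  have A_subset : A ⊆ ball (0 : E) ρ := by
    refine Set.iUnion₂_subset fun x hx => ?_
    apply ball_subset_ball'
    rw [dist_zero_right, hs x hx]
    norm_num [δ, ρ]
  have I :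
    (s.card : ℝ≥0∞) * ENNReal.ofReal (δ ^ finrank ℝ E) * μ (ball 0 1) ≤
      ENNReal.ofReal (ρ ^ finrank ℝ E) * μ (ball 0 1) :=
    calc
      (s.card : ℝ≥0∞) * ENNReal.ofReal (δ ^ finrank ℝ E) * μ (ball 0 1) = μ A := by
        rw [hA, measure_biUnion_finset D fun c _ => measurableSet_ball]
        have I : 0 < δ := by norm_num [δ]
        simp only [μ.addHaar_ball_of_pos _ I]
        simp only [Finset.sum_const, nsmul_eq_mul, mul_assoc]
      _ ≤ μ (ball (0 : E) ρ) := measure_mono A_subset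
      _ = ENNReal.ofReal (ρ ^ finrank ℝ E) * μ (ball 0 1) := by
        simp only [μ.addHaar_ball_of_pos _ ρpos]
  have J : (s.card : ℝ≥0∞) * ENNReal.ofReal (δ ^ finrank ℝ E) ≤ ENNReal.ofReal (ρ ^ finrank ℝ E) :=
    (ENNReal.mul_le_mul_iff_left (measure_ball_pos _ _ zero_lt_one).ne' measure_ball_lt_top.ne).1 I
  have K : (s.card : ℝ) ≤ (9 : ℝ) ^ finrank ℝ E := by
    have := ENNReal.toReal_le_of_le_ofReal (pow_nonneg ρpos.le _) J
    simpa [ρ, δ, div_eq_mul_inv, mul_pow] using this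
  exact mod_cast K

open Module in
lemma exists_net (E : Type*) [NormedAddCommGroup E] [NormedSpace ℝ E] [FiniteDimensional ℝ E] :
    ∃ s : Finset E, (∀ c ∈ s, ‖c‖ = 1) ∧ s.card ≤ 9 ^ finrank ℝ E ∧
      ∀ x : E, ‖x‖ = 1 → ∃ y ∈ s, ‖x - y‖ ≤ 1 / 4 := by
  classical
  let p : ℕ → Prop := fun k => ∃ s : Finset E, (∀ c ∈ s, ‖c‖ = 1) ∧
    (∀ c ∈ s, ∀ d ∈ s, c ≠ d → 1 / 4 ≤ ‖c - d‖) ∧ s.card = k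
  have h0 : p 0 := ⟨∅, by simp, by simp, by simp⟩
  obtain ⟨s, hs1, hs2, hs3⟩ := Nat.findGreatest_spec (P := p) (Nat.zero_le (9 ^ finrank ℝ E)) h0
  refine ⟨s, hs1, card_le s hs1 hs2, fun x hx => ?_⟩
  by_contra! hcon
  have hxs : x ∉ s := fun hxs => by
    have := hcon x hxs
    simp at this
    linarith
  have h1 : ∀ c ∈ insert x s, ‖c‖ = 1 := by
    intro c hc
    rcases Finset.mem_insert.1 hc with rfl | hc
    · exact hx
    · exact hs1 c hc
  have h2 : ∀ c ∈ insert x s, ∀ d ∈ insert x s, c ≠ d → 1 / 4 ≤ ‖c - d‖ := by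
    intro c hc d hd hcd
    rcases Finset.mem_insert.1 hc with rfl | hc1 <;> rcases Finset.mem_insert.1 hd with rfl | hd1
    · exact absurd rfl hcd
    · exact (hcon d hd1).le
    · rw [norm_sub_rev]; exact (hcon c hc1).le
    · exact hs2 c hc1 d hd1 hcd
  have h3 : (insert x s).card = s.card + 1 := Finset.card_insert_of_notMem hxs
  have h4 := card_le _ h1 h2
  have h5 := Nat.le_findGreatest (P := p) h4 ⟨_, h1, h2, rfl⟩
  omega

lemma norm_le_of_net {E : Type*} [NormedAddCommGroup E] [InnerProductSpace ℝ E]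
    (T : E →L[ℝ] E) (hT : (T : E →ₗ[ℝ] E).IsSymmetric)
    (s : Finset E) (hs : ∀ c ∈ s, ‖c‖ = 1) (hnet : ∀ x : E, ‖x‖ = 1 → ∃ y ∈ s, ‖x - y‖ ≤ 1 / 4)
    (m : ℝ) (hm0 : 0 ≤ m) (hm : ∀ y ∈ s, |inner ℝ (T y) y| ≤ m) : ‖T‖ ≤ 2 * m := by
  have h1 : ∀ x : E, ‖x‖ = 1 → |inner ℝ (T x) x| ≤ m + ‖T‖ / 2 := by
    intro x hx
    obtain ⟨y, hy, hxy⟩ := hnet x hx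
    have e : inner ℝ (T x) x = inner ℝ (T y) y + inner ℝ (T (x - y)) x + inner ℝ (T y) (x - y) := by
      simp only [map_sub, inner_sub_left, inner_sub_right]; ring
    have b1 : |inner ℝ (T (x - y)) x| ≤ ‖T‖ * (1 / 4) := by
      refine (abs_real_inner_le_norm _ _).trans ?_
      rw [hx, mul_one]
      exact (T.le_opNorm _).trans (by gcongr)
    have b2 : |inner ℝ (T y) (x - y)| ≤ ‖T‖ * (1 / 4) := by
      refine (abs_real_inner_le_norm _ _).trans ?_
      have := T.le_opNorm y
      rw [hs y hy, mul_one] at this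
      gcongr
    have b3 := hm y hy
    rw [e]
    refine (abs_add_three _ _ _).trans ?_
    linarith
  have h2 : ‖T‖ ≤ m + ‖T‖ / 2 := by
    conv_lhs => rw [T.norm_eq_iSup_rayleighQuotient hT]
    refine ciSup_le fun x => ?_
    by_cases hx : x = 0
    · simp [hx]; positivity
    · have hx' : ‖x‖ ≠ 0 := by simpa using hx
      have := h1 (‖x‖⁻¹ • x) (by simp [norm_smul, hx'])
      have e : T.rayleighQuotient x = inner ℝ (T (‖x‖⁻¹ • x)) (‖x‖⁻¹ • x) := by
        simp only [ContinuousLinearMap.rayleighQuotient, ContinuousLinearMap.reApplyInnerSelf_apply,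
          map_smul, real_inner_smul_left, real_inner_smul_right, RCLike.re_to_real]
        field_simp
      rw [e]; exact this
  linarith

lemma det_bound {n : ℕ} {κ : Type*} [Fintype κ] [DecidableEq κ] (B : Matrix (Fin n) κ ℝ)
    (s : Finset (EuclideanSpace ℝ κ)) (hs : ∀ c ∈ s, ‖c‖ = 1)
    (hnet : ∀ x : EuclideanSpace ℝ κ, ‖x‖ = 1 → ∃ y ∈ s, ‖x - y‖ ≤ 1 / 4)
    (hq : ∀ y ∈ s, |‖Matrix.toEuclideanLin B y‖ ^ 2 - 1| < 1 / 14) :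
    specNorm B < √(8 / 7) ∧ IsUnit (Bᵀ * B) ∧ specNorm (Bᵀ * B)⁻¹ < 7 / 6 := by
  let G := LinearMap.toContinuousLinearMap (Matrix.toEuclideanLin (Bᵀ * B))
  let T : EuclideanSpace ℝ κ →L[ℝ] EuclideanSpace ℝ κ := G - ContinuousLinearMap.id ℝ _
  have hG : ∀ x y, inner ℝ (G x) y
      = inner ℝ (Matrix.toEuclideanLin B x) (Matrix.toEuclideanLin B y) := by
    intro x y
    have e : G x = Matrix.toEuclideanLin Bᵀ (Matrix.toEuclideanLin B x) := by
      change Matrix.toEuclideanLin (Bᵀ * B) x = _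
      ext i
      simp [Matrix.toLpLin_apply, Matrix.mulVec_mulVec]
    rw [e, real_inner_comm, ← inner_transpose, real_inner_comm]
  have hTq : ∀ x, inner ℝ (T x) x = ‖Matrix.toEuclideanLin B x‖ ^ 2 - ‖x‖ ^ 2 := by
    intro x
    simp only [T, _root_.sub_apply, inner_sub_left, hG, real_inner_self_eq_norm_sq,
      ContinuousLinearMap.id_apply]
  have hTs : (T : EuclideanSpace ℝ κ →ₗ[ℝ] EuclideanSpace ℝ κ).IsSymmetric := by
    intro x y
    have h1 := hG x y
    have h2 := hG y x
    rw [real_inner_comm] at h2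
    simp only [T, ContinuousLinearMap.coe_coe, _root_.sub_apply, inner_sub_left,
      inner_sub_right, ContinuousLinearMap.id_apply]
    rw [h1, h2, real_inner_comm]
  have hT : ‖T‖ < 1 / 7 := by
    obtain ⟨m, hm0, hm1, hm⟩ : ∃ m : ℝ, 0 ≤ m ∧ m < 1 / 14 ∧ ∀ y ∈ s, |inner ℝ (T y) y| ≤ m := by
      rcases s.eq_empty_or_nonempty with rfl | hne
      · exact ⟨0, le_rfl, by norm_num, by simp⟩
      · obtain ⟨y, hy, hmax⟩ := s.exists_max_image (fun y => |inner ℝ (T y) y|) hne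
        refine ⟨_, abs_nonneg _, ?_, hmax⟩
        rw [hTq, hs y hy, one_pow]
        exact hq y hy
    have := norm_le_of_net T hTs s hs hnet m hm0 hm
    linarith
  have hTx : ∀ x, |inner ℝ (T x) x| ≤ ‖T‖ * ‖x‖ ^ 2 := by
    intro x
    refine (abs_real_inner_le_norm _ _).trans ?_
    rw [sq, ← mul_assoc]
    gcongr
    exact T.le_opNorm x
  have hT0 := norm_nonneg T
  have hGl : ∀ x, (1 - ‖T‖) * ‖x‖ ≤ ‖G x‖ := by
    intro x
    have h1 := abs_le.1 (hTx x)
    rw [hTq] at h1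
    have h2 := real_inner_le_norm (G x) x
    rw [hG, real_inner_self_eq_norm_sq] at h2
    rcases (norm_nonneg x).eq_or_lt with h | h
    · rw [← h]; simp
    · have : (1 - ‖T‖) * ‖x‖ * ‖x‖ ≤ ‖G x‖ * ‖x‖ := by nlinarith
      exact le_of_mul_le_mul_right this h
  have hU : IsUnit (Bᵀ * B) := by
    rw [← Matrix.mulVec_injective_iff_isUnit]
    refine (injective_iff_map_eq_zero (Matrix.mulVecLin (Bᵀ * B))).2 fun x hx => ?_
    have h1 := hGl (WithLp.toLp 2 x)
    have h2 : G (WithLp.toLp 2 x) = 0 := by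
      change Matrix.toEuclideanLin (Bᵀ * B) (WithLp.toLp 2 x) = 0
      rw [Matrix.mulVecLin_apply] at hx
      rw [Matrix.toLpLin_apply, hx]
      rfl
    rw [h2, norm_zero] at h1
    have h3 : ‖WithLp.toLp 2 x‖ = 0 :=
      le_antisymm (by by_contra! hlt; nlinarith) (norm_nonneg _)
    simpa using h3
  refine ⟨?_, hU, ?_⟩
  · have h1 : specNorm B ≤ √(1 + ‖T‖) := by
      unfold specNorm
      refine ContinuousLinearMap.opNorm_le_bound _ (by positivity) fun x => ?_
      have h1 := abs_le.1 (hTx x)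
      rw [hTq] at h1
      rw [← Real.sqrt_sq (norm_nonneg x), ← Real.sqrt_mul (by positivity)]
      apply Real.le_sqrt_of_sq_le
      change ‖Matrix.toEuclideanLin B x‖ ^ 2 ≤ _
      linarith
    refine h1.trans_lt (Real.sqrt_lt_sqrt (by positivity) (by linarith))
  · have h1 : specNorm (Bᵀ * B)⁻¹ ≤ (1 - ‖T‖)⁻¹ := by
      unfold specNorm
      have hpos : 0 < 1 - ‖T‖ := by linarith
      refine ContinuousLinearMap.opNorm_le_bound _ (by positivity) fun x => ?_
      change ‖Matrix.toEuclideanLin (Bᵀ * B)⁻¹ x‖ ≤ _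
      have h2 := hGl (Matrix.toEuclideanLin (Bᵀ * B)⁻¹ x)
      have h3 : G (Matrix.toEuclideanLin (Bᵀ * B)⁻¹ x) = x := by
        change Matrix.toEuclideanLin (Bᵀ * B) (Matrix.toEuclideanLin (Bᵀ * B)⁻¹ x) = x
        ext i
        simp only [Matrix.toLpLin_apply, Matrix.mulVec_mulVec]
        rw [Matrix.mul_nonsing_inv _ ((Matrix.isUnit_iff_isUnit_det _).1 hU), Matrix.one_mulVec]
      rw [h3] at h2
      rw [inv_mul_eq_div, le_div_iff₀ hpos, mul_comm]
      exact h2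
    refine h1.trans_lt ?_
    rw [inv_lt_comm₀ (by linarith) (by norm_num)]
    linarith

end SGC

namespace SGC

/-- zero extension of a vector indexed by the blocks of `A`. -/
def ext0 {p d : ℕ} (A : Finset (Fin p)) (y : EuclideanSpace ℝ ({j // j ∈ A} × Fin d)) :
    EuclideanSpace ℝ (Fin p × Fin d) :=
  WithLp.toLp 2 fun k => if h : k.1 ∈ A then y (⟨k.1, h⟩, k.2) else 0

lemma sum_ext {p d : ℕ} (A : Finset (Fin p)) (f : {j // j ∈ A} × Fin d → ℝ)
    (g : Fin p × Fin d → ℝ) (h0 : ∀ k, k.1 ∉ A → g k = 0)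
    (h : ∀ k : {j // j ∈ A} × Fin d, f k = g (k.1.1, k.2)) : ∑ k, f k = ∑ k, g k := by
  refine Fintype.sum_of_injective (fun k : {j // j ∈ A} × Fin d => ((k.1.1, k.2) : Fin p × Fin d))
    ?_ f g ?_ h
  · rintro ⟨⟨a, ha⟩, b⟩ ⟨⟨a', ha'⟩, b'⟩ hk
    simpa using hk
  · rintro ⟨a, b⟩ hk
    refine h0 _ fun ha => hk ⟨(⟨a, ha⟩, b), rfl⟩

lemma norm_ext0 {p d : ℕ} (A : Finset (Fin p)) (y : EuclideanSpace ℝ ({j // j ∈ A} × Fin d)) :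
    ‖ext0 A y‖ = ‖y‖ := by
  rw [EuclideanSpace.norm_eq, EuclideanSpace.norm_eq]
  congr 1
  symm
  apply sum_ext
  · intro k hk
    simp [ext0, hk]
  · intro k
    simp [ext0]

lemma Q_ext0 {n p d : ℕ} (A : Finset (Fin p)) (y : EuclideanSpace ℝ ({j // j ∈ A} × Fin d))
    (W : Matrix (Fin n) (Fin p × Fin d) ℝ) : Q W (ext0 A y) = Q (blockCols W A) y := by
  unfold Q
  refine Finset.sum_congr rfl fun i _ => ?_
  congr 1
  unfold Matrix.mulVec dotProduct
  symm
  apply sum_ext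
  · intro k hk
    simp [ext0, hk]
  · intro k
    simp [ext0, blockCols]

lemma good {n p d : ℕ} (hn : 0 < n) (A : Finset (Fin p)) (W : Matrix (Fin n) (Fin p × Fin d) ℝ)
    (s : Finset (EuclideanSpace ℝ ({j // j ∈ A} × Fin d))) (hs : ∀ c ∈ s, ‖c‖ = 1)
    (hnet : ∀ x : EuclideanSpace ℝ ({j // j ∈ A} × Fin d), ‖x‖ = 1 → ∃ y ∈ s, ‖x - y‖ ≤ 1 / 4)
    (hq : ∀ y ∈ s, |(Fintype.card (Fin p × Fin d) : ℝ) * Q W (ext0 A y) - n| < (n : ℝ) / 14) :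
    specNorm (Real.sqrt ((p * d : ℕ) / (n : ℝ)) • blockCols W A) < √(8 / 7) ∧
    IsUnit (((p * d : ℕ) / (n : ℝ)) • ((blockCols W A)ᵀ * blockCols W A)) ∧
    specNorm ((((p * d : ℕ) / (n : ℝ)) • ((blockCols W A)ᵀ * blockCols W A))⁻¹) < 7 / 6 := by
  have hn' : (0 : ℝ) < n := by exact_mod_cast hn
  have h0 : (0 : ℝ) ≤ (p * d : ℕ) / (n : ℝ) := by positivity
  have e : ((p * d : ℕ) / (n : ℝ)) • ((blockCols W A)ᵀ * blockCols W A)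
      = (Real.sqrt ((p * d : ℕ) / (n : ℝ)) • blockCols W A)ᵀ *
        (Real.sqrt ((p * d : ℕ) / (n : ℝ)) • blockCols W A) := by
    rw [Matrix.transpose_smul, Matrix.smul_mul, Matrix.mul_smul, smul_smul, Real.mul_self_sqrt h0]
  rw [e]
  refine det_bound _ s hs hnet fun y hy => ?_
  have h1 := hq y hy
  have e2 : ‖Matrix.toEuclideanLin (Real.sqrt ((p * d : ℕ) / (n : ℝ)) • blockCols W A) y‖ ^ 2
      = (p * d : ℕ) / (n : ℝ) * Q W (ext0 A y) := by
    rw [Q_ext0, Q_eq, map_smul, LinearMap.smul_apply, norm_smul, mul_pow, Real.norm_eq_abs, sq_abs,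
      Real.sq_sqrt h0]
  rw [e2]
  have e3 : (p * d : ℕ) / (n : ℝ) * Q W (ext0 A y) - 1
      = ((Fintype.card (Fin p × Fin d) : ℝ) * Q W (ext0 A y) - n) / n := by
    rw [Fintype.card_prod, Fintype.card_fin, Fintype.card_fin]
    field_simp
  rw [e3, abs_div, abs_of_pos hn', div_lt_iff₀ hn']
  linarith

lemma final_num (n k : ℕ) (c : ℕ) (hc : c ≤ 9 ^ k) (hk : (k : ℝ) ≤ n / 14400) :
    (c : ℝ) * (2 * Real.exp (-(n : ℝ) / 1568)) ≤ 5 * Real.exp (-(n : ℝ) / 28800) := by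
  have h1 : (c : ℝ) ≤ Real.exp (3 * n / 14400) := by
    have h9 : (9 : ℝ) ≤ Real.exp 3 := by
      have := Real.exp_one_gt_d9
      have e : Real.exp 3 = Real.exp 1 ^ 3 := by rw [← Real.exp_nat_mul]; norm_num
      rw [e]
      have h2 : (2.7 : ℝ) ^ 3 ≤ Real.exp 1 ^ 3 := by gcongr; linarith
      exact le_trans (by norm_num) h2
    calc (c : ℝ) ≤ 9 ^ k := by exact_mod_cast hc
      _ ≤ Real.exp 3 ^ k := by gcongr
      _ = Real.exp (k * 3) := by rw [Real.exp_nat_mul]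
      _ ≤ _ := by rw [Real.exp_le_exp]; linarith
  have hn : (0 : ℝ) ≤ n := Nat.cast_nonneg _
  calc (c : ℝ) * (2 * Real.exp (-(n : ℝ) / 1568))
      ≤ Real.exp (3 * n / 14400) * (2 * Real.exp (-(n : ℝ) / 1568)) := by gcongr
    _ = 2 * Real.exp (3 * n / 14400 + -(n : ℝ) / 1568) := by rw [Real.exp_add]; ring
    _ ≤ 5 * Real.exp (-(n : ℝ) / 28800) := by
      gcongr
      · norm_num
      · linarith

end SGC

/-- **Lemma S.3, specialized.** With `t₄ = 1/60 − √(sd/n)`, `t₅ = 1/60 − √(s/p)`,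
`t₆ = 1/10 − √(s/p)`:  `P[‖√(pd/n)·V_A‖ ≥ √(8/7)] ≤ 5 exp(−n/28800)` and
`P[‖((pd/n)·V_Aᵀ V_A)⁻¹‖ ≥ 7/6] ≤ 5 exp(−n/28800)`, with `V_Aᵀ V_A` invertible on
the complementary event. -/
theorem stiefel_gram_concentration_specialized
    {Ω : Type*} [MeasurableSpace Ω] (P : Measure Ω) [IsProbabilityMeasure P]
    (n p d s : ℕ) (V : Ω → Matrix (Fin n) (Fin p × Fin d) ℝ)
    (hV : IsUniformStiefel P V)
    (T A : Finset (Fin p)) (hT : T.card = s) (hA : A ⊆ T)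
    (hpsd : n ≤ (p - s) * d)
    (h₁ : Real.sqrt ((s * d : ℕ) / (n : ℝ)) ≤ 1 / 120)
    (h₂ : Real.sqrt ((s : ℝ) / p) ≤ 1 / 120) :
    P {ω | Real.sqrt (8 / 7)
          ≤ specNorm (Real.sqrt ((p * d : ℕ) / (n : ℝ)) • blockCols (V ω) A)}
      ≤ ENNReal.ofReal (5 * Real.exp (-(n : ℝ) / 28800))
    ∧ P {ω | ¬ IsUnit (((p * d : ℕ) / (n : ℝ)) • ((blockCols (V ω) A)ᵀ * blockCols (V ω) A))
            ∨ (7 : ℝ) / 6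
              ≤ specNorm ((((p * d : ℕ) / (n : ℝ)) •
                  ((blockCols (V ω) A)ᵀ * blockCols (V ω) A))⁻¹)}
        ≤ ENNReal.ofReal (5 * Real.exp (-(n : ℝ) / 28800)) := by
  classical
  rcases Nat.eq_zero_or_pos n with hn | hn
  · have h5 : (1 : ℝ≥0∞) ≤ ENNReal.ofReal (5 * Real.exp (-(n : ℝ) / 28800)) := by
      rw [hn]
      norm_num
    exact ⟨prob_le_one.trans h5, prob_le_one.trans h5⟩
  obtain ⟨N, hN1, hN2, hN3⟩ :=
    SGC.exists_net (EuclideanSpace ℝ ({j // j ∈ A} × Fin d))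
  have hn' : (0 : ℝ) < n := by exact_mod_cast hn
  have hk : ((A.card * d : ℕ) : ℝ) ≤ n / 14400 := by
    have h3 : ((s * d : ℕ) : ℝ) / n ≤ (1 / 120) ^ 2 := (Real.sqrt_le_left (by norm_num)).1 h₁
    rw [div_le_iff₀ hn'] at h3
    have h4 : A.card * d ≤ s * d := Nat.mul_le_mul_right _ (hT ▸ Finset.card_le_card hA)
    have h5 : ((A.card * d : ℕ) : ℝ) ≤ ((s * d : ℕ) : ℝ) := by exact_mod_cast h4
    linarith
  have hfin : Module.finrank ℝ (EuclideanSpace ℝ ({j // j ∈ A} × Fin d)) = A.card * d := by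
    simp
  rw [hfin] at hN2
  let bad : Set Ω := ⋃ y ∈ N, {ω | (n : ℝ) / 14 ≤
    |(Fintype.card (Fin p × Fin d) : ℝ) * SGC.Q (V ω) (SGC.ext0 A y) - n|}
  have hbad : P bad ≤ ENNReal.ofReal (5 * Real.exp (-(n : ℝ) / 28800)) := by
    calc P bad ≤ ∑ y ∈ N, P {ω | (n : ℝ) / 14 ≤
          |(Fintype.card (Fin p × Fin d) : ℝ) * SGC.Q (V ω) (SGC.ext0 A y) - n|} :=
          measure_biUnion_finset_le _ _
      _ ≤ ∑ y ∈ N, ENNReal.ofReal (2 * Real.exp (-(n : ℝ) / 1568)) :=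
          Finset.sum_le_sum fun y hy =>
            SGC.tail P V hV _ ((SGC.norm_ext0 A y).trans (hN1 y hy))
      _ = ENNReal.ofReal (N.card * (2 * Real.exp (-(n : ℝ) / 1568))) := by
          rw [Finset.sum_const, nsmul_eq_mul, ENNReal.ofReal_mul (Nat.cast_nonneg N.card),
            ENNReal.ofReal_natCast]
      _ ≤ _ := ENNReal.ofReal_le_ofReal (SGC.final_num n _ _ hN2 hk)
  have hgood : ∀ ω, ω ∉ bad → _ := fun ω hω =>
    SGC.good hn A (V ω) N hN1 hN3 (fun y hy => by
      by_contra! hcon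
      exact hω (Set.mem_biUnion hy hcon))
  refine ⟨(measure_mono ?_).trans hbad, (measure_mono ?_).trans hbad⟩
  · intro ω hω
    by_contra hb
    exact absurd hω (not_le.2 (hgood ω hb).1)
  · intro ω hω
    by_contra hb
    obtain ⟨-, h2, h3⟩ := hgood ω hb
    rcases hω with h | h
    · exact h h2
    · exact absurd h (not_le.2 h3)
end
end
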